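/- Let τ>0, 0<R<R₀, and let f be a 1-periodic real analytic function with zero mean value that extends holomorphically and boundedly to a neighbourhood of the closed strip S̄_{R₀}. Then there exists c>0 (depending only on τ, R₀, f and R) such that for every M > 2ζ(1+τ) there is a function ũ_M ∈ C¹_hol(K_M, B_{R,ρ}) with ρ = c·M^{−8}, such that for every ω ∈ A_M^ℝ and every ε ∈ (−ρ,ρ): the function θ ∈ 𝕋 ↦ ũ_M(e^{2πiω})(θ,ε) is real-valued with zero mean value, the map θ ↦ θ + ũ_M(e^{2πiω})(θ,ε) is injective on ℝ, and u(θ) := ũ_M(e^{2πiω})(θ,ε) satisfies the second-order difference equation u(θ+ω) − 2u(θ) + u(θ−ω) = ε f(θ + u(θ)) for all θ ∈ 𝕋; consequently γ(θ) = (θ+u(θ), ω+u(θ)−u(θ−ω)) parametrizes an invariant graph of frequency ω for the standard map T_ε. -/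

import Mathlib

open Complex Metric Set OnePoint

noncomputable section

/-- Real Riemann zeta value `ζ(s) = Σ_{m≥1} m^{-s}` for real `s`. -/
def zetaR (s : ℝ) : ℝ := ∑' n : ℕ, 1 / (n + 1 : ℝ) ^ s

/-- The set `A_M^ℝ` of real `(2+τ)`-Diophantine numbers with constant `M`. -/
def AMR (τ M : ℝ) : Set ℝ :=
  {ω | ∀ n : ℤ, ∀ m : ℕ, 0 < m → 1 / (M * (m : ℝ) ^ (2 + τ)) ≤ |ω - n / m|}

/-- The complex extension `A_M^ℂ`. -/
def AMC (τ M : ℝ) : Set ℂ :=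
  {ω | ∃ ω₀ ∈ AMR τ M, |ω₀ - ω.re| ≤ |ω.im|}

/-- `E(ω) = e^{2πiω}`. -/
def Efn (ω : ℂ) : ℂ := Complex.exp (2 * Real.pi * Complex.I * ω)

/-- The compact set `K_M = E(A_M^ℂ) ∪ {0,∞}` in the Riemann sphere `Ĉ = ℂ ∪ {∞}`. -/
def KM (τ M : ℝ) : Set (OnePoint ℂ) :=
  (fun ω => ((Efn ω : ℂ) : OnePoint ℂ)) '' AMC τ M ∪ {((0 : ℂ) : OnePoint ℂ), ∞}

/-- The chart `ξ ↦ 1/ξ` of the Riemann sphere at `∞`. -/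
def sphChart (ξ : ℂ) : OnePoint ℂ := if ξ = 0 then ∞ else ((ξ⁻¹ : ℂ) : OnePoint ℂ)

/-- `K ∩ ℂ`, in the coordinate `q`. -/
def finPart (K : Set (OnePoint ℂ)) : Set ℂ := {q : ℂ | (q : OnePoint ℂ) ∈ K}
/-- `K̃ = {ξ : 1/ξ ∈ K}`, the set `K` read in the coordinate `ξ = 1/q`. -/
def infPart (K : Set (OnePoint ℂ)) : Set ℂ := {ξ : ℂ | sphChart ξ ∈ K}

variable {α : Type*} {B : Type*} [NormedAddCommGroup B] [NormedSpace ℂ B]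

/-- Difference quotient error `Ω_{u,g}(q,q') = (u(q')−u(q))/(q'−q) − g(q)`,
for functions with values in a space of functions on `α`. -/
def omegaF (u g : ℂ → α → B) (p : ℂ × ℂ) (a : α) : B :=
  if p.1 = p.2 then 0 else (p.2 - p.1)⁻¹ • (u p.2 a - u p.1 a) - g p.1 a

/-- Continuity on `K` for the sup-norm over `S` of the values. -/
def ContSup (K : Set ℂ) (S : Set α) (u : ℂ → α → B) : Prop :=
  ∀ q ∈ K, ∀ ε > (0 : ℝ), ∃ δ > (0 : ℝ), ∀ q' ∈ K, dist q' q < δ →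
    ∀ a ∈ S, ‖u q' a - u q a‖ ≤ ε

/-- Continuity on `K × K` for the sup-norm over `S` of the values. -/
def ContSup2 (K : Set ℂ) (S : Set α) (F : ℂ × ℂ → α → B) : Prop :=
  ∀ p ∈ K ×ˢ K, ∀ ε > (0 : ℝ), ∃ δ > (0 : ℝ), ∀ p' ∈ K ×ˢ K, dist p' p < δ →
    ∀ a ∈ S, ‖F p' a - F p a‖ ≤ ε

/-- `u` is `C¹`-holomorphic on `K ⊂ ℂ` with derivative `g`, with values in the
space of bounded functions on `S` (sup norm). -/
def FPair (K : Set ℂ) (S : Set α) (u g : ℂ → α → B) : Prop :=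
  ContSup K S u ∧ ContSup K S g ∧ ContSup2 K S (omegaF u g)

def fn0 (K : Set ℂ) (S : Set α) (u : ℂ → α → B) : ℝ :=
  sSup {x : ℝ | ∃ q ∈ K, ∃ a ∈ S, x = ‖u q a‖}
def fdel (K : Set ℂ) (S : Set α) (u : ℂ → α → B) : ℝ :=
  sSup {x : ℝ | ∃ p ∈ K ×ˢ K, ∃ a ∈ S, x = ‖u (Prod.snd p) a - u (Prod.fst p) a‖}
def fn2 (K : Set ℂ) (S : Set α) (u g : ℂ → α → B) : ℝ :=
  sSup {x : ℝ | ∃ p ∈ K ×ˢ K, ∃ a ∈ S, x = ‖omegaF u g p a‖}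

/-- The `C¹_hol` norm `n₀ + max(sup‖φ'‖, sup‖δφ‖) + n₂` (one chart). -/
def fNorm (K : Set ℂ) (S : Set α) (u g : ℂ → α → B) : ℝ :=
  fn0 K S u + max (fn0 K S g) (fdel K S u) + fn2 K S u g

def FBdd (K : Set ℂ) (S : Set α) (u g : ℂ → α → B) : Prop :=
  BddAbove {x : ℝ | ∃ q ∈ K, ∃ a ∈ S, x = ‖u q a‖} ∧
    BddAbove {x : ℝ | ∃ q ∈ K, ∃ a ∈ S, x = ‖g q a‖} ∧
    BddAbove {x : ℝ | ∃ p ∈ K ×ˢ K, ∃ a ∈ S, x = ‖omegaF u g p a‖}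

/-- `C¹`-holomorphy on a subset `K` of the Riemann sphere: `C¹`-holomorphy in
both charts `q` and `ξ = 1/q`, with chartwise derivatives `g` and `h`. -/
def SPair (K : Set (OnePoint ℂ)) (S : Set α) (u : OnePoint ℂ → α → B)
    (g h : ℂ → α → B) : Prop :=
  FPair (finPart K) S (fun q : ℂ => u (q : OnePoint ℂ)) g ∧
    FPair (infPart K) S (fun ξ : ℂ => u (sphChart ξ)) h

def SBdd (K : Set (OnePoint ℂ)) (S : Set α) (u : OnePoint ℂ → α → B)
    (g h : ℂ → α → B) : Prop :=
  FBdd (finPart K) S (fun q : ℂ => u (q : OnePoint ℂ)) g ∧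
    FBdd (infPart K) S (fun ξ : ℂ => u (sphChart ξ)) h

/-- The `C¹_hol(K,·)` norm for `K ⊂ Ĉ`: max of the norms in the two charts. -/
def sNorm (K : Set (OnePoint ℂ)) (S : Set α) (u : OnePoint ℂ → α → B)
    (g h : ℂ → α → B) : ℝ :=
  max (fNorm (finPart K) S (fun q : ℂ => u (q : OnePoint ℂ)) g)
    (fNorm (infPart K) S (fun ξ : ℂ => u (sphChart ξ)) h)

/-- The strip `S_r` (identified with `{x ∈ ℂ/ℤ : |Im x| < r}` via 1-periodicity). -/
def Strip (r : ℝ) : Set ℂ := {z : ℂ | |z.im| < r}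

/-- `S_r × D_ρ`, the domain of the elements of `B_{r,ρ} = H^∞(S_r × D_ρ)`. -/
def SD (r ρ : ℝ) : Set (ℂ × ℂ) := Strip r ×ˢ Metric.ball (0 : ℂ) ρ

/-- Membership of a value in `B_{r,ρ} = H^∞(S_r × D_ρ) = H^∞(S_r, B_ρ)`:
1-periodicity in `θ` and holomorphy on `S_r × D_ρ` (boundedness being part of
the `C¹_hol` data). -/
def ValHol (r ρ : ℝ) (v : ℂ × ℂ → ℂ) : Prop :=
  (∀ θ ε : ℂ, v (θ + 1, ε) = v (θ, ε)) ∧ DifferentiableOn ℂ v (SD r ρ)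

/-- `u ∈ C_r = C¹_hol(K_M, H^∞(S_r, B_ρ))`, with chartwise derivative data `g, h`. -/
def MemC (τ M r ρ : ℝ) (u : OnePoint ℂ → ℂ × ℂ → ℂ) (g h : ℂ → ℂ × ℂ → ℂ) : Prop :=
  SPair (KM τ M) (SD r ρ) u g h ∧ SBdd (KM τ M) (SD r ρ) u g h ∧
    ∀ q ∈ KM τ M, ValHol r ρ (u q)

/-- The norm `‖u‖_r` of `u ∈ C_r`, given its derivative data `g, h`. -/
def CNorm (τ M r ρ : ℝ) (u : OnePoint ℂ → ℂ × ℂ → ℂ) (g h : ℂ → ℂ × ℂ → ℂ) : ℝ :=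
  sNorm (KM τ M) (SD r ρ) u g h

/-- The `k`-th Fourier coefficient `φ̂_k(q) ∈ B_ρ` of `u(q) ∈ H^∞(S_r, B_ρ)`. -/
def fhat (u : OnePoint ℂ → ℂ × ℂ → ℂ) (k : ℤ) (q : OnePoint ℂ) (ε : ℂ) : ℂ :=
  ∫ t in (0:ℝ)..1, u q ((t : ℂ), ε) * Complex.exp (-(2 * Real.pi * Complex.I * k * t))

/-- `e_k(θ) = e^{2πikθ}`. -/
def ek (k : ℤ) (θ : ℂ) : ℂ := Complex.exp (2 * Real.pi * Complex.I * k * θ)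

/-- `up = u⁺`, i.e. `up(q,θ) = Σ_k q^k û_k(q) e_k(θ)` on `K_M` (for `q = e^{2πiω}`
this is `u(q, θ+ω)`). -/
def IsPlus (τ M r ρ : ℝ) (u up : OnePoint ℂ → ℂ × ℂ → ℂ) : Prop :=
  ∀ q : ℂ, (q : OnePoint ℂ) ∈ KM τ M → q ≠ 0 → ∀ θ ∈ Strip r,
    ∀ ε ∈ Metric.ball (0 : ℂ) ρ,
      HasSum (fun k : ℤ => q ^ k * fhat u k (q : OnePoint ℂ) ε * ek k θ)
        (up (q : OnePoint ℂ) (θ, ε))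

/-- `um = u⁻`, i.e. `um(q,θ) = Σ_k q^{-k} û_k(q) e_k(θ)`. -/
def IsMinus (τ M r ρ : ℝ) (u um : OnePoint ℂ → ℂ × ℂ → ℂ) : Prop :=
  ∀ q : ℂ, (q : OnePoint ℂ) ∈ KM τ M → q ≠ 0 → ∀ θ ∈ Strip r,
    ∀ ε ∈ Metric.ball (0 : ℂ) ρ,
      HasSum (fun k : ℤ => q ^ (-k) * fhat u k (q : OnePoint ℂ) ε * ek k θ)
        (um (q : OnePoint ℂ) (θ, ε))

/-- The derivative `∂_θ` acting on values. -/
def dth (v : OnePoint ℂ → ℂ × ℂ → ℂ) (q : OnePoint ℂ) (p : ℂ × ℂ) : ℂ :=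
  deriv (fun t => v q (t, p.2)) p.1

/-- Real-symmetry (`u ∈ C_{r,ℝ}`): `conj(û_k(q)) = û_{-k}(1/q̄)` where
`(conj ψ)(ε) = conj(ψ(ε̄))` in `B_ρ`. -/
def RealSym (τ M : ℝ) (u : OnePoint ℂ → ℂ × ℂ → ℂ) : Prop :=
  ∀ k : ℤ, ∀ q : ℂ, (q : OnePoint ℂ) ∈ KM τ M → q ≠ 0 → ∀ ε : ℂ,
    starRingEnd ℂ (fhat u k (q : OnePoint ℂ) (starRingEnd ℂ ε)) =
      fhat u (-k) (((((starRingEnd ℂ) q)⁻¹ : ℂ) : OnePoint ℂ)) ε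

namespace KAM

/-- Formal power series in `x = e^{2πiθ}`, `y = e^{-2πiθ}` and `ε`. -/
abbrev PS (R : Type*) := MvPowerSeries (Fin 3) R

/-- The Fourier index of the monomial `x^{m 0} y^{m 1} ε^{m 2}`. -/
def chg (m : Fin 3 →₀ ℕ) : ℤ := m 0 - m 1

lemma chg_add (m n : Fin 3 →₀ ℕ) : chg (m + n) = chg m + chg n := by
  simp [chg]; ring

section Formal

variable {R : Type*} [CommRing R]

/-- The Fourier multiplier with symbol `μ`. -/
def fmul (μ : ℤ → R) : PS R →ₗ[R] PS R where
  toFun u := fun m => μ (chg m) * MvPowerSeries.coeff m u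
  map_add' u v := by
    funext m
    exact (congrArg (μ (chg m) * ·) (map_add (MvPowerSeries.coeff m) u v)).trans (mul_add _ _ _)
  map_smul' c u := by
    funext m
    exact mul_left_comm _ _ _

@[simp] lemma coeff_fmul (μ : ℤ → R) (u : PS R) (m : Fin 3 →₀ ℕ) :
    MvPowerSeries.coeff m (fmul μ u) = μ (chg m) * MvPowerSeries.coeff m u := rfl

lemma fmul_fmul (μ ν : ℤ → R) (u : PS R) :
    fmul μ (fmul ν u) = fmul (fun k => μ k * ν k) u := by
  ext m; simp [mul_assoc]

lemma fmul_congr {μ ν : ℤ → R} (h : ∀ k, μ k = ν k) (u : PS R) : fmul μ u = fmul ν u := by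
  rw [funext h]

lemma fmul_comm (μ ν : ℤ → R) (u : PS R) : fmul μ (fmul ν u) = fmul ν (fmul μ u) := by
  rw [fmul_fmul, fmul_fmul]; exact fmul_congr (fun k => mul_comm _ _) u

lemma fmul_mul_of_mul {μ : ℤ → R} (h : ∀ i j, μ (i + j) = μ i * μ j) (u v : PS R) :
    fmul μ (u * v) = fmul μ u * fmul μ v := by
  classical
  ext m
  simp only [coeff_fmul, MvPowerSeries.coeff_mul, Finset.mul_sum]
  refine Finset.sum_congr rfl fun p hp => ?_
  rw [← Finset.HasAntidiagonal.mem_antidiagonal.1 hp, chg_add, h]; ring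

/-- The derivation `D = (2πi)⁻¹ ∂_θ`. -/
def dD : PS R →ₗ[R] PS R := fmul fun k => (k : R)

lemma dD_mul (u v : PS R) : dD (u * v) = dD u * v + u * dD v := by
  classical
  ext m
  simp only [dD, map_add, coeff_fmul, MvPowerSeries.coeff_mul, Finset.mul_sum,
    ← Finset.sum_add_distrib]
  refine Finset.sum_congr rfl fun p hp => ?_
  rw [← Finset.HasAntidiagonal.mem_antidiagonal.1 hp, chg_add]; push_cast; ring

lemma dD_one : dD (1 : PS R) = 0 := by
  have := dD_mul (1 : PS R) 1
  simp only [mul_one, one_mul] at this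
  simpa using this

lemma dD_pow (u : PS R) (n : ℕ) : dD (u ^ n) = n * u ^ (n - 1) * dD u := by
  induction n with
  | zero => simp [dD_one]
  | succ n ih =>
    rw [pow_succ, dD_mul, ih]
    rcases n with _ | n
    · simp
    · simp only [Nat.add_sub_cancel]; push_cast; ring

/-- The mean value (charge-zero part). -/
def mean : PS R →ₗ[R] PS R := fmul fun k => if k = 0 then 1 else 0

lemma mean_fmul (μ : ℤ → R) (u : PS R) : mean (fmul μ u) = fmul (fun k => if k = 0 then μ 0 else 0) u := by
  rw [mean, fmul_fmul]; exact fmul_congr (fun k => by split_ifs with h <;> simp [h]) u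

lemma mean_fmul_zero {μ : ℤ → R} (h : μ 0 = 0) (u : PS R) : mean (fmul μ u) = 0 := by
  rw [mean_fmul]; ext m; simp [h]

lemma mean_dD (u : PS R) : mean (dD u) = 0 := mean_fmul_zero (by simp) u

lemma mean_mul (u v : PS R) : mean (mean u * v) = mean u * mean v := by
  classical
  ext m
  simp only [mean, coeff_fmul, MvPowerSeries.coeff_mul, Finset.mul_sum]
  refine Finset.sum_congr rfl fun p hp => ?_
  rw [← Finset.HasAntidiagonal.mem_antidiagonal.1 hp, chg_add]
  by_cases h : chg p.1 = 0 <;> simp [h]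

lemma mean_mul' (u v : PS R) : mean (u * mean v) = mean u * mean v := by
  rw [mul_comm, mean_mul, mul_comm]

variable (q : Rˣ)

/-- The shift `θ ↦ θ + ω`, `q = e^{2πiω}`. -/
def sh : PS R →ₗ[R] PS R := fmul fun k => ((q ^ k : Rˣ) : R)

lemma sh_mul (u v : PS R) : sh q (u * v) = sh q u * sh q v :=
  fmul_mul_of_mul (fun i j => by rw [zpow_add]; simp) u v

lemma sh_one : sh q (1 : PS R) = 1 := by
  classical
  ext m
  simp only [sh, coeff_fmul, MvPowerSeries.coeff_one]
  split_ifs with h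
  · simp [h, chg]
  · simp

lemma sh_inv_sh (u : PS R) : sh q⁻¹ (sh q u) = u := by
  rw [sh, sh, fmul_fmul]
  ext m; simp [← Units.val_mul]

lemma mean_sh (u : PS R) : mean (sh q u) = mean u := by
  rw [sh, mean_fmul, mean]; exact fmul_congr (fun k => by simp) u

/-- The second difference operator. -/
def lap (u : PS R) : PS R := sh q u - 2 * u + sh q⁻¹ u

lemma lap_eq (u : PS R) :
    lap q u = fmul (fun k => ((q ^ k : Rˣ) : R) - 2 + ((q⁻¹ ^ k : Rˣ) : R)) u := by
  ext m
  have : MvPowerSeries.coeff m ((2 : PS R) * u) = 2 * MvPowerSeries.coeff m u := by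
    rw [two_mul, map_add]; ring
  simp only [lap, map_add, map_sub, this, sh, coeff_fmul]; ring

lemma lap_sub (u v : PS R) : lap q (u - v) = lap q u - lap q v := by
  simp only [lap_eq, map_sub]

lemma lap_dD (u : PS R) : lap q (1 + dD u) = dD (lap q u) := by
  have : lap q (1 + dD u) = lap q (dD u) := by
    simp only [lap, map_add, sh_one]; ring
  rw [this, lap_eq, lap_eq, dD, fmul_comm]

lemma mean_lap (u : PS R) : mean (lap q u) = 0 := by
  rw [lap_eq]; exact mean_fmul_zero (by simp; ring) u

lemma mean_dD_mul_lap (u : PS R) : mean (dD u * lap q u) = 0 := by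
  have e : dD u * lap q u = dD (u * sh q u) - u * sh q (dD u)
      + sh q⁻¹ (sh q (dD u) * u) - dD (u * u) := by
    have : dD (sh q u) = sh q (dD u) := fmul_comm _ _ u
    rw [dD_mul, dD_mul, sh_mul, sh_inv_sh, this, lap]; ring
  rw [e, map_sub, map_add, map_sub, mean_dD, mean_dD, mean_sh, mul_comm u]; ring

/-- The variable `ε`. -/
def eps : PS R := MvPowerSeries.X 2

lemma eps_pow_dvd {n : ℕ} {u : PS R} :
    eps ^ n ∣ u ↔ ∀ m : Fin 3 →₀ ℕ, m 2 < n → MvPowerSeries.coeff m u = 0 :=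
  MvPowerSeries.X_pow_dvd_iff

lemma eps_pow_dvd_ext {u v : PS R} (h : ∀ J, eps ^ J ∣ u - v) : u = v := by
  ext m
  have := eps_pow_dvd.1 (h (m 2 + 1)) m (Nat.lt_succ_self _)
  rw [map_sub] at this; exact sub_eq_zero.1 this

lemma eps_dvd_fmul {n : ℕ} {u : PS R} (μ : ℤ → R) (h : eps ^ n ∣ u) : eps ^ n ∣ fmul μ u := by
  rw [eps_pow_dvd] at *
  intro m hm; simp [h m hm]

lemma fmul_eps_mul (μ : ℤ → R) (u : PS R) : fmul μ (eps * u) = eps * fmul μ u := by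
  classical
  ext m
  rw [coeff_fmul, eps, mul_comm (MvPowerSeries.X 2) u, mul_comm (MvPowerSeries.X 2) (fmul μ u),
    MvPowerSeries.X, MvPowerSeries.coeff_mul_monomial, MvPowerSeries.coeff_mul_monomial, coeff_fmul]
  split_ifs with h
  · have : chg (m - Finsupp.single 2 1) = chg m := by
      simp [chg]
    rw [this]; ring
  · simp

lemma eps_lap {n : ℕ} {u : PS R} (h : eps ^ n ∣ u) : eps ^ n ∣ lap q u := by
  rw [lap_eq]; exact eps_dvd_fmul _ h

end Formal

section Equation

variable {R : Type*} [CommRing R] [Algebra ℂ R]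

/-- The Taylor coefficient `D^j G₀ / j!`. -/
def tay (G₀ : PS R) (j : ℕ) : PS R :=
  fmul (fun k => algebraMap ℂ R ((k : ℂ) ^ j / (j.factorial : ℂ))) G₀

lemma tay_succ (G₀ : PS R) (j : ℕ) : ((j : PS R) + 1) * tay G₀ (j + 1) = dD (tay G₀ j) := by
  ext m
  have e : ((j : PS R) + 1) * tay G₀ (j + 1) = (j + 1) • tay G₀ (j + 1) := by
    rw [nsmul_eq_mul]; push_cast; rfl
  rw [e, dD, tay, tay, fmul_fmul]
  rw [map_nsmul, nsmul_eq_mul, coeff_fmul, coeff_fmul, ← mul_assoc]; congr 1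
  have h1 : (((j + 1 : ℕ) : R)) = algebraMap ℂ R ((j + 1 : ℕ) : ℂ) := by simp
  have h2 : ((chg m : ℤ) : R) = algebraMap ℂ R ((chg m : ℤ) : ℂ) := by simp
  rw [h1, h2, ← map_mul, ← map_mul]; congr 1
  have h3 : ((j : ℂ) + 1) ≠ 0 := by exact_mod_cast Nat.succ_ne_zero j
  have h4 : (j.factorial : ℂ) ≠ 0 := by exact_mod_cast Nat.factorial_ne_zero j
  rw [Nat.factorial_succ]; push_cast
  field_simp
  ring

/-- The truncated Taylor expansion of `G(θ + v)`. -/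
def comp (G₀ : PS R) (J : ℕ) (v : PS R) : PS R := ∑ j ∈ Finset.range J, tay G₀ j * v ^ j

/-- The derivative of `comp` with respect to `v`. -/
def comp' (G₀ : PS R) (J : ℕ) (v : PS R) : PS R :=
  ∑ j ∈ Finset.range J, tay G₀ j * (j * v ^ (j - 1))

lemma sub_dvd_comp (G₀ : PS R) (J : ℕ) (u v : PS R) : u - v ∣ comp G₀ J u - comp G₀ J v := by
  rw [comp, comp, ← Finset.sum_sub_distrib]
  refine Finset.dvd_sum fun j _ => ?_
  rw [← mul_sub]; exact Dvd.dvd.mul_left (sub_dvd_pow_sub_pow u v j) _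

lemma comp_taylor (G₀ : PS R) (J : ℕ) (v h : PS R) :
    h ^ 2 ∣ comp G₀ J (v + h) - comp G₀ J v - comp' G₀ J v * h := by
  rw [comp, comp, comp', Finset.sum_mul, ← Finset.sum_sub_distrib, ← Finset.sum_sub_distrib]
  refine Finset.dvd_sum fun j _ => ?_
  obtain ⟨k, hk⟩ := Polynomial.powAddExpansion v h j
  rw [hk]; exact ⟨tay G₀ j * k, by ring⟩

lemma dD_comp (G₀ : PS R) (J : ℕ) (v : PS R) :
    dD (comp G₀ J v) = comp' G₀ J v * (1 + dD v) + J * tay G₀ J * v ^ (J - 1) := by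
  induction J with
  | zero => simp [comp, comp']
  | succ J ih =>
    have e1 : comp G₀ (J + 1) v = comp G₀ J v + tay G₀ J * v ^ J := Finset.sum_range_succ _ _
    have e2 : comp' G₀ (J + 1) v = comp' G₀ J v + tay G₀ J * (J * v ^ (J - 1)) :=
      Finset.sum_range_succ _ _
    rw [e1, e2, map_add, ih, dD_mul, dD_pow, ← tay_succ, Nat.add_sub_cancel]
    push_cast; ring

/-- A primitive of `G₀`. -/
def prim (G₀ : PS R) : PS R := fmul (fun k => algebraMap ℂ R ((k : ℂ)⁻¹)) G₀

lemma dD_prim {G₀ : PS R} (h : mean G₀ = 0) : dD (prim G₀) = G₀ := by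
  ext m
  have := congrArg (MvPowerSeries.coeff m) h
  simp only [mean, coeff_fmul, map_zero] at this
  rw [dD, prim, fmul_fmul, coeff_fmul]
  by_cases hm : chg m = 0
  · simp only [hm, if_true, one_mul] at this; simp [this]
  · have h2 : ((chg m : ℤ) : R) = algebraMap ℂ R ((chg m : ℤ) : ℂ) := by simp
    rw [h2, ← map_mul, mul_inv_cancel₀ (by exact_mod_cast hm), map_one, one_mul]

lemma comp'_prim {G₀ : PS R} (h : mean G₀ = 0) (J : ℕ) (v : PS R) :
    comp' (prim G₀) (J + 1) v = comp G₀ J v := by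
  rw [comp', Finset.sum_range_succ', comp]
  simp only [Nat.cast_zero, zero_mul, mul_zero, add_zero, Nat.add_sub_cancel]
  refine Finset.sum_congr rfl fun j _ => ?_
  have : tay G₀ j = dD (tay (prim G₀) j) := by
    conv_lhs => rw [← dD_prim h]
    rw [tay, dD, fmul_comm]; rfl
  rw [this, ← tay_succ]; push_cast; ring

variable (b : ℤ → R) (G₀ : PS R)

/-- `u` is the formal solution of `u = Δ⁻¹ (ε G(θ + u))`, `Δ⁻¹` having symbol `b`. -/
def IsSol (u : PS R) : Prop := ∀ J, eps ^ J ∣ u - fmul b (eps * comp G₀ J u)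

variable {b G₀}

lemma IsSol.eps_dvd {u : PS R} (h : IsSol b G₀ u) : eps ∣ u := by
  have h1 := h 1
  rw [pow_one, fmul_eps_mul] at h1
  have := dvd_add h1 (dvd_mul_right eps (fmul b (comp G₀ 1 u)))
  simpa using this

lemma IsSol.unique {u v : PS R} (hu : IsSol b G₀ u) (hv : IsSol b G₀ v) : u = v := by
  refine eps_pow_dvd_ext fun J => ?_
  induction J with
  | zero => simp
  | succ J ih =>
    have e : u - v = (u - fmul b (eps * comp G₀ (J + 1) u)) - (v - fmul b (eps * comp G₀ (J + 1) v))
      + eps * fmul b (comp G₀ (J + 1) u - comp G₀ (J + 1) v) := by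
      rw [map_sub, fmul_eps_mul, fmul_eps_mul]; ring
    rw [e]
    refine dvd_add (dvd_sub (hu _) (hv _)) ?_
    rw [pow_succ']
    exact mul_dvd_mul_left _ (eps_dvd_fmul _ (ih.trans (sub_dvd_comp _ _ _ _)))

/-- Picard iterates. -/
def picard (b : ℤ → R) (G₀ : PS R) : ℕ → PS R
  | 0 => 0
  | n + 1 => fmul b (eps * comp G₀ n (picard b G₀ n))

lemma eps_dvd_picard (n : ℕ) : eps ∣ picard b G₀ n := by
  cases n with
  | zero => simp [picard]
  | succ n => rw [picard, fmul_eps_mul]; exact dvd_mul_right _ _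

lemma picard_step (n : ℕ) : eps ^ n ∣ picard b G₀ (n + 1) - picard b G₀ n := by
  induction n with
  | zero => simp
  | succ n ih =>
    have e : picard b G₀ (n + 1 + 1) - picard b G₀ (n + 1) =
        eps * fmul b (tay G₀ n * picard b G₀ (n + 1) ^ n
          + (comp G₀ n (picard b G₀ (n + 1)) - comp G₀ n (picard b G₀ n))) := by
      conv_lhs => rw [picard]
      conv_lhs => arg 2; rw [picard]
      rw [← map_sub, ← mul_sub, fmul_eps_mul, comp, Finset.sum_range_succ, ← comp]
      congr 2; ring
    rw [e, pow_succ']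
    refine mul_dvd_mul_left _ (eps_dvd_fmul _ (dvd_add ?_ (ih.trans (sub_dvd_comp _ _ _ _))))
    exact Dvd.dvd.mul_left (pow_dvd_pow_of_dvd (eps_dvd_picard _) n) _

lemma picard_stab {n n' : ℕ} (h : n ≤ n') : eps ^ n ∣ picard b G₀ n' - picard b G₀ n := by
  induction n', h using Nat.le_induction with
  | base => simp
  | succ k hk ih =>
    have := dvd_add ((pow_dvd_pow eps hk).trans (picard_step (b := b) (G₀ := G₀) k)) ih
    simpa using this

variable (b G₀) in
/-- The formal solution. -/
def sol : PS R := fun m => MvPowerSeries.coeff m (picard b G₀ (m 2 + 1))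

lemma sol_sub_picard (n : ℕ) : eps ^ n ∣ sol b G₀ - picard b G₀ n := by
  rw [eps_pow_dvd]
  intro m hm
  have h1 : MvPowerSeries.coeff m (sol b G₀) = MvPowerSeries.coeff m (picard b G₀ (m 2 + 1)) := rfl
  have h2 := eps_pow_dvd.1 (picard_stab (b := b) (G₀ := G₀) (Nat.succ_le_of_lt hm)) m
    (Nat.lt_succ_self _)
  rw [map_sub] at h2 ⊢
  rw [h1, ← sub_eq_zero.1 h2, sub_self]

lemma isSol_sol : IsSol b G₀ (sol b G₀) := by
  intro J
  have e : sol b G₀ - fmul b (eps * comp G₀ J (sol b G₀)) =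
    (sol b G₀ - picard b G₀ (J + 1)) -
      eps * fmul b (comp G₀ J (sol b G₀) - comp G₀ J (picard b G₀ J)) := by
    conv_rhs => rw [picard]
    rw [map_sub, mul_sub, ← fmul_eps_mul, ← fmul_eps_mul]; ring
  rw [e]
  refine dvd_sub ((pow_dvd_pow _ J.le_succ).trans (sol_sub_picard _)) (Dvd.dvd.mul_left ?_ _)
  exact eps_dvd_fmul _ ((sol_sub_picard J).trans (sub_dvd_comp _ _ _ _))

end Equation
section Newton

variable {R : Type*} [CommRing R] {q : Rˣ} {a : ℤ → R} {G₀ : PS R}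

lemma mean_one : mean (1 : PS R) = 1 := by
  classical
  ext m
  simp only [mean, coeff_fmul, MvPowerSeries.coeff_one]
  split_ifs with h1 h2 <;> simp_all [chg]

/-- `a` is the symbol of the inverse of `u ↦ u(θ + ω) - u(θ)` on mean-zero functions. -/
structure IsDivisor (q : Rˣ) (a : ℤ → R) : Prop where
  zero : a 0 = 0
  mul : ∀ k ≠ 0, a k * ((q ^ k : Rˣ) - 1) = 1

/-- The symbol of the inverse of `u ↦ u(θ) - u(θ - ω)` on mean-zero functions. -/
def adj (a : ℤ → R) (k : ℤ) : R := if k = 0 then 0 else 1 + a k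

/-- The symbol of the inverse of `lap q` on mean-zero functions. -/
def dbl (a : ℤ → R) (k : ℤ) : R := a k * (1 + a k)

lemma IsDivisor.fmul_sub (ha : IsDivisor q a) (w : PS R) : fmul a (sh q w - w) = w - mean w := by
  ext m
  simp only [map_sub, coeff_fmul, sh, mean]
  by_cases h : chg m = 0
  · simp [h, ha.zero]
  · rw [if_neg h]; linear_combination MvPowerSeries.coeff m w * ha.mul _ h

lemma IsDivisor.fmul_adj (ha : IsDivisor q a) (g : PS R) :
    fmul (adj a) (g - sh q⁻¹ g) = g - mean g := by
  ext m
  simp only [map_sub, coeff_fmul, sh, mean, adj]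
  by_cases h : chg m = 0
  · simp [h]
  · have hq : ((q ^ chg m : Rˣ) : R) * ((q⁻¹ ^ chg m : Rˣ) : R) = 1 := by
      rw [← Units.val_mul]; simp
    simp only [if_neg h]
    linear_combination (MvPowerSeries.coeff m g) * ((q⁻¹ ^ chg m : Rˣ) : R) * ha.mul _ h
      - (MvPowerSeries.coeff m g) * a (chg m) * hq

lemma IsDivisor.lap_dbl (ha : IsDivisor q a) (g : PS R) :
    lap q (fmul (dbl a) g) = g - mean g := by
  rw [lap_eq, fmul_fmul]
  ext m
  simp only [map_sub, coeff_fmul, mean, dbl]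
  by_cases h : chg m = 0
  · simp [h, ha.zero]
  · have hq : ((q ^ chg m : Rˣ) : R) * ((q⁻¹ ^ chg m : Rˣ) : R) = 1 := by
      rw [← Units.val_mul]; simp
    have h1 := ha.mul _ h
    simp only [if_neg h]
    generalize ((q ^ chg m : Rˣ) : R) = x at *
    generalize ((q⁻¹ ^ chg m : Rˣ) : R) = y at *
    generalize a (chg m) = α at *
    have e : (x - 2 + y) * (α * (1 + α)) = 1 := by
      have e1 : 1 + α = α * x := by linear_combination -h1
      have e2 : x - 2 + y = (x - 1) ^ 2 * y := by linear_combination (2 - x) * hq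
      rw [e1, e2]
      linear_combination (x * y * (α * (x - 1) + 1)) * h1 + hq
    rw [e]; ring

lemma eps_dvd_mean {n : ℕ} {u : PS R} (h : eps ^ n ∣ u) : eps ^ n ∣ mean u := eps_dvd_fmul _ h

lemma eps_dvd_eps_mul_pow {u : PS R} (h : eps ∣ u) {J : ℕ} (hJ : J ≠ 0) (x : PS R) :
    eps ^ J ∣ eps * (x * u ^ (J - 1)) := by
  obtain ⟨J, rfl⟩ := Nat.exists_eq_succ_of_ne_zero hJ
  rw [Nat.succ_eq_add_one, Nat.add_sub_cancel, pow_succ']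
  exact mul_dvd_mul_left _ (Dvd.dvd.mul_left (pow_dvd_pow_of_dvd h _) _)

variable [Algebra ℂ R] (ha : IsDivisor q a) (hG : mean G₀ = 0) {u : PS R} (hu : IsSol (dbl a) G₀ u)
include ha hu

lemma mean_sol : mean u = 0 := by
  refine eps_pow_dvd_ext fun J => ?_
  have h := eps_dvd_mean (hu J)
  rwa [map_sub, mean_fmul_zero (by simp [dbl, ha.zero])] at h

include hG

/-- The formal solution solves the second-order difference equation. -/
lemma lap_sol (J : ℕ) : eps ^ J ∣ lap q u - eps * comp G₀ J u := by
  have h1 : eps ^ J ∣ lap q u - (eps * comp G₀ J u - mean (eps * comp G₀ J u)) := by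
    have := eps_lap q (hu J)
    rwa [lap_sub, ha.lap_dbl] at this
  have h2 : eps ^ J ∣ mean ((1 + dD u) * (eps * comp G₀ J u)) := by
    have e := dD_comp (prim G₀) (J + 1) u
    rw [comp'_prim hG, Nat.add_sub_cancel] at e
    have e' : (1 + dD u) * (eps * comp G₀ J u) = dD (eps * comp (prim G₀) (J + 1) u)
        - eps * (((J + 1 : ℕ) : PS R) * tay (prim G₀) (J + 1) * u ^ (J + 1 - 1)) := by
      rw [dD, fmul_eps_mul, ← dD, e, Nat.add_sub_cancel]; ring
    rw [e', map_sub, mean_dD, zero_sub, dvd_neg]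
    exact (pow_dvd_pow _ J.le_succ).trans
      (eps_dvd_mean (eps_dvd_eps_mul_pow hu.eps_dvd J.succ_ne_zero _))
  have h3 : mean ((1 + dD u) * lap q u) = 0 := by
    rw [add_mul, one_mul, map_add, mean_lap, mean_dD_mul_lap, add_zero]
  have h4 : mean ((1 + dD u) * mean (eps * comp G₀ J u)) = mean (eps * comp G₀ J u) := by
    rw [mean_mul', map_add, mean_one, mean_dD, add_zero, one_mul]
  have h5 := eps_dvd_mean (h1.mul_left (1 + dD u))
  rw [mul_sub, mul_sub, map_sub, map_sub, h3, h4] at h5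
  have h6 := dvd_sub h1 (dvd_add h5 h2)
  ring_nf at h6 ⊢
  exact h6

/-- One Newton step: the linearized equation, solved up to quadratically small terms. -/
lemma newton {N : ℕ} (hN : N ≠ 0) {v : PS R} (hv : eps ^ N ∣ u - v) :
    eps ^ N ∣ lap q v - eps * comp G₀ (2 * N) v ∧
    ∃ w, u - v = (1 + dD v) * w ∧
      ∀ g, g = (1 + dD v) * sh q (1 + dD v) * (sh q w - w) →
      eps ^ (2 * N) ∣
        g - mean g + fmul (adj a) ((1 + dD v) * (lap q v - eps * comp G₀ (2 * N) v)) := by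
  have hvε : eps ∣ v := by
    have := dvd_sub hu.eps_dvd ((dvd_pow_self eps hN).trans hv)
    simpa using this
  have hs := lap_sol ha hG hu (2 * N)
  have he : eps ^ N ∣ lap q v - eps * comp G₀ (2 * N) v := by
    have e : lap q v - eps * comp G₀ (2 * N) v = (lap q u - eps * comp G₀ (2 * N) u)
        - lap q (u - v) + eps * (comp G₀ (2 * N) u - comp G₀ (2 * N) v) := by
      rw [lap_sub]; ring
    rw [e]
    exact dvd_add (dvd_sub ((pow_dvd_pow _ (by lia)).trans hs) (eps_lap q hv))
      (Dvd.dvd.mul_left (hv.trans (sub_dvd_comp _ _ _ _)) _)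
  refine ⟨he, ?_⟩
  set e := lap q v - eps * comp G₀ (2 * N) v with he_def
  set A := 1 + dD v with hA
  have hAu : IsUnit A := by
    rw [MvPowerSeries.isUnit_iff_constantCoeff]
    have : MvPowerSeries.constantCoeff (dD v) = 0 := by
      rw [← MvPowerSeries.coeff_zero_eq_constantCoeff_apply, dD, coeff_fmul]; simp [chg]
    rw [hA, map_add, this]; simp
  obtain ⟨Y, hY⟩ := hAu.exists_right_inv
  refine ⟨Y * (u - v), by rw [← mul_assoc, hY, one_mul], ?_⟩
  rintro g hg
  set w := Y * (u - v) with hw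
  have hwv : u - v = A * w := by rw [hw, ← mul_assoc, hY, one_mul]
  have hlin : eps ^ (2 * N) ∣ A * lap q (u - v) - (u - v) * lap q A + A * e := by
    obtain ⟨k, hk⟩ := comp_taylor G₀ (2 * N) v (u - v)
    rw [add_sub_cancel] at hk
    have hD := dD_comp G₀ (2 * N) v
    rw [← hA] at hD
    have hDe : dD e = lap q A - eps * dD (comp G₀ (2 * N) v) := by
      rw [he_def, map_sub, hA, lap_dD, dD, fmul_eps_mul]
    have h2 : eps ^ (2 * N) ∣ (u - v) * dD e := by
      rw [two_mul, pow_add]; exact mul_dvd_mul hv (eps_dvd_fmul _ he)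
    have h3 : eps ^ (2 * N) ∣ (u - v) ^ 2 := by
      rw [mul_comm, pow_mul]; exact pow_dvd_pow_of_dvd hv 2
    have h4 := eps_dvd_eps_mul_pow hvε (J := 2 * N) (by lia) (((2 * N : ℕ) : PS R) * tay G₀ (2 * N))
    have e1 : A * lap q (u - v) - (u - v) * lap q A + A * e
        = A * (lap q u - eps * comp G₀ (2 * N) u) + A * eps * k * (u - v) ^ 2
          - (u - v) * dD e
          - (u - v) * (eps * (((2 * N : ℕ) : PS R) * tay G₀ (2 * N) * v ^ (2 * N - 1))) := by
      rw [lap_sub]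
      linear_combination A * he_def + A * eps * hk + (u - v) * hDe - (u - v) * eps * hD
    rw [e1]
    exact dvd_sub (dvd_sub (dvd_add (hs.mul_left _) (h3.mul_left _)) h2) (h4.mul_left _)
  have hgid : A * lap q (u - v) - (u - v) * lap q A = g - sh q⁻¹ g := by
    rw [hwv, hg]
    simp only [lap, sh_mul, map_sub, sh_inv_sh]
    ring
  rw [hgid] at hlin
  have := eps_dvd_fmul (adj a) hlin
  rwa [map_add, ha.fmul_adj] at this

end Newton
section Norms

open scoped ENNReal

/-- A submultiplicative seminorm on a complex algebra, possibly taking the value `∞`. -/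
structure IsSeminorm {R : Type*} [CommRing R] [Algebra ℂ R] (ν : R → ℝ≥0∞) : Prop where
  add_le : ∀ a b, ν (a + b) ≤ ν a + ν b
  mul_le : ∀ a b, ν (a * b) ≤ ν a * ν b
  const_le : ∀ c : ℂ, ν (algebraMap ℂ R c) ≤ ENNReal.ofReal ‖c‖

/-- The weight of a monomial for the strip of half-width `s / (2π)` and the disc of radius `ρ`. -/
def wt (s ρ : ℝ) (m : Fin 3 →₀ ℕ) : ℝ≥0∞ := ENNReal.ofReal (Real.exp (s * (m 0 + m 1)) * ρ ^ m 2)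

/-- The weighted `ℓ¹` norm of the part of degree `< J` in `ε`. -/
def Nm {R : Type*} [CommRing R] (ν : R → ℝ≥0∞) (s ρ : ℝ) (J : ℕ) (u : PS R) : ℝ≥0∞ :=
  ∑' m : Fin 3 →₀ ℕ, if m 2 < J then ν (MvPowerSeries.coeff m u) * wt s ρ m else 0

/-- The weighted norm of `u` up to degree `J` in `ε` is at most `x`. -/
def Bd {R : Type*} [CommRing R] (ν : R → ℝ≥0∞) (s ρ : ℝ) (J : ℕ) (u : PS R) (x : ℝ) : Prop :=
  0 ≤ x ∧ Nm ν s ρ J u ≤ ENNReal.ofReal x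

lemma wt_add {s ρ : ℝ} (hρ : 0 ≤ ρ) (m n : Fin 3 →₀ ℕ) : wt s ρ (m + n) = wt s ρ m * wt s ρ n := by
  rw [wt, wt, wt, ← ENNReal.ofReal_mul (by positivity)]
  congr 1
  simp only [Finsupp.coe_add, Pi.add_apply, Nat.cast_add, pow_add]
  rw [show s * ((m 0 + n 0 : ℝ) + (m 1 + n 1)) = s * (m 0 + m 1) + s * (n 0 + n 1) by ring,
    Real.exp_add]
  ring

lemma abs_chg_le (m : Fin 3 →₀ ℕ) : |(chg m : ℝ)| ≤ m 0 + m 1 := by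
  have h0 : (0 : ℝ) ≤ m 0 := Nat.cast_nonneg _
  have h1 : (0 : ℝ) ≤ m 1 := Nat.cast_nonneg _
  rw [chg, abs_le]; push_cast; constructor <;> linarith

variable {R : Type*} [CommRing R] [Algebra ℂ R] {ν : R → ℝ≥0∞} (hν : IsSeminorm ν)
include hν

namespace IsSeminorm

lemma zero : ν 0 = 0 := by
  have := hν.const_le 0; simpa using this

lemma one_le : ν 1 ≤ 1 := by
  have := hν.const_le 1; simpa using this

lemma neg_le (a : R) : ν (-a) ≤ ν a := by
  have h := hν.mul_le (algebraMap ℂ R (-1)) a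
  have h1 := hν.const_le (-1)
  simp only [map_neg, map_one, norm_neg, norm_one, ENNReal.ofReal_one, neg_mul, one_mul] at h h1
  exact h.trans ((mul_le_mul_left h1 _).trans (one_mul _).le)

lemma sum_le {ι : Type*} (s : Finset ι) (f : ι → R) : ν (∑ i ∈ s, f i) ≤ ∑ i ∈ s, ν (f i) := by
  classical
  induction s using Finset.induction_on with
  | empty => simp [hν.zero]
  | insert i s hi ih =>
    rw [Finset.sum_insert hi, Finset.sum_insert hi]
    exact (hν.add_le _ _).trans (by gcongr)

end IsSeminorm

variable {s s' ρ ρ' x y : ℝ} {J N : ℕ} {u v : PS R}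

omit [Algebra ℂ R] hν in
lemma Nm_mono_coeff (h : ∀ m : Fin 3 →₀ ℕ, m 2 < J →
    ν (MvPowerSeries.coeff m u) ≤ ν (MvPowerSeries.coeff m v)) : Nm ν s ρ J u ≤ Nm ν s ρ J v := by
  refine ENNReal.tsum_le_tsum fun m => ?_
  split_ifs with hm
  · gcongr; exact h m hm
  · exact le_rfl

omit [Algebra ℂ R] hν in
lemma Nm_congr (h : eps ^ J ∣ u - v) : Nm ν s ρ J u = Nm ν s ρ J v := by
  refine tsum_congr fun m => ?_
  split_ifs with hm
  · have := eps_pow_dvd.1 h m hm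
    rw [map_sub] at this; rw [sub_eq_zero.1 this]
  · rfl

lemma Nm_add_le : Nm ν s ρ J (u + v) ≤ Nm ν s ρ J u + Nm ν s ρ J v := by
  rw [Nm, Nm, Nm, ← ENNReal.tsum_add]
  refine ENNReal.tsum_le_tsum fun m => ?_
  split_ifs
  · rw [map_add, ← add_mul]; gcongr; exact hν.add_le _ _
  · simp

lemma Nm_neg_le : Nm ν s ρ J (-u) ≤ Nm ν s ρ J u :=
  Nm_mono_coeff fun m _ => by rw [map_neg]; exact hν.neg_le _

lemma Nm_mul_le (hρ : 0 ≤ ρ) : Nm ν s ρ J (u * v) ≤ Nm ν s ρ J u * Nm ν s ρ J v := by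
  classical
  set T : PS R → (Fin 3 →₀ ℕ) → ℝ≥0∞ :=
    fun u m => if m 2 < J then ν (MvPowerSeries.coeff m u) * wt s ρ m else 0 with hT
  have h1 : Nm ν s ρ J (u * v) ≤ ∑' m : Fin 3 →₀ ℕ, ∑' p : Finset.HasAntidiagonal.antidiagonal m,
      T u p.1.1 * T v p.1.2 := by
    refine ENNReal.tsum_le_tsum fun m => ?_
    split_ifs with hm
    · rw [MvPowerSeries.coeff_mul]
      refine (mul_le_mul_left (hν.sum_le _ _) _).trans ?_
      rw [Finset.sum_mul, Finset.tsum_subtype (Finset.HasAntidiagonal.antidiagonal m)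
        (fun p : (Fin 3 →₀ ℕ) × (Fin 3 →₀ ℕ) => T u p.1 * T v p.2)]
      refine Finset.sum_le_sum fun p hp => ?_
      have hpm := Finset.HasAntidiagonal.mem_antidiagonal.1 hp
      have h2 : p.1 2 + p.2 2 = m 2 := by rw [← hpm]; rfl
      simp only [hT]
      rw [if_pos (by lia), if_pos (by lia), ← hpm, wt_add hρ]
      refine (mul_le_mul_left (hν.mul_le _ _) _).trans (le_of_eq ?_)
      ring
    · exact zero_le
  refine h1.trans (le_of_eq ?_)
  have h2 := ENNReal.tsum_sigma' (β := fun m : Fin 3 →₀ ℕ => Finset.HasAntidiagonal.antidiagonal m)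
    fun p => T u p.2.1.1 * T v p.2.1.2
  refine h2.symm.trans ?_
  rw [← (Finset.HasAntidiagonal.sigmaAntidiagonalEquivProd (A := Fin 3 →₀ ℕ)).symm.tsum_eq]
  simp only [Finset.HasAntidiagonal.sigmaAntidiagonalEquivProd_symm_apply_snd_coe]
  rw [ENNReal.tsum_prod (f := fun m n => T u m * T v n)]
  simp only [ENNReal.tsum_mul_left, ENNReal.tsum_mul_right]
  rfl

lemma Nm_monomial_le (n : Fin 3 →₀ ℕ) (c : R) :
    Nm ν s ρ J (MvPowerSeries.monomial n c) ≤ ν c * wt s ρ n := by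
  classical
  rw [Nm, tsum_eq_single n]
  · split_ifs <;> simp
  · intro m hm
    rw [MvPowerSeries.coeff_monomial, if_neg hm]; simp [hν.zero]

lemma Nm_one_le : Nm ν s ρ J (1 : PS R) ≤ 1 := by
  have h := Nm_monomial_le hν (s := s) (ρ := ρ) (J := J) 0 1
  rw [MvPowerSeries.monomial_zero_one] at h
  refine h.trans ?_
  simpa [wt] using hν.one_le

lemma Nm_eps_le : Nm ν s ρ J (eps : PS R) ≤ ENNReal.ofReal ρ := by
  refine (Nm_monomial_le hν _ _).trans ?_
  refine (mul_le_mul_left hν.one_le _).trans ?_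
  simp [wt]

lemma Nm_fmul_le {μ : ℤ → R} {K δ : ℝ} (hK : 0 ≤ K)
    (h : ∀ k, ν (μ k) ≤ ENNReal.ofReal (K * Real.exp (δ * |k|))) (hδ : 0 ≤ δ) :
    Nm ν s ρ J (fmul μ u) ≤ ENNReal.ofReal K * Nm ν (s + δ) ρ J u := by
  rw [Nm, Nm, ← ENNReal.tsum_mul_left]
  refine ENNReal.tsum_le_tsum fun m => ?_
  split_ifs
  · rw [coeff_fmul]
    refine (mul_le_mul_left ((hν.mul_le _ _).trans (mul_le_mul_left (h _) _)) _).trans ?_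
    have e : ENNReal.ofReal (K * Real.exp (δ * |((chg m : ℤ) : ℝ)|)) * wt s ρ m
        ≤ ENNReal.ofReal K * wt (s + δ) ρ m := by
      rw [wt, wt, ← ENNReal.ofReal_mul (by positivity), ← ENNReal.ofReal_mul hK]
      rcases le_or_gt 0 (ρ ^ m 2) with hr | hr
      · refine ENNReal.ofReal_le_ofReal ?_
        rw [mul_assoc, ← mul_assoc (Real.exp _), ← Real.exp_add]
        gcongr
        nlinarith [abs_chg_le m]
      · rw [ENNReal.ofReal_of_nonpos]
        · exact zero_le
        · exact mul_nonpos_of_nonneg_of_nonpos (by positivity)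
            (mul_nonpos_of_nonneg_of_nonpos (by positivity) hr.le)
    calc _ = ν (MvPowerSeries.coeff m u) *
          (ENNReal.ofReal (K * Real.exp (δ * |((chg m : ℤ) : ℝ)|)) * wt s ρ m) := by
            push_cast; ring
      _ ≤ ν (MvPowerSeries.coeff m u) * (ENNReal.ofReal K * wt (s + δ) ρ m) := by gcongr
      _ = _ := by ring
  · simp

lemma Nm_mean_le : Nm ν s ρ J (mean u) ≤ Nm ν s ρ J u := by
  have := Nm_fmul_le hν (s := s) (ρ := ρ) (J := J) (u := u) (μ := fun k => if k = 0 then 1 else 0)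
    (K := 1) (δ := 0) zero_le_one (fun k => ?_) le_rfl
  · simpa [mean] using this
  · split_ifs
    · simpa using hν.one_le
    · simp [hν.zero]

omit [Algebra ℂ R] hν

lemma Nm_mono (hs : s ≤ s') (hρ0 : 0 ≤ ρ) (hρ : ρ ≤ ρ') : Nm ν s ρ J u ≤ Nm ν s' ρ' J u := by
  refine ENNReal.tsum_le_tsum fun m => ?_
  split_ifs
  · gcongr
    refine ENNReal.ofReal_le_ofReal ?_
    gcongr
  · exact le_rfl

lemma Nm_shrink (hν0 : ν 0 = 0) (hρ0 : 0 ≤ ρ) (hρ' : 0 < ρ') (hρ : ρ ≤ ρ') (h : eps ^ N ∣ u) :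
    Nm ν s ρ J u ≤ ENNReal.ofReal ((ρ / ρ') ^ N) * Nm ν s ρ' J u := by
  rw [Nm, Nm, ← ENNReal.tsum_mul_left]
  refine ENNReal.tsum_le_tsum fun m => ?_
  split_ifs
  · by_cases hm : m 2 < N
    · rw [eps_pow_dvd.1 h m hm, hν0]; simp
    · have e : wt s ρ m ≤ ENNReal.ofReal ((ρ / ρ') ^ N) * wt s ρ' m := by
        rw [wt, wt, ← ENNReal.ofReal_mul (by positivity)]
        refine ENNReal.ofReal_le_ofReal ?_
        have h1 : ρ ^ m 2 = (ρ / ρ') ^ m 2 * ρ' ^ m 2 := by rw [← mul_pow]; field_simp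
        have h2 : (ρ / ρ') ^ m 2 ≤ (ρ / ρ') ^ N :=
          pow_le_pow_of_le_one (by positivity) (div_le_one_of_le₀ hρ hρ'.le) (not_lt.1 hm)
        rw [h1]
        calc Real.exp (s * (m 0 + m 1)) * ((ρ / ρ') ^ m 2 * ρ' ^ m 2)
            ≤ Real.exp (s * (m 0 + m 1)) * ((ρ / ρ') ^ N * ρ' ^ m 2) := by gcongr
          _ = _ := by ring
      calc _ ≤ ν (MvPowerSeries.coeff m u) * (ENNReal.ofReal ((ρ / ρ') ^ N) * wt s ρ' m) := by
            gcongr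
        _ = _ := by ring
  · simp

variable (N) in
/-- The part of degree `< N` in `ε`. -/
def trunc (u : PS R) : PS R := fun m => if m 2 < N then MvPowerSeries.coeff m u else 0

lemma coeff_trunc (u : PS R) (m : Fin 3 →₀ ℕ) : MvPowerSeries.coeff m (trunc N u) =
    if m 2 < N then MvPowerSeries.coeff m u else 0 := rfl

lemma eps_dvd_sub_trunc : eps ^ N ∣ u - trunc N u := by
  rw [eps_pow_dvd]
  intro m hm
  rw [map_sub, coeff_trunc, if_pos hm, sub_self]

lemma fmul_trunc (μ : ℤ → R) : fmul μ (trunc N u) = trunc N (fmul μ u) := by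
  ext m; rw [coeff_fmul, coeff_trunc, coeff_trunc, coeff_fmul]; split_ifs <;> simp

lemma Nm_trunc_le (hν0 : ν 0 = 0) : Nm ν s ρ J (trunc N u) ≤ Nm ν s ρ N u := by
  refine ENNReal.tsum_le_tsum fun m => ?_
  rw [coeff_trunc]
  split_ifs <;> simp [hν0]

end Norms
section Estimates

open scoped ENNReal

variable {R : Type*} [CommRing R] [Algebra ℂ R] {ν : R → ℝ≥0∞}
  {s s' ρ ρ' x y : ℝ} {J N : ℕ} {u v : PS R}

namespace Bd

omit [Algebra ℂ R] in
lemma le (h : Bd ν s ρ J u x) (hxy : x ≤ y) : Bd ν s ρ J u y :=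
  ⟨h.1.trans hxy, h.2.trans (ENNReal.ofReal_le_ofReal hxy)⟩

omit [Algebra ℂ R] in
lemma congr (h : Bd ν s ρ J u x) (huv : eps ^ J ∣ u - v) : Bd ν s ρ J v x :=
  ⟨h.1, (Nm_congr huv).symm.le.trans h.2⟩

omit [Algebra ℂ R] in
lemma narrow (h : Bd ν s' ρ' J u x) (hs : s ≤ s') (hρ0 : 0 ≤ ρ) (hρ : ρ ≤ ρ') : Bd ν s ρ J u x :=
  ⟨h.1, (Nm_mono hs hρ0 hρ).trans h.2⟩

lemma add (hν : IsSeminorm ν) (hu : Bd ν s ρ J u x) (hv : Bd ν s ρ J v y) :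
    Bd ν s ρ J (u + v) (x + y) := by
  refine ⟨add_nonneg hu.1 hv.1, (Nm_add_le hν).trans ?_⟩
  rw [ENNReal.ofReal_add hu.1 hv.1]
  exact add_le_add hu.2 hv.2

lemma neg (hν : IsSeminorm ν) (hu : Bd ν s ρ J u x) : Bd ν s ρ J (-u) x :=
  ⟨hu.1, (Nm_neg_le hν).trans hu.2⟩

lemma mul (hν : IsSeminorm ν) (hρ : 0 ≤ ρ) (hu : Bd ν s ρ J u x) (hv : Bd ν s ρ J v y) :
    Bd ν s ρ J (u * v) (x * y) := by
  refine ⟨mul_nonneg hu.1 hv.1, (Nm_mul_le hν hρ).trans ?_⟩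
  rw [ENNReal.ofReal_mul hu.1]
  exact mul_le_mul' hu.2 hv.2

lemma one (hν : IsSeminorm ν) : Bd ν s ρ J (1 : PS R) 1 :=
  ⟨zero_le_one, by simpa using Nm_one_le hν⟩

lemma pow (hν : IsSeminorm ν) (hρ : 0 ≤ ρ) (hu : Bd ν s ρ J u x) (n : ℕ) :
    Bd ν s ρ J (u ^ n) (x ^ n) := by
  induction n with
  | zero => simpa using one hν
  | succ n ih => rw [pow_succ, pow_succ]; exact ih.mul hν hρ hu

lemma eps (hν : IsSeminorm ν) (hρ : 0 ≤ ρ) : Bd ν s ρ J (KAM.eps : PS R) ρ :=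
  ⟨hρ, Nm_eps_le hν⟩

lemma mean (hν : IsSeminorm ν) (hu : Bd ν s ρ J u x) : Bd ν s ρ J (mean u) x :=
  ⟨hu.1, (Nm_mean_le hν).trans hu.2⟩

lemma fmul (hν : IsSeminorm ν) {μ : ℤ → R} {K δ : ℝ} (hK : 0 ≤ K)
    (h : ∀ k : ℤ, ν (μ k) ≤ ENNReal.ofReal (K * Real.exp (δ * |k|))) (hδ : 0 ≤ δ)
    (hu : Bd ν (s + δ) ρ J u x) : Bd ν s ρ J (fmul μ u) (K * x) := by
  refine ⟨mul_nonneg hK hu.1, (Nm_fmul_le hν hK h hδ).trans ?_⟩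
  rw [ENNReal.ofReal_mul hK]
  gcongr; exact hu.2

lemma dD (hν : IsSeminorm ν) {δ : ℝ} (hδ : 0 < δ) (hu : Bd ν (s + δ) ρ J u x) :
    Bd ν s ρ J (dD u) (δ⁻¹ * x) := by
  refine hu.fmul hν (by positivity) (fun k => ?_) hδ.le
  have h := hν.const_le (k : ℂ)
  simp only [map_intCast] at h
  refine h.trans (ENNReal.ofReal_le_ofReal ?_)
  rw [Complex.norm_intCast, inv_mul_eq_div, le_div_iff₀ hδ]
  push_cast
  linarith [Real.add_one_le_exp (δ * |(k : ℝ)|)]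

lemma neumann (hν : IsSeminorm ν) (hρ : 0 ≤ ρ) {z c d : PS R} (hz : Bd ν s ρ J z (1 / 2))
    (hzε : KAM.eps ∣ z) (hc : KAM.eps ^ J ∣ c - (d + c * z)) (hd : Bd ν s ρ J d x) :
    Bd ν s ρ J c (2 * x) := by
  have key : ∀ i : ℕ, ∃ S, Bd ν s ρ J S 2 ∧ KAM.eps ^ J ∣ c - (d * S + c * z ^ i) := by
    intro i
    induction i with
    | zero =>
      refine ⟨0, ⟨zero_le_two, ?_⟩, by simp⟩
      simp [Nm, hν.zero]
    | succ i ih =>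
      obtain ⟨S, hS, hS'⟩ := ih
      refine ⟨1 + S * z, ((one hν).add hν (hS.mul hν hρ hz)).le (by norm_num), ?_⟩
      have e : c - (d * (1 + S * z) + c * z ^ (i + 1)) =
          (c - (d + c * z)) + z * (c - (d * S + c * z ^ i)) := by ring
      rw [e]
      exact dvd_add hc (hS'.mul_left _)
  obtain ⟨S, hS, hS'⟩ := key J
  have h2 := dvd_add hS' ((pow_dvd_pow_of_dvd hzε J).mul_left c)
  have e : c - (d * S + c * z ^ J) + c * z ^ J = c - d * S := by ring
  rw [e, ← dvd_neg, neg_sub] at h2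
  exact ((hd.mul hν hρ hS).congr h2).le (by linarith)

end Bd

variable {q : Rˣ} {a : ℤ → R} {G₀ : PS R}

omit [Algebra ℂ R] in
lemma eps_dvd_trunc (h : eps ∣ u) : eps ∣ trunc N u := by
  rw [← pow_one eps, eps_pow_dvd] at *
  intro m hm
  rw [coeff_trunc, h m hm]; simp

/-- The estimate of one Newton step, with a loss `3δ` in the width of the strip. -/
lemma newton_bd (hν : IsSeminorm ν) (ha : IsDivisor q a) (hG : mean G₀ = 0)
    (hu : IsSol (dbl a) G₀ u) (hN : N ≠ 0) {Λ δ g₀ : ℝ} (hΛ : 1 ≤ Λ) (hδ : 0 < δ) (hδ1 : δ ≤ 1)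
    (hρ : 0 ≤ ρ) (haΛ : ∀ k : ℤ, ν (a k) ≤ ENNReal.ofReal (Λ * Real.exp (δ * |k|)))
    (haΛ' : ∀ k : ℤ, ν (adj a k) ≤ ENNReal.ofReal (Λ * Real.exp (δ * |k|)))
    (h1 : Bd ν (s + 3 * δ) ρ (2 * N) (dD (trunc N u)) (1 / 10))
    (h2 : Bd ν (s + 3 * δ) ρ (2 * N) (dD (sh q (trunc N u))) (1 / 10))
    (hc : Bd ν (s + 3 * δ) ρ (2 * N) (comp G₀ (2 * N) (trunc N u)) g₀) :
    Bd ν s ρ (2 * N) (u - trunc N u) (120 * Λ ^ 2 * (ρ * g₀) / δ) ∧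
    Bd ν s ρ (2 * N) (dD (u - trunc N u)) (120 * Λ ^ 2 * (ρ * g₀) / δ) ∧
    Bd ν s ρ (2 * N) (dD (sh q (u - trunc N u))) (120 * Λ ^ 2 * (ρ * g₀) / δ) := by
  have hΛ0 : 0 ≤ Λ := zero_le_one.trans hΛ
  have hg₀ : 0 ≤ ρ * g₀ := mul_nonneg hρ hc.1
  obtain ⟨he, w, hw, hg⟩ := newton ha hG hu hN (eps_dvd_sub_trunc (N := N) (u := u))
  have hvε := eps_dvd_trunc (N := N) hu.eps_dvd
  set v := trunc N u with hv
  set A := 1 + dD v with hA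
  have hshA : sh q A = 1 + dD (sh q v) := by
    rw [hA, map_add, sh_one]; congr 1; exact fmul_comm _ _ _
  set e := lap q v - eps * comp G₀ (2 * N) v with he_def
  obtain ⟨g, hgw⟩ : ∃ g, g = A * sh q A * (sh q w - w) := ⟨_, rfl⟩
  replace hg := hg g hgw
  -- the error of the approximate solution
  have hbe : Bd ν (s + 3 * δ) ρ (2 * N) e (ρ * g₀) := by
    have hb := (Bd.eps hν hρ (J := 2 * N) (s := s + 3 * δ)).mul hν hρ hc
    refine ⟨hb.1, le_trans (Nm_mono_coeff fun m _ => ?_) hb.2⟩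
    by_cases hm : m 2 < N
    · rw [eps_pow_dvd.1 he m hm, hν.zero]; exact zero_le
    · have : MvPowerSeries.coeff m (lap q v) = 0 := by
        rw [hv, lap_eq, fmul_trunc, coeff_trunc, if_neg hm]
      rw [he_def, map_sub, this, zero_sub]; exact hν.neg_le _
  have hb1 : Bd ν (s + 3 * δ) ρ (2 * N) A (11 / 10) := ((Bd.one hν).add hν h1).le (by norm_num)
  have hb2 : Bd ν (s + 3 * δ) ρ (2 * N) (sh q A) (11 / 10) := by
    rw [hshA]; exact ((Bd.one hν).add hν h2).le (by norm_num)
  -- the part of `g` with zero mean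
  have hbg : Bd ν (s + 2 * δ) ρ (2 * N) (g - mean g) (Λ * (11 / 10 * (ρ * g₀))) := by
    have h := (((hb1.mul hν hρ hbe).narrow (s := s + 2 * δ + δ) (by linarith) hρ le_rfl).fmul
      hν hΛ0 haΛ' hδ.le).neg hν
    refine h.congr ?_
    rw [← dvd_neg]; convert hg using 1; ring
  -- the inverse of `A * sh q A`
  set z := dD v + dD (sh q v) + dD v * dD (sh q v) with hz
  have hAz : A * sh q A = 1 + z := by rw [hshA, hA, hz]; ring
  have hbz : Bd ν (s + 2 * δ) ρ (2 * N) z (21 / 100) :=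
    (((h1.add hν h2).add hν (h1.mul hν hρ h2)).narrow (by linarith) hρ le_rfl).le (by norm_num)
  have hdε (x : PS R) (μ : ℤ → R) (hx : eps ∣ x) : eps ∣ fmul μ x := by
    rw [← pow_one eps] at *; exact eps_dvd_fmul _ hx
  have hzε : eps ∣ z := dvd_add (dvd_add (hdε _ _ hvε) (hdε _ _ (hdε _ _ hvε)))
    (Dvd.dvd.mul_right (hdε _ _ hvε) _)
  obtain ⟨Z, hZ⟩ : ∃ Z, (1 + z) * Z = 1 := by
    have hAu : IsUnit (1 + z) := by
      rw [MvPowerSeries.isUnit_iff_constantCoeff]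
      obtain ⟨z', hz'⟩ := hzε
      rw [hz', map_add, map_mul, eps]; simp
    exact hAu.exists_right_inv
  have hbZ : Bd ν (s + 2 * δ) ρ (2 * N) Z 2 := by
    have := Bd.neumann hν hρ (c := Z) (d := 1) (z := -z) ((hbz.neg hν).le (by norm_num))
      (by rwa [dvd_neg]) ?_ (Bd.one hν)
    · simpa using this
    · have e : Z - (1 + Z * -z) = 0 := by linear_combination hZ
      rw [e]; exact dvd_zero _
  have hZ1 : Z - 1 = -(Z * z) := by linear_combination hZ
  have hbZ1 : Bd ν (s + 2 * δ) ρ (2 * N) (Z - 1) (1 / 2) := by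
    rw [hZ1]; exact ((hbZ.mul hν hρ hbz).neg hν).le (by norm_num)
  have hZg : Z * g = sh q w - w := by rw [hgw, hAz]; linear_combination (sh q w - w) * hZ
  have hmZ : mean (Z * g) = 0 := by rw [hZg, map_sub, mean_sh, sub_self]
  have hbc : Bd ν (s + 2 * δ) ρ (2 * N) (mean g) (2 * (2 * (Λ * (11 / 10 * (ρ * g₀))))) := by
    refine Bd.neumann hν hρ (d := -mean (Z * (g - mean g))) (z := -mean (Z - 1))
      ((hbZ1.mean hν).neg hν) ?_ ?_ (((hbZ.mul hν hρ hbg).mean hν).neg hν)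
    · rw [dvd_neg, hZ1]; exact hdε _ _ (by rw [dvd_neg]; exact hzε.mul_left _)
    · have e1 : mean (Z * (g - mean g)) = - (mean Z * mean g) := by
        rw [mul_sub, map_sub, hmZ, mean_mul', zero_sub]
      have e : mean g - (-mean (Z * (g - mean g)) + mean g * -mean (Z - 1)) = 0 := by
        rw [e1, map_sub, mean_one]; ring
      rw [e]; exact dvd_zero _
  have hbdw : Bd ν (s + 2 * δ) ρ (2 * N) (sh q w - w) (2 * (6 * (Λ * (11 / 10 * (ρ * g₀))))) := by
    rw [← hZg]
    have := hbg.add hν hbc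
    rw [sub_add_cancel] at this
    refine hbZ.mul hν hρ (this.le ?_)
    have : 0 ≤ Λ * (11 / 10 * (ρ * g₀)) := by positivity
    linarith
  set X := Λ * (ρ * g₀) with hX
  have hX0 : 0 ≤ X := by positivity
  replace hbdw := hbdw.le (y := 14 * X) (by rw [hX]; nlinarith [hX0])
  have hbw' : Bd ν (s + δ) ρ (2 * N) (w - mean w) (Λ * (14 * X)) := by
    rw [← ha.fmul_sub]
    exact (hbdw.narrow (s := s + δ + δ) (by linarith) hρ le_rfl).fmul hν hΛ0 haΛ hδ.le
  have hmw : mean w = - mean (dD v * (w - mean w)) := by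
    have h0 : mean (u - v) = 0 := by
      rw [map_sub, hv, mean, fmul_trunc, ← mean, mean_sol ha hu]
      ext m; simp [coeff_trunc]
    rw [hw, hA, add_mul, one_mul, map_add] at h0
    have h3 : mean (dD v * mean w) = 0 := by rw [mean_mul', mean_dD, zero_mul]
    rw [mul_sub, map_sub, h3, sub_zero]; linear_combination h0
  have hbw : Bd ν (s + δ) ρ (2 * N) w (2 * (Λ * (14 * X))) := by
    have h := hbw'.add hν ((((h1.narrow (s := s + δ) (by linarith) hρ le_rfl).mul hν hρ
      hbw').mean hν).neg hν)
    rw [← hmw, sub_add_cancel] at h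
    refine h.le ?_
    have := hbw'.1
    linarith
  have hΛX : X ≤ Λ * X := le_mul_of_one_le_left hX0 hΛ
  have hbh : Bd ν (s + δ) ρ (2 * N) (u - v) (120 * (Λ * X)) := by
    rw [hw]
    exact ((hb1.narrow (by linarith) hρ le_rfl).mul hν hρ hbw).le (by linarith)
  have hbsh : Bd ν (s + δ) ρ (2 * N) (sh q (u - v)) (120 * (Λ * X)) := by
    rw [hw, sh_mul, show sh q w = w + (sh q w - w) by ring]
    exact ((hb2.narrow (by linarith) hρ le_rfl).mul hν hρ
      (hbw.add hν (hbdw.narrow (by linarith) hρ le_rfl))).le (by linarith)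
  have e3 : 120 * Λ ^ 2 * (ρ * g₀) / δ = δ⁻¹ * (120 * (Λ * X)) := by rw [hX]; ring
  rw [e3]
  refine ⟨(hbh.narrow (by linarith) hρ le_rfl).le ?_, hbh.dD hν hδ, hbsh.dD hν hδ⟩
  exact le_mul_of_one_le_left hbh.1 (one_le_inv₀ hδ |>.2 hδ1)

end Estimates
section Iteration

open scoped ENNReal

variable {R : Type*} [CommRing R] [Algebra ℂ R] {ν : R → ℝ≥0∞}
  {s s' ρ ρ' x y : ℝ} {J N : ℕ} {u v : PS R} {q : Rˣ} {a : ℤ → R} {G₀ : PS R}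

lemma Nm_sum_le (hν : IsSeminorm ν) {ι : Type*} (S : Finset ι) (f : ι → PS R) :
    Nm ν s ρ J (∑ i ∈ S, f i) ≤ ∑ i ∈ S, Nm ν s ρ J (f i) := by
  classical
  induction S using Finset.induction_on with
  | empty => simp [Nm, hν.zero]
  | insert i S hi ih =>
    rw [Finset.sum_insert hi, Finset.sum_insert hi]
    exact (Nm_add_le hν).trans (by gcongr)

/-- The superposition operator is bounded, uniformly in the truncation degree. -/
lemma comp_bd (hν : IsSeminorm ν) (hρ : 0 ≤ ρ) {γ : (Fin 3 →₀ ℕ) → ℂ}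
    (hG : ∀ m, MvPowerSeries.coeff m G₀ = algebraMap ℂ R (γ m)) (hγ : ∀ m, m 2 ≠ 0 → γ m = 0)
    {B g₀ s₀ : ℝ} (hB : 0 ≤ B) (hg₀ : 0 ≤ g₀) (hs : s ≤ s₀)
    (hsum : ∑' m, ENNReal.ofReal (‖γ m‖ * Real.exp (s₀ * (m 0 + m 1) + B * |(chg m : ℝ)|))
      ≤ ENNReal.ofReal g₀) (hv : Bd ν s ρ J v B) (J' : ℕ) :
    Bd ν s ρ J (comp G₀ J' v) g₀ := by
  refine ⟨hg₀, le_trans ?_ hsum⟩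
  set W : (Fin 3 →₀ ℕ) → ℝ := fun m => ‖γ m‖ * Real.exp (s₀ * (m 0 + m 1)) with hW
  have h1 (j : ℕ) : Nm ν s ρ J (tay G₀ j * v ^ j) ≤
      ∑' m, ENNReal.ofReal (W m * ((B * |(chg m : ℝ)|) ^ j / j.factorial)) := by
    refine (Nm_mul_le hν hρ).trans ?_
    refine (mul_le_mul' le_rfl (hv.pow hν hρ j).2).trans ?_
    rw [Nm, ← ENNReal.tsum_mul_right]
    refine ENNReal.tsum_le_tsum fun m => ?_
    have e : W m * ((B * |(chg m : ℝ)|) ^ j / j.factorial) =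
        (‖((chg m : ℤ) : ℂ) ^ j / (j.factorial : ℂ)‖ * ‖γ m‖) * Real.exp (s₀ * (m 0 + m 1))
          * B ^ j := by
      rw [hW, norm_div, norm_pow, Complex.norm_intCast, Complex.norm_natCast]
      push_cast; ring
    rw [e, ENNReal.ofReal_mul (by positivity), ENNReal.ofReal_mul (by positivity)]
    gcongr
    split_ifs
    · rw [tay, coeff_fmul, hG, ← map_mul]
      refine (mul_le_mul_left (hν.const_le _) _).trans ?_
      rw [norm_mul]
      by_cases hm : m 2 = 0
      · gcongr
        rw [wt, hm, pow_zero, mul_one]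
        refine ENNReal.ofReal_le_ofReal ?_
        gcongr
      · simp [hγ m hm]
    · exact zero_le
  calc Nm ν s ρ J (comp G₀ J' v) ≤ ∑ j ∈ Finset.range J', Nm ν s ρ J (tay G₀ j * v ^ j) :=
        Nm_sum_le hν _ _
    _ ≤ ∑ j ∈ Finset.range J',
        ∑' m, ENNReal.ofReal (W m * ((B * |(chg m : ℝ)|) ^ j / j.factorial)) :=
        Finset.sum_le_sum fun j _ => h1 j
    _ = ∑' m, ∑ j ∈ Finset.range J',
        ENNReal.ofReal (W m * ((B * |(chg m : ℝ)|) ^ j / j.factorial)) :=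
        (Summable.tsum_finsetSum fun j _ => ENNReal.summable).symm
    _ ≤ _ := by
      refine ENNReal.tsum_le_tsum fun m => ?_
      rw [← ENNReal.ofReal_sum_of_nonneg (fun j _ => by positivity)]
      refine ENNReal.ofReal_le_ofReal ?_
      rw [← Finset.mul_sum, Real.exp_add, ← mul_assoc]
      gcongr
      exact Real.sum_le_exp_of_nonneg (by positivity) _

lemma pow_le_exp (p : ℕ) {δ : ℝ} (hδ : 0 < δ) {x : ℝ} (hx : 0 ≤ x) :
    x ^ p ≤ p.factorial * δ⁻¹ ^ p * Real.exp (δ * x) := by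
  have h := Real.pow_div_factorial_le_exp (δ * x) (by positivity) p
  rw [div_le_iff₀ (by positivity), mul_pow] at h
  have h2 : δ⁻¹ ^ p * (δ ^ p * x ^ p) ≤ δ⁻¹ ^ p * (Real.exp (δ * x) * p.factorial) := by gcongr
  rw [← mul_assoc, ← mul_pow, inv_mul_cancel₀ hδ.ne', one_pow, one_mul] at h2
  linarith

/-- The partial sums of `∑ (j + 1) / 2 ^ j`. -/
def tseq (n : ℕ) : ℝ := 4 - 2 * (n + 2) / 2 ^ n

lemma tseq_succ (n : ℕ) : tseq (n + 1) = tseq n + (n + 1) / 2 ^ n := by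
  rw [tseq, tseq, pow_succ]; push_cast; field_simp; ring

omit [Algebra ℂ R] in
lemma Bd.degree (h : Bd ν s ρ N u x) (hJ : J ≤ N) : Bd ν s ρ J u x := by
  refine ⟨h.1, le_trans (ENNReal.tsum_le_tsum fun m => ?_) h.2⟩
  by_cases hm : m 2 < J
  · rw [if_pos hm, if_pos (hm.trans_le hJ)]
  · rw [if_neg hm]; exact zero_le

omit [Algebra ℂ R] in
lemma Bd.trunc (hν0 : ν 0 = 0) (h : Bd ν s ρ N u x) : Bd ν s ρ J (trunc N u) x :=
  ⟨h.1, (Nm_trunc_le hν0).trans h.2⟩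

lemma Bd.shrink (hν : IsSeminorm ν) (hρ0 : 0 ≤ ρ) (hρ' : 0 < ρ') (hρ : ρ ≤ ρ')
    (hu : KAM.eps ^ N ∣ u) (h : Bd ν s ρ' J u x) : Bd ν s ρ J u ((ρ / ρ') ^ N * x) := by
  refine ⟨mul_nonneg (by positivity) h.1, (Nm_shrink hν.zero hρ0 hρ' hρ hu).trans ?_⟩
  rw [ENNReal.ofReal_mul (by positivity)]
  gcongr; exact h.2

/-- The Newton iteration: the formal solution converges on a smaller strip and disc. -/
theorem sol_bd (hν : IsSeminorm ν) (ha : IsDivisor q a) (hG : mean G₀ = 0)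
    (hu : IsSol (dbl a) G₀ u) {s₀ δ₀ ρ₀ L g₀ B β : ℝ} {p : ℕ} (hδ : 0 < δ₀) (hδ1 : δ₀ ≤ 1)
    (hL : 1 ≤ L) (hρ : 0 < ρ₀) (hg₀ : 0 ≤ g₀)
    (haL : ∀ k : ℤ, ν (a k) ≤ ENNReal.ofReal (L * |k| ^ p))
    (haL' : ∀ k : ℤ, ν (adj a k) ≤ ENNReal.ofReal (L * |k| ^ p))
    (hcomp : ∀ s ≤ s₀, ∀ ρ ≥ 0, ∀ J (v : PS R), Bd ν s ρ J v B → Bd ν s ρ J (comp G₀ J v) g₀)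
    (hβ1 : β ≤ 1 / 10) (hβB : β ≤ B)
    (hK : 120 * L ^ 2 * p.factorial ^ 2 * ρ₀ * g₀ * δ₀⁻¹ ^ (2 * p + 1) ≤ β) (J : ℕ) :
    Bd ν (s₀ - 6 * δ₀) (ρ₀ * (2⁻¹) ^ (8 * (p + 1))) J u β ∧
    Bd ν (s₀ - 6 * δ₀) (ρ₀ * (2⁻¹) ^ (8 * (p + 1))) J (dD u) β := by
  set K := 120 * L ^ 2 * p.factorial ^ 2 * ρ₀ * g₀ * δ₀⁻¹ ^ (2 * p + 1) with hKdef
  have hL0 : 0 ≤ L := zero_le_one.trans hL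
  have hK0 : 0 ≤ K := by positivity
  set r : ℕ → ℝ := fun n => ρ₀ * (2 : ℝ) ^ (-((2 * p + 2 : ℕ) : ℝ) * tseq n) with hr
  have hr0 (n) : 0 < r n := by positivity
  have hrs (n) : r (n + 1) = r n * (2 : ℝ) ^ (-((2 * p + 2 : ℕ) : ℝ) * ((n + 1) / 2 ^ n)) := by
    simp only [hr, tseq_succ, mul_add]
    rw [Real.rpow_add two_pos, mul_assoc]
  have hrle (n) : r (n + 1) ≤ r n := by
    rw [hrs]
    refine mul_le_of_le_one_right (hr0 n).le (Real.rpow_le_one_of_one_le_of_nonpos one_le_two ?_)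
    have : (0 : ℝ) ≤ ((2 * p + 2 : ℕ) : ℝ) * ((n + 1) / 2 ^ n) := by positivity
    linarith
  have hr00 (n) : r n ≤ ρ₀ := by
    induction n with
    | zero => norm_num [hr, tseq]
    | succ n ih => exact (hrle n).trans ih
  have hrpow (n) : (r (n + 1) / r n) ^ 2 ^ n = (2⁻¹ : ℝ) ^ ((2 * p + 2) * (n + 1)) := by
    have e : -((2 * p + 2 : ℕ) : ℝ) * ((n + 1) / 2 ^ n) * ((2 ^ n : ℕ) : ℝ) =
        -(((2 * p + 2) * (n + 1) : ℕ) : ℝ) := by push_cast; field_simp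
    rw [hrs, mul_div_cancel_left₀ _ (hr0 n).ne', ← Real.rpow_natCast (_ ^ _ : ℝ) (2 ^ n),
      ← Real.rpow_mul two_pos.le, e, Real.rpow_neg two_pos.le, Real.rpow_natCast, inv_pow]
  have hrlow (n) : ρ₀ * (2⁻¹) ^ (8 * (p + 1)) ≤ r n := by
    simp only [hr]
    gcongr
    rw [inv_pow, ← Real.rpow_natCast, ← Real.rpow_neg two_pos.le]
    refine Real.rpow_le_rpow_of_exponent_le one_le_two ?_
    have h1 : tseq n ≤ 4 := by
      have : (0 : ℝ) ≤ 2 * (n + 2) / 2 ^ n := by positivity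
      rw [tseq]; linarith
    push_cast
    nlinarith [(Nat.cast_nonneg p : (0 : ℝ) ≤ p)]
  set S : ℕ → ℝ := fun n => s₀ - 6 * δ₀ * (1 - 2⁻¹ ^ n) with hS
  have hSs (n) : S n = S (n + 1) + 3 * (δ₀ * 2⁻¹ ^ n) := by
    simp only [hS, pow_succ]; ring
  have hhalf (n : ℕ) : (0 : ℝ) < 2⁻¹ ^ n ∧ (2⁻¹ : ℝ) ^ n ≤ 1 :=
    ⟨by positivity, pow_le_one₀ (by norm_num) (by norm_num)⟩
  have hS0 (n) : S n ≤ s₀ := by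
    have : 0 ≤ 6 * δ₀ * (1 - 2⁻¹ ^ n) := mul_nonneg (by positivity) (by linarith [(hhalf n).2])
    simp only [hS]; linarith
  have hSlow (n) : s₀ - 6 * δ₀ ≤ S n := by
    have : 0 ≤ 6 * δ₀ * 2⁻¹ ^ n := by positivity
    simp only [hS]; linarith
  have main : ∀ n : ℕ, ∀ x ∈ ({u, dD u, dD (sh q u)} : Set (PS R)),
      Bd ν (S n) (r n) (2 ^ n) x (K * (1 - 2⁻¹ ^ n)) := by
    intro n
    induction n with
    | zero =>
      have hz (x : PS R) (hx : eps ∣ x) : Bd ν (S 0) (r 0) (2 ^ 0) x (K * (1 - 2⁻¹ ^ 0)) := by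
        refine ⟨by simp, ?_⟩
        rw [pow_zero, Nm_congr (v := 0) (by simpa using hx)]
        simp [Nm, hν.zero]
      have hd (x : PS R) (μ : ℤ → R) (hx : eps ∣ x) : eps ∣ fmul μ x := by
        rw [← pow_one eps] at *; exact eps_dvd_fmul _ hx
      rintro x (rfl | rfl | rfl)
      · exact hz _ hu.eps_dvd
      · exact hz _ (hd _ _ hu.eps_dvd)
      · exact hz _ (hd _ _ (hd _ _ hu.eps_dvd))
    | succ n ih =>
      have hKn : K * (1 - 2⁻¹ ^ n) ≤ β :=
        (mul_le_of_le_one_right hK0 (by linarith [(hhalf n).1])).trans hK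
      have htr (x : PS R) (hx : Bd ν (S n) (r n) (2 ^ n) x (K * (1 - 2⁻¹ ^ n))) (J : ℕ) :
          Bd ν (S n) (r n) J (trunc (2 ^ n) x) (K * (1 - 2⁻¹ ^ n)) := hx.trunc hν.zero
      have hDt : dD (trunc (2 ^ n) u) = trunc (2 ^ n) (dD u) := fmul_trunc _
      have hSt : sh q (trunc (2 ^ n) u) = trunc (2 ^ n) (sh q u) := fmul_trunc _
      have hDt' : dD (trunc (2 ^ n) (sh q u)) = trunc (2 ^ n) (dD (sh q u)) := fmul_trunc _
      set δ := δ₀ * 2⁻¹ ^ n with hδn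
      have hδpos : 0 < δ := by have := (hhalf n).1; positivity
      have hδle : δ ≤ 1 := mul_le_one₀ hδ1 (hhalf n).1.le (hhalf n).2
      set Λ := L * (p.factorial * δ⁻¹ ^ p) with hΛ
      have hΛ1 : 1 ≤ Λ := by
        have h1 : (1 : ℝ) ≤ p.factorial := by exact_mod_cast Nat.factorial_pos p
        have h2 : (1 : ℝ) ≤ δ⁻¹ ^ p := one_le_pow₀ (one_le_inv₀ hδpos |>.2 hδle)
        exact one_le_mul_of_one_le_of_one_le hL (one_le_mul_of_one_le_of_one_le h1 h2)
      have hΛb (k : ℤ) : L * ((|k| : ℤ) : ℝ) ^ p ≤ Λ * Real.exp (δ * (|k| : ℤ)) := by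
        rw [hΛ, mul_assoc]
        gcongr
        exact pow_le_exp p hδpos (by positivity)
      have hstep := newton_bd (s := S (n + 1)) (ρ := r n) (N := 2 ^ n) hν ha hG hu (by positivity)
        hΛ1 hδpos hδle (hr0 n).le (g₀ := g₀)
        (fun k => (haL k).trans (ENNReal.ofReal_le_ofReal (hΛb k)))
        (fun k => (haL' k).trans (ENNReal.ofReal_le_ofReal (hΛb k)))
        (by rw [← hSs, hDt]; exact (htr _ (ih _ (by simp)) _).le (hKn.trans hβ1))
        (by rw [← hSs, hSt, hDt']; exact (htr _ (ih _ (by simp)) _).le (hKn.trans hβ1))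
        (by
          rw [← hSs]
          exact hcomp _ (hS0 n) _ (hr0 n).le _ _ ((htr _ (ih _ (by simp)) _).le (hKn.trans hβB)))
      have hinc : (r (n + 1) / r n) ^ 2 ^ n * (120 * Λ ^ 2 * (r n * g₀) / δ)
          ≤ K * (2⁻¹) ^ (n + 1) := by
        have e : 120 * Λ ^ 2 * (r n * g₀) / δ =
            120 * L ^ 2 * p.factorial ^ 2 * r n * g₀ * δ₀⁻¹ ^ (2 * p + 1) * 2 ^ (n * (2 * p + 1)) := by
          have e1 : δ⁻¹ = δ₀⁻¹ * 2 ^ n := by rw [hδn, mul_inv, inv_pow, inv_inv]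
          rw [hΛ, div_eq_mul_inv, e1, mul_pow, pow_mul]; ring
        rw [e, hrpow]
        have e2 : (2⁻¹ : ℝ) ^ ((2 * p + 2) * (n + 1)) =
            2⁻¹ ^ (n * (2 * p + 1)) * 2⁻¹ ^ (2 * p + 1) * 2⁻¹ ^ (n + 1) := by
          rw [← pow_add, ← pow_add]; congr 1; ring
        have e3 : (2⁻¹ : ℝ) ^ (n * (2 * p + 1)) * 2 ^ (n * (2 * p + 1)) = 1 := by
          rw [← mul_pow]; norm_num
        calc _ = (120 * L ^ 2 * p.factorial ^ 2 * r n * g₀ * δ₀⁻¹ ^ (2 * p + 1)) *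
              (2⁻¹ ^ (n * (2 * p + 1)) * 2 ^ (n * (2 * p + 1))) * 2⁻¹ ^ (2 * p + 1)
              * 2⁻¹ ^ (n + 1) := by rw [e2]; ring
          _ ≤ K * 1 * 1 * 2⁻¹ ^ (n + 1) := by
            rw [e3, hKdef]
            gcongr
            · exact hr00 n
            · exact (hhalf _).2
          _ = _ := by ring
      have hfin (x : PS R) (hx : Bd ν (S n) (r n) (2 ^ n) x (K * (1 - 2⁻¹ ^ n)))
          (hh : Bd ν (S (n + 1)) (r n) (2 * 2 ^ n) (x - trunc (2 ^ n) x)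
            (120 * Λ ^ 2 * (r n * g₀) / δ)) :
          Bd ν (S (n + 1)) (r (n + 1)) (2 ^ (n + 1)) x (K * (1 - 2⁻¹ ^ (n + 1))) := by
        rw [pow_succ' 2 n]
        have h1 := (htr x hx (2 * 2 ^ n)).narrow (s := S (n + 1)) (ρ := r (n + 1))
          (by rw [hSs n]; linarith) (hr0 _).le (hrle n)
        have h2 := (hh.shrink hν (hr0 _).le (hr0 n) (hrle n) eps_dvd_sub_trunc).le hinc
        have := h1.add hν h2
        rw [add_sub_cancel] at this
        refine this.le (le_of_eq ?_)
        rw [pow_succ]; ring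
      rintro x (rfl | rfl | rfl)
      · exact hfin _ (ih _ (by simp)) hstep.1
      · refine hfin _ (ih _ (by simp)) ?_
        have := hstep.2.1; rwa [map_sub, hDt] at this
      · refine hfin _ (ih _ (by simp)) ?_
        have := hstep.2.2; rwa [map_sub, map_sub, hSt, hDt'] at this
  have fin (x : PS R) (hx : x ∈ ({u, dD u, dD (sh q u)} : Set (PS R))) :
      Bd ν (s₀ - 6 * δ₀) (ρ₀ * (2⁻¹) ^ (8 * (p + 1))) J x β :=
    ((((main J x hx).degree J.lt_two_pow_self.le).narrow (hSlow J) (by positivity)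
      (hrlow J)).le (mul_le_of_le_one_right hK0 (by linarith [(hhalf J).1]))).le hK
  exact ⟨fin _ (by simp), fin _ (by simp)⟩

end Iteration
section SmallDivisors

/-- Lower bound for `|e^{2πiz} - 1|` away from the integers. -/
lemma le_norm_exp_sub_one {z : ℂ} {η : ℝ} (hη : 0 ≤ η) (x₀ : ℝ) (hx₀ : ∀ l : ℤ, η ≤ |x₀ - l|)
    (hz : |x₀ - z.re| ≤ |z.im|) : η ≤ ‖Efn z - 1‖ := by
  have hη2 : η ≤ 1 / 2 := (hx₀ (round x₀)).trans (abs_sub_round x₀)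
  have hπ := Real.pi_gt_three
  have hw : Efn z = Real.exp (-(2 * Real.pi * z.im)) * Complex.exp ((2 * Real.pi * z.re : ℝ) * I) := by
    rw [Efn, Complex.ofReal_exp, ← Complex.exp_add]
    congr 1
    apply Complex.ext <;> simp
  rcases le_or_gt (η / 2) |z.im| with h | h
  · have hn : ‖Efn z‖ = Real.exp (-(2 * Real.pi * z.im)) := by
      rw [hw, norm_mul, Complex.norm_exp_ofReal_mul_I, mul_one, Complex.norm_real,
        Real.norm_of_nonneg (Real.exp_pos _).le]
    have h1 : |Real.exp (-(2 * Real.pi * z.im)) - 1| ≤ ‖Efn z - 1‖ := by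
      rw [← hn]; simpa using abs_norm_sub_norm_le (Efn z) 1
    refine le_trans ?_ h1
    rcases le_total 0 z.im with hy | hy
    · rw [abs_of_nonneg hy] at h
      rw [abs_sub_comm]
      refine le_trans ?_ (le_abs_self _)
      have h2 : Real.exp (-(2 * Real.pi * z.im)) ≤ Real.exp (-(3 * η)) := by
        apply Real.exp_le_exp.2; nlinarith
      have h3 : Real.exp (-(3 * η)) * (1 + 3 * η) ≤ 1 := by
        rw [Real.exp_neg, inv_mul_le_iff₀ (Real.exp_pos _), mul_one, add_comm]
        exact Real.add_one_le_exp _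
      nlinarith [Real.exp_pos (-(3 * η))]
    · rw [abs_of_nonpos hy] at h
      refine le_trans ?_ (le_abs_self _)
      have h2 := Real.add_one_le_exp (-(2 * Real.pi * z.im))
      nlinarith
  · set l := round z.re with hl
    have hxl : η / 2 ≤ |z.re - l| := by
      have h1 := hx₀ l
      have h2 : |x₀ - l| ≤ |x₀ - z.re| + |z.re - l| := abs_sub_le _ _ _
      linarith
    set φ := 2 * Real.pi * (z.re - l) with hφ
    have hexp : Complex.exp ((2 * Real.pi * z.re : ℝ) * I) = Complex.exp ((φ : ℝ) * I) := by
      rw [Complex.exp_eq_exp_iff_exists_int]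
      refine ⟨l, ?_⟩
      rw [hφ]; push_cast; ring
    rw [hw, hexp]
    set r := Real.exp (-(2 * Real.pi * z.im)) with hr
    have hr0 : 0 < r := Real.exp_pos _
    have hre : ((r : ℂ) * Complex.exp ((φ : ℝ) * I) - 1).re = r * Real.cos φ - 1 := by
      simp [Complex.exp_ofReal_mul_I_re, Complex.exp_ofReal_mul_I_im]
    have him : ((r : ℂ) * Complex.exp ((φ : ℝ) * I) - 1).im = r * Real.sin φ := by
      simp [Complex.exp_ofReal_mul_I_re, Complex.exp_ofReal_mul_I_im]
    have hsq : ‖(r : ℂ) * Complex.exp ((φ : ℝ) * I) - 1‖ ^ 2 =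
        (r * Real.cos φ - 1) ^ 2 + (r * Real.sin φ) ^ 2 := by
      rw [← Complex.normSq_eq_norm_sq, Complex.normSq_apply, hre, him]; ring
    have hφle : |φ| ≤ Real.pi := by
      rw [hφ, abs_mul, abs_of_pos (by positivity : 0 < 2 * Real.pi)]
      nlinarith [abs_sub_round z.re]
    have hφge : Real.pi * η ≤ |φ| := by
      rw [hφ, abs_mul, abs_of_pos (by positivity : 0 < 2 * Real.pi)]
      nlinarith
    refine (sq_le_sq₀ hη (norm_nonneg _)).1 ?_
    rw [hsq]
    rcases le_total |φ| (Real.pi / 2) with hc | hc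
    · have h1 : 2 * η ≤ |Real.sin φ| := by
        have := Real.mul_abs_le_abs_sin hc
        refine le_trans ?_ this
        rw [div_mul_eq_mul_div, le_div_iff₀ (by positivity)]; nlinarith
      have h2 : (2 * η) ^ 2 ≤ Real.sin φ ^ 2 := by
        rw [← sq_abs (Real.sin φ)]; gcongr
      nlinarith [Real.sin_sq_add_cos_sq φ, sq_nonneg (r - Real.cos φ)]
    · have h1 : Real.cos φ ≤ 0 := by
        rw [← Real.cos_abs]
        exact Real.cos_nonpos_of_pi_div_two_le_of_le hc (by linarith)
      nlinarith [sq_nonneg (r * Real.sin φ), mul_nonneg hr0.le (neg_nonneg.2 h1)]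

variable {τ M : ℝ}

lemma neg_mem_AMR {ω : ℝ} (h : ω ∈ AMR τ M) : -ω ∈ AMR τ M := by
  intro n m hm
  have := h (-n) m hm
  rw [← abs_neg]
  convert this using 2; push_cast; ring

lemma neg_mem_AMC {ω : ℂ} (h : ω ∈ AMC τ M) : -ω ∈ AMC τ M := by
  obtain ⟨ω₀, h₀, h⟩ := h
  refine ⟨-ω₀, neg_mem_AMR h₀, ?_⟩
  rw [Complex.neg_re, Complex.neg_im, abs_neg, ← abs_neg]
  convert h using 2; ring

lemma Efn_ne_zero (ω : ℂ) : Efn ω ≠ 0 := Complex.exp_ne_zero _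

lemma Efn_neg (ω : ℂ) : Efn (-ω) = (Efn ω)⁻¹ := by
  rw [Efn, Efn, ← Complex.exp_neg]; congr 1; ring

lemma Efn_pow (ω : ℂ) (n : ℕ) : Efn ω ^ n = Efn (n * ω) := by
  rw [Efn, Efn, ← Complex.exp_nat_mul]; congr 1; ring

lemma mem_finPart {q : ℂ} : q ∈ finPart (KM τ M) ↔ q = 0 ∨ ∃ ω ∈ AMC τ M, Efn ω = q := by
  simp only [finPart, KM, Set.mem_ofPred_eq, Set.mem_union, Set.mem_image, Set.mem_insert_iff,
    Set.mem_singleton_iff, OnePoint.coe_eq_coe, OnePoint.coe_ne_infty, or_false]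
  exact or_comm

lemma infPart_subset : infPart (KM τ M) ⊆ finPart (KM τ M) := by
  intro ξ hξ
  by_cases h : ξ = 0
  · exact mem_finPart.2 (Or.inl h)
  · have h1 : ξ⁻¹ ∈ finPart (KM τ M) := by
      have := hξ
      rw [infPart, Set.mem_ofPred_eq, sphChart, if_neg h] at this
      exact this
    rcases mem_finPart.1 h1 with h2 | ⟨ω, hω, h2⟩
    · exact absurd h2 (inv_ne_zero h)
    · exact mem_finPart.2 (Or.inr ⟨-ω, neg_mem_AMC hω, by rw [Efn_neg, h2, inv_inv]⟩)

lemma small_divisor (hM : 0 < M) {ω : ℂ} (hω : ω ∈ AMC τ M) {n : ℕ} (hn : 0 < n) :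
    (M * (n : ℝ) ^ (1 + τ))⁻¹ ≤ ‖Efn ω ^ n - 1‖ := by
  obtain ⟨ω₀, h₀, h⟩ := hω
  have hn' : (0 : ℝ) < n := by exact_mod_cast hn
  rw [Efn_pow]
  refine le_norm_exp_sub_one (by positivity) (n * ω₀) (fun l => ?_) ?_
  · have h1 := h₀ l n hn
    have e : (n : ℝ) * ω₀ - l = n * (ω₀ - l / n) := by field_simp
    rw [e, abs_mul, abs_of_pos hn']
    have e2 : (M * (n : ℝ) ^ (1 + τ))⁻¹ = n * (1 / (M * (n : ℝ) ^ (2 + τ))) := by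
      rw [show (2 + τ : ℝ) = 1 + (1 + τ) by ring, Real.rpow_add hn' 1 (1 + τ), Real.rpow_one]
      field_simp
    rw [e2]; gcongr
  · have e : (n : ℝ) * ω₀ - ((n : ℂ) * ω).re = n * (ω₀ - ω.re) := by simp; ring
    have e' : ((n : ℂ) * ω).im = n * ω.im := by simp
    rw [e, e', abs_mul, abs_mul]; gcongr

lemma norm_inv_pow_sub_one_le (hτ : 0 ≤ τ) (hM : 1 ≤ M) {q : ℂ} (hq : q ∈ finPart (KM τ M)) {n : ℕ}
    (hn : 0 < n) : q ^ n - 1 ≠ 0 ∧ ‖(q ^ n - 1)⁻¹‖ ≤ M * (n : ℝ) ^ (1 + τ) := by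
  have hn' : (1 : ℝ) ≤ n := by exact_mod_cast hn
  have hpos : 1 ≤ M * (n : ℝ) ^ (1 + τ) :=
    one_le_mul_of_one_le_of_one_le hM (Real.one_le_rpow hn' (by linarith))
  rcases mem_finPart.1 hq with rfl | ⟨ω, hω, rfl⟩
  · rw [zero_pow hn.ne']; simpa using hpos
  · have h := small_divisor (by linarith) hω hn
    have h0 : 0 < ‖Efn ω ^ n - 1‖ := (by positivity : 0 < (M * (n : ℝ) ^ (1 + τ))⁻¹).trans_le h
    refine ⟨norm_pos_iff.1 h0, ?_⟩
    rw [norm_inv]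
    exact inv_le_of_inv_le₀ (by positivity) h

lemma one_le_of_zetaR (hτ : 0 < τ) (hM : 2 * zetaR (1 + τ) < M) : 1 ≤ M := by
  have hs : Summable fun n : ℕ => 1 / (n + 1 : ℝ) ^ (1 + τ) := by
    have := (summable_nat_add_iff 1).2 (Real.summable_one_div_nat_rpow.2 (by linarith : 1 < 1 + τ))
    simpa using this
  have h1 : (1 : ℝ) ≤ zetaR (1 + τ) := by
    have := hs.le_tsum 0 (fun n _ => by positivity)
    simpa [zetaR] using this
  linarith

end SmallDivisors
section ChartSeminorm
open scoped ENNReal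

/-- `D` is a continuous difference quotient of `f` on `K`, bounded by `C`. -/
structure Quot (K : Set ℂ) (f : ℂ → ℂ) (D : ℂ × ℂ → ℂ) (C : ℝ) : Prop where
  cont : ContinuousOn D (K ×ˢ K)
  bound : ∀ p ∈ K ×ˢ K, ‖D p‖ ≤ C
  eq : ∀ p ∈ K ×ˢ K, f p.2 - f p.1 = (p.2 - p.1) * D p

namespace Quot

variable {K : Set ℂ} {f g : ℂ → ℂ} {D E : ℂ × ℂ → ℂ} {A A' C C' : ℝ}

lemma continuousOn (h : Quot K f D C) : ContinuousOn f K := by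
  intro x hx
  have hD : ContinuousWithinAt (fun y => D (x, y)) K x :=
    (h.cont (x, x) ⟨hx, hx⟩).comp (f := fun y => (x, y)) (t := K ×ˢ K)
      (by fun_prop) (fun y hy => ⟨hx, hy⟩)
  have h2 : ContinuousWithinAt (fun y => f x + (y - x) * D (x, y)) K x :=
    continuousWithinAt_const.add ((continuousWithinAt_id.sub continuousWithinAt_const).mul hD)
  refine h2.congr (fun y hy => ?_) ?_
  · rw [← h.eq (x, y) ⟨hx, hy⟩]; ring
  · simp

lemma const (c : ℂ) : Quot K (fun _ => c) 0 0 :=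
  ⟨continuousOn_const, fun _ _ => by simp, fun _ _ => by simp⟩

lemma add (h : Quot K f D C) (h' : Quot K g E C') : Quot K (f + g) (D + E) (C + C') where
  cont := h.cont.add h'.cont
  bound p hp := (norm_add_le _ _).trans (add_le_add (h.bound p hp) (h'.bound p hp))
  eq p hp := by
    simp only [Pi.add_apply]; linear_combination h.eq p hp + h'.eq p hp

lemma mul (h : Quot K f D C) (h' : Quot K g E C') (hf : ∀ x ∈ K, ‖f x‖ ≤ A)
    (hg : ∀ x ∈ K, ‖g x‖ ≤ A') :
    Quot K (f * g) (fun p => f p.1 * E p + D p * g p.2) (A * C' + C * A') where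
  cont := ((h.continuousOn.comp continuousOn_fst fun _ hp => hp.1).mul h'.cont).add
    (h.cont.mul (h'.continuousOn.comp continuousOn_snd fun _ hp => hp.2))
  bound p hp := by
    have h1 := hf _ hp.1
    have h2 := hg _ hp.2
    have h3 := h.bound _ hp
    have h4 := h'.bound _ hp
    have : 0 ≤ A := (norm_nonneg _).trans h1
    have : 0 ≤ C := (norm_nonneg _).trans h3
    refine (norm_add_le _ _).trans ?_
    rw [norm_mul, norm_mul]
    gcongr
  eq p hp := by
    simp only [Pi.mul_apply]; linear_combination f p.1 * h'.eq p hp + g p.2 * h.eq p hp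

lemma mono (h : Quot K f D C) (hC : C ≤ C') : Quot K f D C' :=
  ⟨h.cont, fun p hp => (h.bound p hp).trans hC, h.eq⟩

end Quot

/-- The points of `K` other than `0` and `∞`. -/
abbrev Pts (K : Set (OnePoint ℂ)) : Type := {q : ℂ // q ≠ 0 ∧ (q : OnePoint ℂ) ∈ K}

variable {K : Set (OnePoint ℂ)}

/-- `Φ` extends `φ` to `K`, and has bounded continuous difference quotients in both charts. -/
structure Lift (φ : Pts K → ℂ) (Φ : OnePoint ℂ → ℂ) (D₁ D₂ : ℂ × ℂ → ℂ) (C₀ C₁ : ℝ) : Prop where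
  ext : ∀ x : Pts K, Φ (x : ℂ) = φ x
  bound : ∀ p ∈ K, ‖Φ p‖ ≤ C₀
  fin : Quot (finPart K) (fun q => Φ (q : OnePoint ℂ)) D₁ C₁
  inf : Quot (infPart K) (fun ξ => Φ (sphChart ξ)) D₂ C₁
  nonneg : 0 ≤ C₀
  nonneg' : 0 ≤ C₁

namespace Lift

variable {φ ψ : Pts K → ℂ} {Φ Ψ : OnePoint ℂ → ℂ} {D₁ D₂ E₁ E₂ : ℂ × ℂ → ℂ} {C₀ C₁ C₀' C₁' : ℝ}

lemma const (c : ℂ) : Lift (K := K) (fun _ => c) (fun _ => c) 0 0 ‖c‖ 0 :=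
  ⟨fun _ => rfl, fun _ _ => le_rfl, Quot.const c, Quot.const c, norm_nonneg _, le_rfl⟩

lemma add (h : Lift φ Φ D₁ D₂ C₀ C₁) (h' : Lift ψ Ψ E₁ E₂ C₀' C₁') :
    Lift (φ + ψ) (Φ + Ψ) (D₁ + E₁) (D₂ + E₂) (C₀ + C₀') (C₁ + C₁') where
  ext x := by simp [h.ext, h'.ext]
  bound p hp := (norm_add_le _ _).trans (add_le_add (h.bound p hp) (h'.bound p hp))
  fin := h.fin.add h'.fin
  inf := h.inf.add h'.inf
  nonneg := add_nonneg h.nonneg h'.nonneg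
  nonneg' := add_nonneg h.nonneg' h'.nonneg'

lemma mul (h : Lift φ Φ D₁ D₂ C₀ C₁) (h' : Lift ψ Ψ E₁ E₂ C₀' C₁') :
    Lift (φ * ψ) (Φ * Ψ) (fun p => Φ (p.1 : ℂ) * E₁ p + D₁ p * Ψ (p.2 : ℂ))
      (fun p => Φ (sphChart p.1) * E₂ p + D₂ p * Ψ (sphChart p.2)) (C₀ * C₀')
      (C₀ * C₁' + C₁ * C₀') where
  ext x := by simp [h.ext, h'.ext]
  bound p hp := by
    rw [Pi.mul_apply, norm_mul]
    exact mul_le_mul (h.bound p hp) (h'.bound p hp) (norm_nonneg _) h.nonneg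
  fin := h.fin.mul h'.fin (fun x hx => h.bound _ hx) (fun x hx => h'.bound _ hx)
  inf := h.inf.mul h'.inf (fun x hx => h.bound _ hx) (fun x hx => h'.bound _ hx)
  nonneg := mul_nonneg h.nonneg h'.nonneg
  nonneg' := add_nonneg (mul_nonneg h.nonneg h'.nonneg') (mul_nonneg h.nonneg' h'.nonneg)

end Lift

/-- `φ` has a `C¹` extension to `K` of size at most `C`. -/
def HasLift (φ : Pts K → ℂ) (C : ℝ) : Prop :=
  ∃ Φ D₁ D₂ C₀ C₁, Lift φ Φ D₁ D₂ C₀ C₁ ∧ C₀ + C₁ ≤ C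

/-- The `C¹` seminorm on functions on `K`. -/
def nu (K : Set (OnePoint ℂ)) (φ : Pts K → ℂ) : ℝ≥0∞ :=
  ⨅ (C : ℝ) (_ : HasLift φ C), ENNReal.ofReal C

lemma nu_le {φ : Pts K → ℂ} {C : ℝ} (h : HasLift φ C) : nu K φ ≤ ENNReal.ofReal C :=
  iInf₂_le C h

lemma exists_hasLift_of_lt {φ : Pts K → ℂ} {a : ℝ≥0∞} (h : nu K φ < a) :
    ∃ C, HasLift φ C ∧ ENNReal.ofReal C < a := by
  simpa only [nu, iInf_lt_iff, exists_prop] using h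

lemma HasLift.nonneg {φ : Pts K → ℂ} {C : ℝ} (h : HasLift φ C) : 0 ≤ C := by
  obtain ⟨Φ, D₁, D₂, C₀, C₁, h, hC⟩ := h
  linarith [h.nonneg, h.nonneg']

lemma HasLift.norm_le {φ : Pts K → ℂ} {C : ℝ} (h : HasLift φ C) (x : Pts K) : ‖φ x‖ ≤ C := by
  obtain ⟨Φ, D₁, D₂, C₀, C₁, h, hC⟩ := h
  have := h.bound _ x.2.2
  rw [h.ext] at this
  linarith [h.nonneg']

lemma norm_le_nu (φ : Pts K → ℂ) (x : Pts K) : ENNReal.ofReal ‖φ x‖ ≤ nu K φ :=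
  le_iInf₂ fun _ h => ENNReal.ofReal_le_ofReal (h.norm_le x)

lemma eq_zero_of_nu {φ : Pts K → ℂ} (h : nu K φ = 0) : φ = 0 := by
  funext x
  have := norm_le_nu φ x
  rw [h, nonpos_iff_eq_zero, ENNReal.ofReal_eq_zero] at this
  exact norm_le_zero_iff.1 this

lemma HasLift.const (c : ℂ) : HasLift (K := K) (fun _ => c) ‖c‖ :=
  ⟨_, _, _, _, _, Lift.const c, by simp⟩

lemma nu_const_le (c : ℂ) : nu K (fun _ => c) ≤ ENNReal.ofReal ‖c‖ := nu_le (HasLift.const c)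

lemma isSeminorm_nu (K : Set (OnePoint ℂ)) : IsSeminorm (nu K) where
  const_le c := nu_const_le c
  add_le φ ψ := by
    refine ENNReal.le_of_forall_pos_le_add fun ε hε htop => ?_
    have hφ : nu K φ < ⊤ := lt_of_le_of_lt le_self_add htop
    have hψ : nu K ψ < ⊤ := lt_of_le_of_lt le_add_self htop
    have hε' : (ε / 2 : ℝ≥0∞) ≠ 0 := by simpa using hε.ne'
    obtain ⟨C, ⟨Φ, D₁, D₂, C₀, C₁, h, hC⟩, hC'⟩ :=
      exists_hasLift_of_lt (ENNReal.lt_add_right hφ.ne hε')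
    obtain ⟨E, ⟨Φ', D₁', D₂', C₀', C₁', h', hE⟩, hE'⟩ :=
      exists_hasLift_of_lt (ENNReal.lt_add_right hψ.ne hε')
    have hC0 : 0 ≤ C := by linarith [h.nonneg, h.nonneg']
    have hE0 : 0 ≤ E := by linarith [h'.nonneg, h'.nonneg']
    have h1 : nu K (φ + ψ) ≤ ENNReal.ofReal (C + E) :=
      nu_le ⟨_, _, _, _, _, h.add h', by linarith⟩
    rw [ENNReal.ofReal_add hC0 hE0] at h1
    calc nu K (φ + ψ) ≤ (nu K φ + ε / 2) + (nu K ψ + ε / 2) := h1.trans (add_le_add hC'.le hE'.le)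
      _ = nu K φ + nu K ψ + (ε / 2 + ε / 2) := by ring
      _ = nu K φ + nu K ψ + ε := by rw [ENNReal.add_halves]
  mul_le φ ψ := by
    have h0 : nu K (0 : Pts K → ℂ) = 0 := by
      have := nu_const_le (K := K) 0
      rw [norm_zero, ENNReal.ofReal_zero, nonpos_iff_eq_zero] at this
      exact this
    by_cases hφ : nu K φ = 0
    · rw [eq_zero_of_nu hφ, zero_mul, h0]; exact zero_le
    by_cases hψ : nu K ψ = 0
    · rw [eq_zero_of_nu hψ, mul_zero, h0]; exact zero_le
    refine ENNReal.le_mul_of_forall_lt (Or.inl hφ) (Or.inr hψ) fun a ha b hb => ?_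
    obtain ⟨C, ⟨Φ, D₁, D₂, C₀, C₁, h, hC⟩, hC'⟩ := exists_hasLift_of_lt ha
    obtain ⟨E, ⟨Φ', D₁', D₂', C₀', C₁', h', hE⟩, hE'⟩ := exists_hasLift_of_lt hb
    have hC0 : 0 ≤ C := by linarith [h.nonneg, h.nonneg']
    have hle : C₀ * C₀' + (C₀ * C₁' + C₁ * C₀') ≤ C * E := by
      calc _ ≤ (C₀ + C₁) * (C₀' + C₁') := by nlinarith [mul_nonneg h.nonneg' h'.nonneg']
        _ ≤ C * E := mul_le_mul hC hE (add_nonneg h'.nonneg h'.nonneg') hC0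
    refine (nu_le ⟨_, _, _, _, _, h.mul h', hle⟩).trans ?_
    rw [ENNReal.ofReal_mul hC0]
    exact mul_le_mul' hC'.le hE'.le

end ChartSeminorm
section Divisor
open scoped ENNReal

/-- The coordinate `q`, a unit of the algebra of functions on the points of `K`. -/
def coord (K : Set (OnePoint ℂ)) : (Pts K → ℂ)ˣ where
  val x := x
  inv x := (x : ℂ)⁻¹
  val_inv := by funext x; exact mul_inv_cancel₀ x.2.1
  inv_val := by funext x; exact inv_mul_cancel₀ x.2.1

/-- The symbol `(q^k - 1)⁻¹`. -/
def symb (K : Set (OnePoint ℂ)) (k : ℤ) (x : Pts K) : ℂ := if k = 0 then 0 else ((x : ℂ) ^ k - 1)⁻¹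

lemma coord_zpow {K : Set (OnePoint ℂ)} (k : ℤ) (x : Pts K) :
    ((coord K ^ k : (Pts K → ℂ)ˣ) : Pts K → ℂ) x = (x : ℂ) ^ k := by
  have h := congrArg Units.val (map_zpow (Units.map (Pi.evalMonoidHom (fun _ : Pts K => ℂ) x))
    (coord K) k)
  rw [Units.val_zpow_eq_zpow_val] at h
  exact h

variable {τ M : ℝ}

lemma zpow_sub_one_ne_zero (hτ : 0 ≤ τ) (hM : 1 ≤ M) (x : Pts (KM τ M)) {k : ℤ} (hk : k ≠ 0) :
    (x : ℂ) ^ k - 1 ≠ 0 := by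
  obtain ⟨n, rfl | rfl⟩ := k.eq_nat_or_neg
  · rw [zpow_natCast]
    exact (norm_inv_pow_sub_one_le hτ hM x.2.2 (by omega)).1
  · have := (norm_inv_pow_sub_one_le hτ hM x.2.2 (n := n) (by omega)).1
    rw [zpow_neg, zpow_natCast]
    rw [sub_ne_zero] at this ⊢
    rwa [Ne, inv_eq_one]

lemma isDivisor_symb (hτ : 0 ≤ τ) (hM : 1 ≤ M) :
    IsDivisor (coord (KM τ M)) (symb (KM τ M)) where
  zero := by funext x; simp [symb]
  mul k hk := by
    funext x
    simp only [Pi.mul_apply, Pi.sub_apply, coord_zpow, symb, if_neg hk, Pi.one_apply]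
    exact inv_mul_cancel₀ (zpow_sub_one_ne_zero hτ hM x hk)

lemma symb_neg (hτ : 0 ≤ τ) (hM : 1 ≤ M) {k : ℤ} (hk : k ≠ 0) :
    symb (KM τ M) (-k) = -(1 + symb (KM τ M) k) := by
  funext x
  have h := zpow_sub_one_ne_zero hτ hM x hk
  have h' := zpow_sub_one_ne_zero hτ hM x (neg_ne_zero.2 hk)
  have h0 : (x : ℂ) ^ k ≠ 0 := zpow_ne_zero _ x.2.1
  simp only [symb, neg_eq_zero, if_neg hk, Pi.neg_apply, Pi.add_apply, Pi.one_apply]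
  rw [zpow_neg] at h' ⊢
  field_simp
  grind

lemma adj_symb (hτ : 0 ≤ τ) (hM : 1 ≤ M) (k : ℤ) :
    adj (symb (KM τ M)) k = -symb (KM τ M) (-k) := by
  by_cases hk : k = 0
  · subst hk; funext x; simp [adj, symb]
  · rw [symb_neg hτ hM hk, neg_neg, adj, if_neg hk]

/-- The difference quotient of `q ↦ (q^n - 1)⁻¹`. -/
def invQuot (n : ℕ) (p : ℂ × ℂ) : ℂ :=
  -(∑ i ∈ Finset.range n, p.2 ^ i * p.1 ^ (n - 1 - i)) * ((p.1 ^ n - 1)⁻¹ * (p.2 ^ n - 1)⁻¹)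

lemma norm_pow_mul_inv_le (hτ : 0 ≤ τ) (hM : 1 ≤ M) {q : ℂ} (hq : q ∈ finPart (KM τ M)) {n i : ℕ}
    (hn : 0 < n) (hi : i ≤ n) : ‖q ^ i * (q ^ n - 1)⁻¹‖ ≤ 1 + M * (n : ℝ) ^ (1 + τ) := by
  obtain ⟨h0, h1⟩ := norm_inv_pow_sub_one_le hτ hM hq hn
  rcases le_total ‖q‖ 1 with h | h
  · rw [norm_mul, norm_pow]
    calc ‖q‖ ^ i * ‖(q ^ n - 1)⁻¹‖ ≤ 1 * ‖(q ^ n - 1)⁻¹‖ := by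
          gcongr; exact pow_le_one₀ (norm_nonneg _) h
      _ ≤ _ := by linarith
  · calc ‖q ^ i * (q ^ n - 1)⁻¹‖ ≤ ‖q ^ n * (q ^ n - 1)⁻¹‖ := by
          rw [norm_mul, norm_mul, norm_pow, norm_pow]; gcongr
      _ = ‖1 + (q ^ n - 1)⁻¹‖ := by
          congr 1; field_simp; ring
      _ ≤ 1 + ‖(q ^ n - 1)⁻¹‖ := by simpa using norm_add_le 1 (q ^ n - 1)⁻¹
      _ ≤ _ := by linarith

lemma quot_inv (hτ : 0 ≤ τ) (hM : 1 ≤ M) {n : ℕ} (hn : 0 < n) :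
    Quot (finPart (KM τ M)) (fun q => (q ^ n - 1)⁻¹) (invQuot n)
      (n * (1 + M * (n : ℝ) ^ (1 + τ)) ^ 2) where
  cont := by
    have hc : ContinuousOn (fun q : ℂ => (q ^ n - 1)⁻¹) (finPart (KM τ M)) :=
      ContinuousOn.inv₀ (by fun_prop) fun q hq => (norm_inv_pow_sub_one_le hτ hM hq hn).1
    unfold invQuot
    exact (Continuous.continuousOn (by fun_prop)).mul
      ((hc.comp continuousOn_fst fun _ hp => hp.1).mul (hc.comp continuousOn_snd fun _ hp => hp.2))
  bound p hp := by
    rw [invQuot, neg_mul, norm_neg, Finset.sum_mul]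
    refine (norm_sum_le _ _).trans ?_
    refine (Finset.sum_le_card_nsmul _ _ ((1 + M * (n : ℝ) ^ (1 + τ)) ^ 2) fun i hi => ?_).trans ?_
    · have hi' := Finset.mem_range.1 hi
      rw [show p.2 ^ i * p.1 ^ (n - 1 - i) * ((p.1 ^ n - 1)⁻¹ * (p.2 ^ n - 1)⁻¹) =
        (p.2 ^ i * (p.2 ^ n - 1)⁻¹) * (p.1 ^ (n - 1 - i) * (p.1 ^ n - 1)⁻¹) by ring, norm_mul, sq]
      have h1 := norm_pow_mul_inv_le hτ hM hp.2 hn hi'.le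
      have h2 := norm_pow_mul_inv_le hτ hM hp.1 hn (i := n - 1 - i) (by omega)
      exact mul_le_mul h1 h2 (norm_nonneg _) ((norm_nonneg _).trans h1)
    · simp
  eq p hp := by
    have h1 := (norm_inv_pow_sub_one_le hτ hM hp.1 hn).1
    have h2 := (norm_inv_pow_sub_one_le hτ hM hp.2 hn).1
    have h := (Commute.all p.2 p.1).geom_sum₂_mul n
    rw [invQuot]
    field_simp
    linear_combination h

/-- The extension of `(q^n - 1)⁻¹` to the Riemann sphere. -/
def invExt (n : ℕ) : OnePoint ℂ → ℂ
  | ∞ => 0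
  | (q : ℂ) => (q ^ n - 1)⁻¹

lemma lift_inv (hτ : 0 ≤ τ) (hM : 1 ≤ M) {n : ℕ} (hn : 0 < n) :
    Lift (K := KM τ M) (symb (KM τ M) n) (invExt n) (invQuot n) (-invQuot n)
      (M * (n : ℝ) ^ (1 + τ)) (n * (1 + M * (n : ℝ) ^ (1 + τ)) ^ 2) where
  ext x := by
    change ((x : ℂ) ^ n - 1)⁻¹ = _
    rw [symb, if_neg (by exact_mod_cast hn.ne'), zpow_natCast]
  bound p hp := by
    induction p using OnePoint.rec with
    | infty =>
      change ‖(0 : ℂ)‖ ≤ _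
      rw [norm_zero]; positivity
    | coe q => exact (norm_inv_pow_sub_one_le hτ hM hp hn).2
  fin := quot_inv hτ hM hn
  inf := by
    have hq := quot_inv hτ hM hn
    have key (ξ : ℂ) (hξ : ξ ∈ infPart (KM τ M)) :
        invExt n (sphChart ξ) = -1 - (ξ ^ n - 1)⁻¹ := by
      have h := (norm_inv_pow_sub_one_le hτ hM (infPart_subset hξ) hn).1
      by_cases h0 : ξ = 0
      · rw [sphChart, if_pos h0]
        change (0 : ℂ) = _
        rw [h0, zero_pow hn.ne']; norm_num
      · have h' := (norm_inv_pow_sub_one_le hτ hM (q := ξ⁻¹) (n := n) (by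
          have := hξ
          rwa [infPart, Set.mem_ofPred_eq, sphChart, if_neg h0] at this) hn).1
        rw [sphChart, if_neg h0]
        change (ξ⁻¹ ^ n - 1)⁻¹ = _
        have h2 : ξ ^ n ≠ 0 := pow_ne_zero _ h0
        rw [inv_pow] at h' ⊢
        field_simp
        grind
    refine ⟨(hq.cont.mono (prod_mono infPart_subset infPart_subset)).neg, fun p hp => ?_,
      fun p hp => ?_⟩
    · rw [Pi.neg_apply, norm_neg]
      exact hq.bound p ⟨infPart_subset hp.1, infPart_subset hp.2⟩
    · have := hq.eq p ⟨infPart_subset hp.1, infPart_subset hp.2⟩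
      simp only [key _ hp.1, key _ hp.2, Pi.neg_apply]
      linear_combination -this
  nonneg := by positivity
  nonneg' := by positivity

lemma nu_symb_le (hτ : 0 ≤ τ) (hM : 1 ≤ M) (k : ℤ) :
    nu (KM τ M) (symb (KM τ M) k) ≤ ENNReal.ofReal (6 * M ^ 2 * |k| ^ ⌈3 + 2 * τ⌉₊) := by
  have hν := isSeminorm_nu (KM τ M)
  have main (n : ℕ) (hn : 0 < n) : M * (n : ℝ) ^ (1 + τ) +
      n * (1 + M * (n : ℝ) ^ (1 + τ)) ^ 2 ≤ 5 * M ^ 2 * (n : ℝ) ^ ⌈3 + 2 * τ⌉₊ ∧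
      1 ≤ M ^ 2 * (n : ℝ) ^ ⌈3 + 2 * τ⌉₊ := by
    have hn' : (1 : ℝ) ≤ n := by exact_mod_cast hn
    set b := M * (n : ℝ) ^ (1 + τ) with hb
    have hb1 : 1 ≤ b := one_le_mul_of_one_le_of_one_le hM (Real.one_le_rpow hn' (by linarith))
    have h1 : n * b ^ 2 ≤ M ^ 2 * (n : ℝ) ^ ⌈3 + 2 * τ⌉₊ := by
      have e : n * b ^ 2 = M ^ 2 * (n : ℝ) ^ (3 + 2 * τ) := by
        rw [hb, mul_pow, ← Real.rpow_natCast ((n : ℝ) ^ (1 + τ)) 2, ← Real.rpow_mul (by linarith),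
          show 3 + 2 * τ = 1 + (1 + τ) * (2 : ℕ) by push_cast; ring,
          Real.rpow_add (by linarith), Real.rpow_one]
        ring
      rw [e, ← Real.rpow_natCast (n : ℝ) ⌈3 + 2 * τ⌉₊]
      gcongr
      · exact Nat.le_ceil _
    have h2 : b ≤ b ^ 2 := by nlinarith
    have h3 : b ^ 2 ≤ n * b ^ 2 := by nlinarith [sq_nonneg b]
    have h4 : (1 + b) ^ 2 ≤ 4 * b ^ 2 := by nlinarith
    have h5 : n * (1 + b) ^ 2 ≤ n * (4 * b ^ 2) := by gcongr
    constructor <;> nlinarith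
  have hpos (n : ℕ) (hn : 0 < n) : nu (KM τ M) (symb (KM τ M) n) ≤
      ENNReal.ofReal (5 * M ^ 2 * (n : ℝ) ^ ⌈3 + 2 * τ⌉₊) :=
    nu_le ⟨_, _, _, _, _, lift_inv hτ hM hn, (main n hn).1⟩
  rcases eq_or_ne k 0 with rfl | hk
  · rw [(isDivisor_symb hτ hM).zero, hν.zero]; exact zero_le
  obtain ⟨n, rfl | rfl⟩ := k.eq_nat_or_neg
  · refine (hpos n (by omega)).trans (ENNReal.ofReal_le_ofReal ?_)
    rw [Nat.abs_cast, Int.cast_natCast]; gcongr; norm_num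
  · have hn : 0 < n := by omega
    rw [symb_neg hτ hM (by omega)]
    refine (hν.neg_le _).trans ((hν.add_le _ _).trans ((add_le_add hν.one_le (hpos n hn)).trans ?_))
    rw [← ENNReal.ofReal_one, ← ENNReal.ofReal_add zero_le_one (by positivity)]
    refine ENNReal.ofReal_le_ofReal ?_
    rw [abs_neg, Nat.abs_cast, Int.cast_natCast]
    linarith [(main n hn).2]

lemma nu_adj_symb_le (hτ : 0 ≤ τ) (hM : 1 ≤ M) (k : ℤ) :
    nu (KM τ M) (adj (symb (KM τ M)) k) ≤ ENNReal.ofReal (6 * M ^ 2 * |k| ^ ⌈3 + 2 * τ⌉₊) := by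
  rw [adj_symb hτ hM]
  refine ((isSeminorm_nu _).neg_le _).trans ?_
  simpa only [abs_neg] using nu_symb_le hτ hM (-k)

end Divisor
section FormalSolution
open scoped ENNReal

/-- The exponent of the monomial standing for `e^{2πikθ}`. -/
def expo (k : ℤ) : Fin 3 →₀ ℕ := Finsupp.single 0 k.toNat + Finsupp.single 1 (-k).toNat

@[simp] lemma expo_zero (k : ℤ) : expo k 0 = k.toNat := by simp [expo]
@[simp] lemma expo_one (k : ℤ) : expo k 1 = (-k).toNat := by simp [expo]
@[simp] lemma expo_two (k : ℤ) : expo k 2 = 0 := by simp [expo]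

@[simp] lemma chg_expo (k : ℤ) : chg (expo k) = k := by
  simp [chg]

lemma expo_injective : Function.Injective expo := fun k l h => by
  rw [← chg_expo k, h, chg_expo]

lemma expo_add (k : ℤ) : ((expo k 0 : ℝ) + expo k 1) = |(k : ℝ)| := by
  have : ((k.toNat : ℤ) + ((-k).toNat : ℤ)) = |k| := by grind
  rw [expo_zero, expo_one, ← Int.cast_abs, ← this]; push_cast; rfl

open Classical in
/-- The coefficients of the formal power series of a Fourier series. -/
def fcoeff (g : ℤ → ℂ) (m : Fin 3 →₀ ℕ) : ℂ := if m ∈ Set.range expo then g (chg m) else 0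

lemma fcoeff_expo (g : ℤ → ℂ) (k : ℤ) : fcoeff g (expo k) = g k := by
  rw [fcoeff, if_pos ⟨k, rfl⟩, chg_expo]

lemma fcoeff_of_notMem (g : ℤ → ℂ) {m : Fin 3 →₀ ℕ} (h : m ∉ Set.range expo) :
    fcoeff g m = 0 := if_neg h

lemma fcoeff_of_ne (g : ℤ → ℂ) {m : Fin 3 →₀ ℕ} (h : m 2 ≠ 0) : fcoeff g m = 0 :=
  fcoeff_of_notMem g fun ⟨k, hk⟩ => h (by rw [← hk, expo_two])

/-- The formal power series of a Fourier series. -/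
def fser (R : Type*) [CommRing R] [Algebra ℂ R] (g : ℤ → ℂ) : PS R :=
  fun m => algebraMap ℂ R (fcoeff g m)

lemma coeff_fser (R : Type*) [CommRing R] [Algebra ℂ R] (g : ℤ → ℂ) (m : Fin 3 →₀ ℕ) :
    MvPowerSeries.coeff m (fser R g) = algebraMap ℂ R (fcoeff g m) := rfl

lemma mean_fser {R : Type*} [CommRing R] [Algebra ℂ R] {g : ℤ → ℂ} (hg : g 0 = 0) :
    mean (fser R g) = 0 := by
  ext m
  rw [mean, coeff_fmul, coeff_fser]
  split_ifs with h
  · rw [fcoeff, h, hg]; simp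
  · simp

lemma tsum_fcoeff {g : ℤ → ℂ} {s B : ℝ} (hg : Summable fun k : ℤ => ‖g k‖ * Real.exp ((s + B) * |(k : ℝ)|)) :
    ∑' m, ENNReal.ofReal (‖fcoeff g m‖ * Real.exp (s * (m 0 + m 1) + B * |(chg m : ℝ)|)) =
      ENNReal.ofReal (∑' k : ℤ, ‖g k‖ * Real.exp ((s + B) * |(k : ℝ)|)) := by
  rw [← expo_injective.tsum_eq, ENNReal.ofReal_tsum_of_nonneg (fun k => by positivity) hg]
  · refine tsum_congr fun k => ?_
    rw [fcoeff_expo, expo_add, chg_expo, add_mul]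
  · intro m hm
    by_contra h
    exact hm (by simp [fcoeff_of_notMem g h])

/-- The weighted `ℓ¹` norm. -/
def Tot {R : Type*} [CommRing R] (ν : R → ℝ≥0∞) (s ρ : ℝ) (u : PS R) : ℝ≥0∞ :=
  ∑' m : Fin 3 →₀ ℕ, ν (MvPowerSeries.coeff m u) * wt s ρ m

lemma tot_le {R : Type*} [CommRing R] {ν : R → ℝ≥0∞} {s ρ : ℝ} {u : PS R} {C : ℝ≥0∞}
    (h : ∀ J, Nm ν s ρ J u ≤ C) : Tot ν s ρ u ≤ C := by
  rw [Tot, ENNReal.tsum_eq_iSup_sum]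
  refine iSup_le fun S => ?_
  refine le_trans ?_ (h (S.sup (fun m => m 2) + 1))
  refine le_trans (Finset.sum_le_sum fun m hm => ?_) (ENNReal.sum_le_tsum S)
  rw [if_pos (Nat.lt_succ_of_le (Finset.le_sup (f := fun m : Fin 3 →₀ ℕ => m 2) hm))]

/-- The formal solution over `K_M`, with bounds uniform in `M` after rescaling `ε`. -/
theorem exists_bound {τ : ℝ} (hτ : 0 ≤ τ) {g : ℤ → ℂ} (hg0 : g 0 = 0) {s₀ δ₀ B β : ℝ}
    (hδ : 0 < δ₀) (hδ1 : δ₀ ≤ 1) (hB : 0 < B) (hβ : 0 < β) (hβ1 : β ≤ 1 / 10) (hβB : β ≤ B)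
    (hg : Summable fun k : ℤ => ‖g k‖ * Real.exp ((s₀ + B) * |(k : ℝ)|)) :
    ∃ c : ℝ, 0 < c ∧ ∀ M : ℝ, 1 ≤ M → ∀ v : PS (Pts (KM τ M) → ℂ),
      IsSol (dbl (symb (KM τ M))) (fser _ g) v →
      Tot (nu (KM τ M)) (s₀ - 6 * δ₀) (2 * (c / M ^ 8)) v ≤ ENNReal.ofReal β ∧
      Tot (nu (KM τ M)) (s₀ - 6 * δ₀) (2 * (c / M ^ 8)) (dD v) ≤ ENNReal.ofReal β := by
  set p := ⌈3 + 2 * τ⌉₊ with hp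
  set g₀ := ∑' k : ℤ, ‖g k‖ * Real.exp ((s₀ + B) * |(k : ℝ)|) with hg₀
  have hg₀0 : 0 ≤ g₀ := tsum_nonneg fun k => by positivity
  set A := 120 * 6 ^ 2 * (p.factorial : ℝ) ^ 2 * (g₀ + 1) * δ₀⁻¹ ^ (2 * p + 1) with hA
  have hA0 : 0 < A := by positivity
  refine ⟨β / A * 2⁻¹ ^ (8 * (p + 1)) / 2, by positivity, fun M hM v hv => ?_⟩
  have hM0 : 0 < M := by linarith
  have hν := isSeminorm_nu (KM τ M)
  have hρ : 0 < β / A / M ^ 8 := by positivity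
  have hM48 : M ^ 4 / M ^ 8 ≤ 1 := by
    rw [div_le_one (by positivity)]; exact pow_le_pow_right₀ hM (by norm_num)
  have hK : 120 * (6 * M ^ 2) ^ 2 * (p.factorial : ℝ) ^ 2 * (β / A / M ^ 8) * g₀ *
      δ₀⁻¹ ^ (2 * p + 1) ≤ β := by
    calc 120 * (6 * M ^ 2) ^ 2 * (p.factorial : ℝ) ^ 2 * (β / A / M ^ 8) * g₀ *
          δ₀⁻¹ ^ (2 * p + 1)
        ≤ 120 * (6 * M ^ 2) ^ 2 * (p.factorial : ℝ) ^ 2 * (β / A / M ^ 8) * (g₀ + 1) *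
          δ₀⁻¹ ^ (2 * p + 1) := by gcongr; linarith
      _ = β * (A / A) * (M ^ 4 / M ^ 8) := by rw [hA]; ring
      _ ≤ β * (A / A) * 1 := by gcongr
      _ = β := by rw [div_self hA0.ne']; ring
  have key := sol_bd hν (isDivisor_symb hτ hM) (mean_fser hg0) hv hδ hδ1
    (by nlinarith : 1 ≤ 6 * M ^ 2) hρ hg₀0 (nu_symb_le hτ hM) (nu_adj_symb_le hτ hM)
    (fun s hs ρ hρ J w hw => comp_bd hν hρ (coeff_fser _ g) (fun m hm => fcoeff_of_ne g hm) hB.le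
      hg₀0 hs (tsum_fcoeff hg).le hw J) hβ1 hβB hK
  have e : 2 * (β / A * 2⁻¹ ^ (8 * (p + 1)) / 2 / M ^ 8) = β / A / M ^ 8 * 2⁻¹ ^ (8 * (p + 1)) := by
    ring
  rw [e]
  exact ⟨tot_le fun J => (key J).1.2, tot_le fun J => (key J).2.2⟩

end FormalSolution
section Fourier

lemma ek_add (k : ℤ) (x y : ℂ) : ek k (x + y) = ek k x * ek k y := by
  rw [ek, ek, ek, ← Complex.exp_add]; congr 1; ring

lemma ek_int (k l : ℤ) : ek k l = 1 := by
  rw [ek, Complex.exp_eq_one_iff]; exact ⟨k * l, by push_cast; ring⟩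

lemma ek_add_one (k : ℤ) (x : ℂ) : ek k (x + 1) = ek k x := by
  rw [ek_add]; simpa using congrArg (ek k x * ·) (ek_int k 1)

lemma norm_ek (k : ℤ) (x : ℂ) : ‖ek k x‖ = Real.exp (-(2 * Real.pi * k * x.im)) := by
  rw [ek, Complex.norm_exp]; congr 1; simp

lemma continuous_ek (k : ℤ) : Continuous (ek k) := by unfold ek; fun_prop

lemma conj_ek (k : ℤ) (x : ℝ) : starRingEnd ℂ (ek k x) = ek (-k) x := by
  rw [ek, ek, ← Complex.exp_conj]
  simp [Complex.conj_ofNat]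

variable {R₁ : ℝ} {F : ℂ → ℂ}

/-- Fourier coefficients of a function on the real line. -/
def four (F : ℂ → ℂ) (k : ℤ) : ℂ := ∫ t in (0:ℝ)..1, F t * ek (-k) t

lemma isOpen_Strip (r : ℝ) : IsOpen (Strip r) :=
  isOpen_lt (continuous_abs.comp Complex.continuous_im) continuous_const

lemma four_shift (hFper : ∀ z : ℂ, F (z + 1) = F z) (hF : DifferentiableOn ℂ F (Strip R₁))
    (k : ℤ) {y : ℝ} (hy : |y| < R₁) :
    four F k = ∫ t in (0:ℝ)..1, F (t + y * I) * ek (-k) (t + y * I) := by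
  have hsub : (uIcc (0 : ℂ).re (1 + y * I).re ×ℂ uIcc (0 : ℂ).im (1 + y * I : ℂ).im) ⊆ Strip R₁ := by
    intro z hz
    rw [mem_reProdIm] at hz
    have h2 := hz.2
    simp only [zero_im, add_im, one_im, mul_im, ofReal_re, I_im, mul_one, ofReal_im, I_re, mul_zero,
      add_zero, zero_add] at h2
    refine lt_of_le_of_lt ?_ hy
    have := Set.abs_sub_left_of_mem_uIcc h2
    simpa using this
  have hdiff : DifferentiableOn ℂ (fun z => F z * ek (-k) z) (Strip R₁) :=
    hF.mul (Differentiable.differentiableOn (by unfold ek; fun_prop))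
  have h := Complex.integral_boundary_rect_eq_zero_of_differentiableOn
    (fun z => F z * ek (-k) z) 0 (1 + y * I) (hdiff.mono hsub)
  have hper (z : ℂ) : F (1 + z) * ek (-k) (1 + z) = F z * ek (-k) z := by
    rw [add_comm, hFper, ek_add_one]
  simp only [zero_im, add_im, one_im, mul_im, ofReal_re, I_im, mul_one, ofReal_im, I_re, mul_zero,
    add_zero, zero_add, zero_re, add_re, one_re, mul_re, sub_zero, ofReal_zero,
    ofReal_one, zero_mul, hper] at h
  rw [four]
  linear_combination h

lemma norm_four_le (hFper : ∀ z : ℂ, F (z + 1) = F z) (hF : DifferentiableOn ℂ F (Strip R₁))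
    {C : ℝ} (hC : ∀ z ∈ Strip R₁, ‖F z‖ ≤ C) {r : ℝ} (hr : 0 ≤ r) (hr1 : r < R₁) (k : ℤ) :
    ‖four F k‖ ≤ C * Real.exp (-(2 * Real.pi * r * |(k : ℝ)|)) := by
  have main (y : ℝ) (hy : |y| < R₁) : ‖four F k‖ ≤ C * Real.exp (2 * Real.pi * k * y) := by
    rw [four_shift hFper hF k hy]
    refine (intervalIntegral.norm_integral_le_of_norm_le_const
      (C := C * Real.exp (2 * Real.pi * k * y)) fun t _ => ?_).trans (by simp)
    rw [norm_mul, norm_ek]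
    have him : ((t : ℂ) + y * I).im = y := by simp
    have h1 := hC (t + y * I) (by rw [Strip, Set.mem_ofPred_eq, him]; exact hy)
    rw [him]
    refine mul_le_mul h1 (le_of_eq (by congr 1; push_cast; ring)) (Real.exp_pos _).le
      ((norm_nonneg _).trans h1)
  rcases le_total (0 : ℝ) k with hk | hk
  · refine (main (-r) (by rwa [abs_neg, abs_of_nonneg hr])).trans (le_of_eq ?_)
    rw [abs_of_nonneg hk]; congr 2; ring
  · refine (main r (by rwa [abs_of_nonneg hr])).trans (le_of_eq ?_)
    rw [abs_of_nonpos hk]; congr 2; ring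

lemma summable_exp_abs {a : ℝ} (ha : 0 < a) : Summable fun k : ℤ => Real.exp (-(a * |(k : ℝ)|)) := by
  have h : Summable fun n : ℕ => Real.exp (-(a * n)) := by
    simpa [neg_mul] using Real.summable_pow_mul_exp_neg_nat_mul 0 ha
  refine Summable.of_nat_of_neg ?_ ?_ <;> simpa using h

lemma summable_four (hFper : ∀ z : ℂ, F (z + 1) = F z) (hF : DifferentiableOn ℂ F (Strip R₁))
    (hFb : ∃ C : ℝ, ∀ z ∈ Strip R₁, ‖F z‖ ≤ C) {r : ℝ} (hr : 0 ≤ r) (hr1 : r < R₁) :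
    Summable fun k : ℤ => ‖four F k‖ * Real.exp (2 * Real.pi * r * |(k : ℝ)|) := by
  obtain ⟨C, hC⟩ := hFb
  have hC0 : 0 ≤ C := (norm_nonneg _).trans (hC 0 (by simp [Strip]; linarith))
  set a := 2 * Real.pi * ((R₁ - r) / 2) with ha
  have ha0 : 0 < a := by
    have : 0 < R₁ - r := by linarith
    positivity
  refine Summable.of_nonneg_of_le (fun k => by positivity) (fun k => ?_)
    ((summable_exp_abs ha0).mul_left C)
  refine (mul_le_mul_of_nonneg_right (norm_four_le hFper hF hC (r := (R₁ + r) / 2) (by linarith)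
    (by linarith) k) (Real.exp_pos _).le).trans (le_of_eq ?_)
  rw [mul_assoc, ← Real.exp_add]; congr 2; rw [ha]; ring

lemma hasSum_four (hFper : ∀ z : ℂ, F (z + 1) = F z) (hF : DifferentiableOn ℂ F (Strip R₁))
    (hFb : ∃ C : ℝ, ∀ z ∈ Strip R₁, ‖F z‖ ≤ C) (hR : 0 < R₁) (x : ℝ) :
    HasSum (fun k : ℤ => four F k * ek k x) (F x) := by
  have hreal (t : ℝ) : (t : ℂ) ∈ Strip R₁ := by simpa [Strip] using hR
  have hc : Continuous fun t : ℝ => F t :=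
    hF.continuousOn.comp_continuous Complex.continuous_ofReal hreal
  have hp : Function.Periodic (fun t : ℝ => F t) 1 := fun t => by
    simpa using hFper t
  have : Fact ((0 : ℝ) < 1) := ⟨one_pos⟩
  let f : C(AddCircle (1 : ℝ), ℂ) := ⟨hp.lift, hc.quotient_liftOn' _⟩
  have hf (t : ℝ) : f (t : AddCircle (1 : ℝ)) = F t := rfl
  have hk (k : ℤ) : fourierCoeff f k = four F k := by
    rw [fourierCoeff_eq_intervalIntegral f k 0, four]
    simp only [one_div, inv_one, one_smul, zero_add, smul_eq_mul, hf, fourier_coe_apply]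
    refine intervalIntegral.integral_congr fun t _ => ?_
    simp only [ek]
    rw [mul_comm]; congr 2; push_cast; ring
  have hs : Summable (fourierCoeff f) := by
    refine Summable.of_norm ?_
    simpa [funext hk] using summable_four hFper hF hFb le_rfl hR
  have := has_pointwise_sum_fourier_series_of_summable hs (x : AddCircle (1 : ℝ))
  simp only [hk, hf, fourier_coe_apply, smul_eq_mul] at this
  convert this using 3 with k
  rw [ek]; congr 1; push_cast; ring

lemma four_conj (hFreal : ∀ x : ℝ, (F (x : ℂ)).im = 0) (k : ℤ) :
    starRingEnd ℂ (four F k) = four F (-k) := by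
  rw [four, four, intervalIntegral.integral_of_le zero_le_one,
    intervalIntegral.integral_of_le zero_le_one, ← integral_conj]
  refine MeasureTheory.integral_congr_ae (.of_forall fun t => ?_)
  simp only [map_mul, conj_ek, Complex.conj_eq_iff_im.2 (hFreal t)]

lemma four_zero (hFmean : (∫ t in (0:ℝ)..1, F t) = 0) : four F 0 = 0 := by
  rw [four, ← hFmean]; simp [ek]

end Fourier
section Evaluation
open scoped ENNReal

lemma isSeminorm_enorm : IsSeminorm (fun z : ℂ => ‖z‖ₑ) where
  add_le := enorm_add_le
  mul_le a b := (enorm_mul a b).le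
  const_le c := (ofReal_norm c).ge

/-- The value of a monomial. -/
def mono (θ ε : ℂ) (m : Fin 3 →₀ ℕ) : ℂ := ek (chg m) θ * ε ^ m 2

lemma ek_add_left (k l : ℤ) (x : ℂ) : ek (k + l) x = ek k x * ek l x := by
  rw [ek, ek, ek, ← Complex.exp_add]; congr 1; push_cast; ring

lemma mono_add (θ ε : ℂ) (m n : Fin 3 →₀ ℕ) : mono θ ε (m + n) = mono θ ε m * mono θ ε n := by
  rw [mono, mono, mono, chg_add, ek_add_left, Finsupp.add_apply, pow_add]; ring

/-- The function of `(θ, ε)` represented by a formal power series. -/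
def ev (θ ε : ℂ) (v : PS ℂ) : ℂ := ∑' m, MvPowerSeries.coeff m v * mono θ ε m

lemma norm_mono (θ : ℝ) (ε : ℂ) (m : Fin 3 →₀ ℕ) : ‖mono θ ε m‖ = ‖ε‖ ^ m 2 := by
  rw [mono, norm_mul, norm_ek, norm_pow]; simp

lemma tsum_enorm_mono (θ : ℝ) (ε : ℂ) (v : PS ℂ) :
    ∑' m, ‖MvPowerSeries.coeff m v * mono θ ε m‖ₑ = Tot (fun z : ℂ => ‖z‖ₑ) 0 ‖ε‖ v := by
  refine tsum_congr fun m => ?_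
  rw [enorm_mul, ← ofReal_norm (mono θ ε m), norm_mono, wt, zero_mul, Real.exp_zero,
    one_mul]

/-- Absolute convergence of a formal power series on the circle of radius `‖ε‖`. -/
def Conv (ε : ℂ) (v : PS ℂ) : Prop := Tot (fun z : ℂ => ‖z‖ₑ) 0 ‖ε‖ v ≠ ⊤

variable {ε : ℂ} {u v : PS ℂ}

lemma Conv.summable_norm (h : Conv ε v) (θ : ℝ) :
    Summable fun m => ‖MvPowerSeries.coeff m v * mono θ ε m‖ := by
  rw [← tsum_enorm_ne_top_iff_summable_norm, tsum_enorm_mono]; exact h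

lemma Conv.summable (h : Conv ε v) (θ : ℝ) :
    Summable fun m => MvPowerSeries.coeff m v * mono θ ε m := (h.summable_norm θ).of_norm

lemma enorm_ev_le (θ : ℝ) (ε : ℂ) (v : PS ℂ) :
    ‖ev θ ε v‖ₑ ≤ Tot (fun z : ℂ => ‖z‖ₑ) 0 ‖ε‖ v := by
  rw [← tsum_enorm_mono θ]; exact enorm_tsum_le_tsum_enorm

lemma ev_add (hu : Conv ε u) (hv : Conv ε v) (θ : ℝ) :
    ev θ ε (u + v) = ev θ ε u + ev θ ε v := by
  rw [ev, ev, ev, ← (hu.summable θ).tsum_add (hv.summable θ)]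
  exact tsum_congr fun m => by rw [map_add, add_mul]

lemma ev_neg (θ ε : ℂ) (u : PS ℂ) : ev θ ε (-u) = -ev θ ε u := by
  rw [ev, ev, ← tsum_neg]; exact tsum_congr fun m => by rw [map_neg, neg_mul]

lemma ev_sub (hu : Conv ε u) (hv : Conv ε v) (θ : ℝ) :
    ev θ ε (u - v) = ev θ ε u - ev θ ε v := by
  rw [ev, ev, ev, ← (hu.summable θ).tsum_sub (hv.summable θ)]
  exact tsum_congr fun m => by rw [map_sub, sub_mul]

lemma ev_monomial (θ ε : ℂ) (n : Fin 3 →₀ ℕ) (c : ℂ) :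
    ev θ ε (MvPowerSeries.monomial n c) = c * mono θ ε n := by
  classical
  rw [ev, tsum_eq_single n]
  · rw [MvPowerSeries.coeff_monomial_same]
  · intro m hm
    rw [MvPowerSeries.coeff_monomial, if_neg hm, zero_mul]

lemma ev_one (θ ε : ℂ) : ev θ ε 1 = 1 := by
  rw [← MvPowerSeries.monomial_zero_one, ev_monomial]; simp [mono, chg, ek]

lemma ev_eps (θ ε : ℂ) : ev θ ε eps = ε := by
  rw [eps, MvPowerSeries.X, ev_monomial]; simp [mono, chg, ek]

lemma ev_mul (hu : Conv ε u) (hv : Conv ε v) (θ : ℝ) :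
    ev θ ε (u * v) = ev θ ε u * ev θ ε v := by
  classical
  have h := summable_mul_of_summable_norm (hu.summable_norm θ) (hv.summable_norm θ)
  rw [ev, ev, ev, (hu.summable θ).tsum_mul_tsum_eq_tsum_sum_antidiagonal (hv.summable θ) h]
  refine tsum_congr fun m => ?_
  rw [MvPowerSeries.coeff_mul, Finset.sum_mul]
  refine Finset.sum_congr rfl fun p hp => ?_
  rw [← Finset.HasAntidiagonal.mem_antidiagonal.1 hp, mono_add]; ring

lemma Conv.add (hu : Conv ε u) (hv : Conv ε v) : Conv ε (u + v) := by
  have h := (hu.summable_norm 0).add (hv.summable_norm 0)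
  rw [Conv, ← tsum_enorm_mono 0, tsum_enorm_ne_top_iff_summable_norm]
  refine Summable.of_nonneg_of_le (fun _ => norm_nonneg _) (fun m => ?_) h
  rw [map_add, add_mul]; exact norm_add_le _ _

lemma Conv.neg (hu : Conv ε u) : Conv ε (-u) := by
  simpa [Conv, Tot] using hu

lemma ev_finset_sum {ι : Type*} (s : Finset ι) {f : ι → PS ℂ} (hf : ∀ i ∈ s, Conv ε (f i))
    (θ : ℝ) : Conv ε (∑ i ∈ s, f i) ∧ ev θ ε (∑ i ∈ s, f i) = ∑ i ∈ s, ev θ ε (f i) := by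
  classical
  induction s using Finset.induction_on with
  | empty => simp [Conv, Tot, ev]
  | insert i s hi ih =>
    have ih := ih fun j hj => hf j (Finset.mem_insert_of_mem hj)
    have h0 := hf i (Finset.mem_insert_self _ _)
    rw [Finset.sum_insert hi, Finset.sum_insert hi]
    exact ⟨h0.add ih.1, by rw [ev_add h0 ih.1, ih.2]⟩

lemma nm_le_tot {R : Type*} [CommRing R] {ν : R → ℝ≥0∞} (s ρ : ℝ) (J : ℕ) (u : PS R) :
    Nm ν s ρ J u ≤ Tot ν s ρ u :=
  ENNReal.tsum_le_tsum fun m => by split_ifs <;> simp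

lemma Conv.mul (hu : Conv ε u) (hv : Conv ε v) : Conv ε (u * v) := by
  refine ne_top_of_le_ne_top (ENNReal.mul_ne_top hu hv) (tot_le fun J => ?_)
  exact (Nm_mul_le isSeminorm_enorm (norm_nonneg _)).trans
    (mul_le_mul' (nm_le_tot _ _ _ _) (nm_le_tot _ _ _ _))

lemma conv_one (ε : ℂ) : Conv ε 1 :=
  ne_top_of_le_ne_top ENNReal.one_ne_top (tot_le fun _ => Nm_one_le isSeminorm_enorm)

lemma conv_eps (ε : ℂ) : Conv ε eps :=
  ne_top_of_le_ne_top ENNReal.ofReal_ne_top (tot_le fun _ => Nm_eps_le isSeminorm_enorm)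

lemma Conv.pow (hv : Conv ε v) (n : ℕ) : Conv ε (v ^ n) := by
  induction n with
  | zero => rw [pow_zero]; exact conv_one ε
  | succ n ih => rw [pow_succ]; exact ih.mul hv

lemma ev_pow (hv : Conv ε v) (θ : ℝ) (n : ℕ) : ev θ ε (v ^ n) = ev θ ε v ^ n := by
  induction n with
  | zero => rw [pow_zero, pow_zero, ev_one]
  | succ n ih => rw [pow_succ, pow_succ, ev_mul (hv.pow n) hv, ih]

lemma ev_fmul_ek {μ : ℤ → ℂ} {ω : ℂ} (hμ : ∀ k, μ k = ek k ω) (θ ε : ℂ) (v : PS ℂ) :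
    ev θ ε (fmul μ v) = ev (θ + ω) ε v := by
  refine tsum_congr fun m => ?_
  rw [coeff_fmul, mono, mono, ek_add, hμ]; ring

lemma ev_fser (g : ℤ → ℂ) (θ ε : ℂ) : ev θ ε (fser ℂ g) = ∑' k, g k * ek k θ := by
  rw [ev, ← expo_injective.tsum_eq]
  · refine tsum_congr fun k => ?_
    rw [coeff_fser, fcoeff_expo, mono, chg_expo, expo_two]; simp
  · intro m hm
    by_contra h
    exact hm (by simp [coeff_fser, fcoeff_of_notMem g h])

lemma tay_fser (g : ℤ → ℂ) (j : ℕ) :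
    tay (fser ℂ g) j = fser ℂ (fun k => (k : ℂ) ^ j / j.factorial * g k) := by
  ext m
  rw [tay, coeff_fmul, coeff_fser, coeff_fser]
  by_cases h : m ∈ Set.range expo
  · obtain ⟨k, rfl⟩ := h
    simp [fcoeff_expo, chg_expo]
  · simp [fcoeff_of_notMem _ h]

lemma conv_fser {g : ℤ → ℂ} (hg : Summable fun k => ‖g k‖) (ε : ℂ) : Conv ε (fser ℂ g) := by
  have h := tsum_fcoeff (g := g) (s := 0) (B := 0) (by simpa using hg)
  simp only [zero_mul, add_zero, Real.exp_zero, mul_one] at h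
  refine ne_top_of_le_ne_top (h ▸ ENNReal.ofReal_ne_top) (ENNReal.tsum_le_tsum fun m => ?_)
  rw [coeff_fser, Algebra.algebraMap_self_apply, ofReal_norm, wt, zero_mul, Real.exp_zero, one_mul]
  by_cases h : m 2 = 0
  · simp [h]
  · simp [fcoeff_of_ne g h]

end Evaluation
section Equation
open scoped ENNReal

variable {g : ℤ → ℂ} {B : ℝ}

lemma tendsto_sum_exp (hg : Summable fun k : ℤ => ‖g k‖ * Real.exp (B * |(k : ℝ)|)) (θ : ℝ)
    {V : ℂ} (hV : ‖V‖ ≤ B) :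
    Filter.Tendsto (fun J => ∑ j ∈ Finset.range J,
      (∑' k : ℤ, (k : ℂ) ^ j / j.factorial * g k * ek k θ) * V ^ j) Filter.atTop
      (nhds (∑' k : ℤ, g k * ek k θ * Complex.exp (k * V))) := by
  set a : ℤ × ℕ → ℂ := fun p => g p.1 * ek p.1 θ * ((p.1 * V) ^ p.2 / p.2.factorial) with ha
  have hexp (k : ℤ) : HasSum (fun j : ℕ => ((k : ℂ) * V) ^ j / j.factorial)
      (Complex.exp (k * V)) := by
    rw [Complex.exp_eq_exp_ℂ]; exact NormedSpace.expSeries_div_hasSum_exp _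
  have hnorm (k : ℤ) : HasSum (fun j : ℕ => ‖a (k, j)‖) (‖g k‖ * Real.exp (|(k : ℝ)| * ‖V‖)) := by
    have h : HasSum (fun j : ℕ => (|(k : ℝ)| * ‖V‖) ^ j / j.factorial)
        (Real.exp (|(k : ℝ)| * ‖V‖)) := by
      rw [Real.exp_eq_exp_ℝ]; exact NormedSpace.expSeries_div_hasSum_exp _
    refine (h.mul_left ‖g k‖).congr_fun ?_
    intro j
    simp [ha, norm_ek]
  have hs : Summable a := by
    refine Summable.of_norm ((summable_prod_of_nonneg fun _ => norm_nonneg _).2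
      ⟨fun k => (hnorm k).summable, ?_⟩)
    refine Summable.of_nonneg_of_le (fun k => tsum_nonneg fun _ => norm_nonneg _) (fun k => ?_) hg
    rw [(hnorm k).tsum_eq, mul_comm B]
    gcongr
  have h1 : ∑' p, a p = ∑' k : ℤ, g k * ek k θ * Complex.exp (k * V) := by
    rw [hs.tsum_prod]
    exact tsum_congr fun k => by simp only [ha]; rw [tsum_mul_left, (hexp k).tsum_eq]
  have hsw := hs.prod_symm
  have h2 : HasSum (fun j : ℕ => ∑' k : ℤ, a (k, j)) (∑' p, a p) := by
    have := hsw.hasSum.prod_fiberwise fun j => (hsw.prod_factor j).hasSum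
    rwa [show ∑' b : ℕ × ℤ, a b.swap = ∑' p, a p from (Equiv.prodComm ℕ ℤ).tsum_eq a] at this
  rw [← h1]
  refine h2.tendsto_sum_nat.congr fun J => Finset.sum_congr rfl fun j _ => ?_
  rw [← tsum_mul_right]
  refine tsum_congr fun k => ?_
  simp only [ha]; ring

variable {v : PS ℂ} {ε : ℂ}

lemma ev_comp (hB : 0 < B) (hg : Summable fun k : ℤ => ‖g k‖ * Real.exp (B * |(k : ℝ)|))
    (hv : Conv ε v) (θ : ℝ) (J : ℕ) :
    Conv ε (comp (fser ℂ g) J v) ∧ ev θ ε (comp (fser ℂ g) J v) = ∑ j ∈ Finset.range J,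
      (∑' k : ℤ, (k : ℂ) ^ j / j.factorial * g k * ek k θ) * ev θ ε v ^ j := by
  have ht (j : ℕ) : Conv ε (tay (fser ℂ g) j) := by
    rw [tay_fser]
    refine conv_fser ?_ ε
    refine Summable.of_nonneg_of_le (fun _ => norm_nonneg _) (fun k => ?_) (hg.mul_left (B ^ j)⁻¹)
    have h := Real.pow_div_factorial_le_exp (B * |(k : ℝ)|) (by positivity) j
    rw [mul_pow, mul_div_assoc, ← le_inv_mul_iff₀ (by positivity)] at h
    calc ‖(k : ℂ) ^ j / j.factorial * g k‖ = |(k : ℝ)| ^ j / j.factorial * ‖g k‖ := by simp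
      _ ≤ (B ^ j)⁻¹ * Real.exp (B * |(k : ℝ)|) * ‖g k‖ := by gcongr
      _ = _ := by ring
  have h := ev_finset_sum (Finset.range J) (f := fun j => tay (fser ℂ g) j * v ^ j)
    (fun j _ => (ht j).mul (hv.pow j)) θ
  refine ⟨h.1, h.2.trans (Finset.sum_congr rfl fun j _ => ?_)⟩
  rw [ev_mul (ht j) (hv.pow j), ev_pow hv, tay_fser, ev_fser]

variable {q : ℂˣ} {ω ρ : ℝ}

lemma bd_sh {β : ℝ} (hq : ∀ k : ℤ, ‖((q ^ k : ℂˣ) : ℂ)‖ = 1) {J : ℕ}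
    (hv : Bd (fun z : ℂ => ‖z‖ₑ) 0 ρ J v β) : Bd (fun z : ℂ => ‖z‖ₑ) 0 ρ J (sh q v) β := by
  have := Bd.fmul isSeminorm_enorm (μ := fun k => ((q ^ k : ℂˣ) : ℂ)) (K := 1) (δ := 0)
    (s := 0) zero_le_one (fun k => by rw [← ofReal_norm, hq]; simp) le_rfl
    (by rwa [add_zero])
  rwa [one_mul] at this

/-- A bounded formal solution of the difference equation sums to an actual solution. -/
theorem ev_equation (hB : 0 < B) (hg : Summable fun k : ℤ => ‖g k‖ * Real.exp (B * |(k : ℝ)|))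
    (hq : ∀ k : ℤ, ((q ^ k : ℂˣ) : ℂ) = ek k ω)
    (hv : Tot (fun z : ℂ => ‖z‖ₑ) 0 ρ v ≤ ENNReal.ofReal B) (hε : ‖ε‖ < ρ)
    (hlap : ∀ J, eps ^ J ∣ lap q v - eps * comp (fser ℂ g) J v) (θ : ℝ) :
    ev (θ + ω) ε v - 2 * ev θ ε v + ev (θ - ω) ε v =
      ε * ∑' k : ℤ, g k * ek k θ * Complex.exp (k * ev θ ε v) := by
  have hρ : 0 < ρ := (norm_nonneg ε).trans_lt hε
  have hνv (J : ℕ) : Bd (fun z : ℂ => ‖z‖ₑ) 0 ρ J v B := ⟨hB.le, (nm_le_tot _ _ _ _).trans hv⟩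
  have hmono {w : PS ℂ} : Tot (fun z : ℂ => ‖z‖ₑ) 0 ‖ε‖ w ≤ Tot (fun z : ℂ => ‖z‖ₑ) 0 ρ w :=
    tot_le fun J => (Nm_mono le_rfl (norm_nonneg _) hε.le).trans (nm_le_tot _ _ _ _)
  have hcv : Conv ε v := ne_top_of_le_ne_top ENNReal.ofReal_ne_top (hmono.trans hv)
  have hq1 (k : ℤ) : ‖((q ^ k : ℂˣ) : ℂ)‖ = 1 := by rw [hq, norm_ek]; simp
  have hq' (k : ℤ) : ((q⁻¹ ^ k : ℂˣ) : ℂ) = ek k (-ω) := by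
    rw [inv_zpow', hq, ek, ek]; congr 1; push_cast; ring
  have hq1' (k : ℤ) : ‖((q⁻¹ ^ k : ℂˣ) : ℂ)‖ = 1 := by
    rw [hq', ← ofReal_neg, norm_ek]; simp
  have conv_sh {p : ℂˣ} (hp : ∀ k : ℤ, ‖((p ^ k : ℂˣ) : ℂ)‖ = 1) : Conv ε (sh p v) :=
    ne_top_of_le_ne_top ENNReal.ofReal_ne_top
      (hmono.trans (tot_le fun J => (bd_sh hp (hνv J)).2))
  have hsub : sh q v - 2 * v = sh q v - (v + v) := by ring
  have hcl : Conv ε (lap q v) := by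
    rw [lap, hsub, sub_eq_add_neg]
    exact ((conv_sh hq1).add (hcv.add hcv).neg).add (conv_sh hq1')
  have hlhs : ev θ ε (lap q v) = ev (θ + ω) ε v - 2 * ev θ ε v + ev (θ - ω) ε v := by
    have h1 : Conv ε (sh q v - (v + v)) := by
      rw [sub_eq_add_neg]; exact (conv_sh hq1).add (hcv.add hcv).neg
    rw [lap, hsub, ev_add h1 (conv_sh hq1'), ev_sub (conv_sh hq1) (hcv.add hcv), ev_add hcv hcv,
      sh, sh, ev_fmul_ek hq, ev_fmul_ek hq', ← sub_eq_add_neg, two_mul]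
  set g₀ := ∑' k : ℤ, ‖g k‖ * Real.exp (B * |(k : ℝ)|) with hg₀
  have hg₀0 : 0 ≤ g₀ := tsum_nonneg fun k => by positivity
  have hcomp (J J' : ℕ) : Bd (fun z : ℂ => ‖z‖ₑ) 0 ρ J' (comp (fser ℂ g) J v) g₀ := by
    refine comp_bd isSeminorm_enorm hρ.le (coeff_fser _ g) (fun m hm => fcoeff_of_ne g hm) hB.le
      hg₀0 (le_refl 0) ?_ (hνv J') J
    rw [tsum_fcoeff (by simpa using hg), zero_add]
  set X := B + (B + B) + B + ρ * g₀ with hX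
  have hres (J : ℕ) : ‖ev θ ε (lap q v) - ε * ev θ ε (comp (fser ℂ g) J v)‖ ≤
      (‖ε‖ / ρ) ^ J * X := by
    have hc := (ev_comp hB hg hcv θ J).1
    have e : ev θ ε (lap q v) - ε * ev θ ε (comp (fser ℂ g) J v) =
        ev θ ε (lap q v - eps * comp (fser ℂ g) J v) := by
      rw [ev_sub hcl ((conv_eps ε).mul hc), ev_mul (conv_eps ε) hc, ev_eps]
    have hb (J' : ℕ) : Bd (fun z : ℂ => ‖z‖ₑ) 0 ρ J' (lap q v - eps * comp (fser ℂ g) J v) X := by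
      rw [lap, hsub, sub_eq_add_neg, sub_eq_add_neg]
      exact (((bd_sh hq1 (hνv J')).add isSeminorm_enorm
        (((hνv J').add isSeminorm_enorm (hνv J')).neg isSeminorm_enorm)).add isSeminorm_enorm
        (bd_sh hq1' (hνv J'))).add isSeminorm_enorm
        (((Bd.eps isSeminorm_enorm hρ.le).mul isSeminorm_enorm hρ.le (hcomp J J')).neg
          isSeminorm_enorm)
    have h0 : 0 ≤ (‖ε‖ / ρ) ^ J * X := by positivity
    rw [e, ← ENNReal.ofReal_le_ofReal_iff h0, ofReal_norm]
    refine (enorm_ev_le θ ε _).trans (tot_le fun J' => ?_)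
    refine (Nm_shrink (by simp) (norm_nonneg _) hρ hε.le (hlap J)).trans ?_
    rw [ENNReal.ofReal_mul (by positivity)]
    exact mul_le_mul' le_rfl (hb J').2
  have hV : ‖ev θ ε v‖ ≤ B := by
    rw [← ENNReal.ofReal_le_ofReal_iff hB.le, ofReal_norm]
    exact (enorm_ev_le θ ε v).trans (hmono.trans hv)
  have hlim := (tendsto_sum_exp hg θ hV).const_mul ε
  have hzero : Filter.Tendsto (fun J => (‖ε‖ / ρ) ^ J * X) Filter.atTop (nhds 0) := by
    simpa using (tendsto_pow_atTop_nhds_zero_of_lt_one (by positivity)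
      ((div_lt_one hρ).2 hε)).mul_const X
  have hlim2 := squeeze_zero_norm hres hzero
  rw [← hlhs]
  have hlim3 : Filter.Tendsto (fun J => ε * ev θ ε (comp (fser ℂ g) J v)) Filter.atTop
      (nhds (ev θ ε (lap q v))) := by
    simpa using (tendsto_const_nhds (x := ev θ ε (lap q v))).sub hlim2
  refine tendsto_nhds_unique hlim3 (hlim.congr fun J => ?_)
  rw [(ev_comp hB hg hcv θ J).2]

end Equation
section Reality
open scoped ComplexConjugate

/-- Exchanging the variables `e^{2πiθ}` and `e^{-2πiθ}`. -/
def flip : (Fin 3 →₀ ℕ) ≃+ (Fin 3 →₀ ℕ) := Finsupp.domCongr (Equiv.swap 0 1)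

@[simp] lemma flip_apply_zero (m : Fin 3 →₀ ℕ) : flip m 0 = m 1 := by simp [flip]
@[simp] lemma flip_apply_one (m : Fin 3 →₀ ℕ) : flip m 1 = m 0 := by simp [flip]
@[simp] lemma flip_apply_two (m : Fin 3 →₀ ℕ) : flip m 2 = m 2 := by
  simp only [flip, Finsupp.domCongr_apply, Finsupp.equivMapDomain_apply, Equiv.symm_swap]
  rw [Equiv.swap_apply_of_ne_of_ne (by decide) (by decide)]

@[simp] lemma chg_flip (m : Fin 3 →₀ ℕ) : chg (flip m) = -chg m := by simp [chg]

@[simp] lemma flip_flip (m : Fin 3 →₀ ℕ) : flip (flip m) = m := by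
  ext i; fin_cases i <;> simp

lemma flip_expo (k : ℤ) : flip (expo k) = expo (-k) := by
  ext i; fin_cases i <;> simp

/-- The series of the complex conjugate function on the real domain. -/
def cj (u : PS ℂ) : PS ℂ := fun m => conj (MvPowerSeries.coeff (flip m) u)

lemma coeff_cj (u : PS ℂ) (m : Fin 3 →₀ ℕ) :
    MvPowerSeries.coeff m (cj u) = conj (MvPowerSeries.coeff (flip m) u) := rfl

lemma cj_sub (u v : PS ℂ) : cj (u - v) = cj u - cj v := by
  ext m; simp [coeff_cj]

lemma cj_sum {ι : Type*} (s : Finset ι) (f : ι → PS ℂ) :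
    cj (∑ i ∈ s, f i) = ∑ i ∈ s, cj (f i) := by
  ext m; simp [coeff_cj]

lemma cj_mul (u v : PS ℂ) : cj (u * v) = cj u * cj v := by
  classical
  ext m
  rw [coeff_cj, MvPowerSeries.coeff_mul, MvPowerSeries.coeff_mul, map_sum]
  refine Finset.sum_nbij' (fun p => (flip p.1, flip p.2)) (fun p => (flip p.1, flip p.2))
    ?_ ?_ ?_ ?_ ?_
  · intro p hp
    rw [Finset.HasAntidiagonal.mem_antidiagonal] at hp ⊢
    rw [← map_add, hp, flip_flip]
  · intro p hp
    rw [Finset.HasAntidiagonal.mem_antidiagonal] at hp ⊢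
    rw [← map_add, hp]
  · intro p _; simp
  · intro p _; simp
  · intro p _; simp [coeff_cj]

lemma cj_one : cj 1 = 1 := by
  classical
  ext m
  rw [coeff_cj, MvPowerSeries.coeff_one, MvPowerSeries.coeff_one]
  have : flip m = 0 ↔ m = 0 := by simp
  simp only [this]; split_ifs <;> simp

lemma cj_pow (u : PS ℂ) (n : ℕ) : cj (u ^ n) = cj u ^ n := by
  induction n with
  | zero => rw [pow_zero, pow_zero, cj_one]
  | succ n ih => rw [pow_succ, pow_succ, cj_mul, ih]

lemma cj_eps : cj eps = eps := by
  classical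
  ext m
  rw [coeff_cj, eps, MvPowerSeries.coeff_X, MvPowerSeries.coeff_X]
  have h : flip (Finsupp.single 2 1) = Finsupp.single 2 1 := by
    ext i; fin_cases i <;> simp
  have : flip m = Finsupp.single 2 1 ↔ m = Finsupp.single 2 1 := by
    rw [← flip.injective.eq_iff, flip_flip, h]
  simp only [this]; split_ifs <;> simp

lemma cj_fmul (b : ℤ → ℂ) (u : PS ℂ) : cj (fmul b u) = fmul (fun k => conj (b (-k))) (cj u) := by
  ext m; simp [coeff_cj]

lemma cj_fser (g : ℤ → ℂ) : cj (fser ℂ g) = fser ℂ (fun k => conj (g (-k))) := by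
  ext m
  rw [coeff_cj, coeff_fser, coeff_fser, Algebra.algebraMap_self_apply,
    Algebra.algebraMap_self_apply]
  by_cases h : m ∈ Set.range expo
  · obtain ⟨k, rfl⟩ := h
    rw [flip_expo, fcoeff_expo, fcoeff_expo]
  · rw [fcoeff_of_notMem _ h, fcoeff_of_notMem, map_zero]
    rintro ⟨k, hk⟩
    exact h ⟨-k, by rw [← flip_expo, hk, flip_flip]⟩

variable {b g : ℤ → ℂ} {v : PS ℂ}

lemma IsSol.neg_cj (hb : ∀ k, conj (b k) = b (-k)) (hg : ∀ k, conj (g k) = -g (-k))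
    (hv : IsSol b (fser ℂ g) v) : IsSol b (fser ℂ g) (-cj v) := by
  intro J
  have hcomp : cj (comp (fser ℂ g) J v) = -comp (fser ℂ g) J (-cj v) := by
    rw [comp, comp, cj_sum, ← Finset.sum_neg_distrib]
    refine Finset.sum_congr rfl fun j _ => ?_
    have ht : cj (tay (fser ℂ g) j) = -((-1) ^ j * tay (fser ℂ g) j) := by
      rw [tay_fser, cj_fser]
      ext m
      have e : ((-1 : PS ℂ) ^ j) = MvPowerSeries.C ((-1 : ℂ) ^ j) := by simp
      rw [e, map_neg, MvPowerSeries.coeff_C_mul, coeff_fser, coeff_fser,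
        Algebra.algebraMap_self_apply, Algebra.algebraMap_self_apply]
      by_cases h : m ∈ Set.range expo
      · obtain ⟨k, rfl⟩ := h
        rw [fcoeff_expo, fcoeff_expo, map_mul, hg, neg_neg]
        simp only [Int.cast_neg, neg_pow (k : ℂ) j, map_div₀, map_mul, map_pow, map_neg, map_one,
          map_intCast, map_natCast]
        ring
      · rw [fcoeff_of_notMem _ h, fcoeff_of_notMem _ h]; simp
    rw [cj_mul, cj_pow, ht, neg_pow (cj v) j]
    ring
  have hdvd {n : ℕ} {w : PS ℂ} (h : eps ^ n ∣ w) : eps ^ n ∣ cj w := by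
    obtain ⟨x, rfl⟩ := h
    exact ⟨cj x, by rw [cj_mul, cj_pow, cj_eps]⟩
  have h := (hdvd (hv J)).neg_right
  rw [cj_sub, cj_fmul, cj_mul, cj_eps, hcomp] at h
  have hb' : (fun k => conj (b (-k))) = b := by funext k; rw [hb, neg_neg]
  rw [hb', mul_neg, map_neg] at h
  convert h using 1
  ring

lemma conj_ev (hv : cj v = -v) (θ ε : ℝ) : conj (ev θ ε v) = -ev θ ε v := by
  rw [← ev_neg, ← hv, ev, ev, Complex.conj_tsum]
  rw [← flip.toEquiv.tsum_eq]
  refine tsum_congr fun m => ?_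
  simp only [AddEquiv.toEquiv_eq_coe, EquivLike.coe_coe, map_mul, coeff_cj, mono, conj_ek,
    chg_flip, neg_neg, map_pow, Complex.conj_ofReal, flip_apply_two]

end Reality
section Regularity
open scoped ENNReal

variable {v : PS ℂ} {ε : ℂ}

lemma integral_ek {k : ℤ} (hk : k ≠ 0) : ∫ t in (0:ℝ)..1, ek k t = 0 := by
  have hc : 2 * Real.pi * I * (k : ℂ) ≠ 0 := by
    simp [Complex.I_ne_zero, Real.pi_ne_zero, hk]
  unfold ek
  rw [integral_exp_mul_complex hc]
  have := ek_int k 1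
  rw [ek] at this
  simp_all

lemma integral_ev (hmean : mean v = 0) (hv : Conv ε v) : ∫ t in (0:ℝ)..1, ev t ε v = 0 := by
  have hcont (m : Fin 3 →₀ ℕ) :
      Continuous fun t : ℝ => MvPowerSeries.coeff m v * mono t ε m := by
    unfold mono
    exact continuous_const.mul
      (((continuous_ek _).comp Complex.continuous_ofReal).mul continuous_const)
  have h := intervalIntegral.hasSum_integral_of_dominated_convergence (a := 0) (b := 1)
    (μ := MeasureTheory.volume) (F := fun m (t : ℝ) => MvPowerSeries.coeff m v * mono t ε m)
    (f := fun t : ℝ => ev t ε v)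
    (fun m _ => ‖MvPowerSeries.coeff m v * mono (0 : ℝ) ε m‖)
    (fun m => (hcont m).aestronglyMeasurable)
    (fun m => Filter.Eventually.of_forall fun t _ => by simp only [norm_mul, norm_mono, le_refl])
    (Filter.Eventually.of_forall fun t _ => hv.summable_norm 0) (by simp)
    (Filter.Eventually.of_forall fun t _ => (hv.summable t).hasSum)
  refine h.unique ?_
  convert hasSum_zero using 2 with m
  rw [intervalIntegral.integral_const_mul]
  simp only [mono]
  rw [intervalIntegral.integral_mul_const]
  by_cases hm : chg m = 0
  · have := congrArg (MvPowerSeries.coeff m) hmean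
    rw [mean, coeff_fmul, if_pos hm, one_mul, map_zero] at this
    rw [this, zero_mul]
  · rw [integral_ek hm, zero_mul, mul_zero]

lemma norm_ek_sub_le (k : ℤ) (x y : ℝ) :
    ‖ek k x - ek k y‖ ≤ 2 * Real.pi * (|(k : ℝ)| * |x - y|) := by
  have e : ek k x - ek k y = ek k y * (Complex.exp (I * (2 * Real.pi * k * (x - y) : ℝ)) - 1) := by
    have : Complex.exp (I * (2 * Real.pi * k * (x - y) : ℝ)) = ek k (x - y) := by
      rw [ek]; congr 1; push_cast; ring
    rw [mul_sub, this, ← ek_add]; simp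
  rw [e, norm_mul, norm_ek]
  have := Real.norm_exp_I_mul_ofReal_sub_one_le (x := 2 * Real.pi * k * (x - y))
  refine (mul_le_mul_of_nonneg_left this (by positivity)).trans (le_of_eq ?_)
  simp [abs_of_pos Real.pi_pos]; ring

lemma norm_ev_sub_le {β : ℝ} (hβ : 0 ≤ β) (hv : Conv ε v)
    (hd : Tot (fun z : ℂ => ‖z‖ₑ) 0 ‖ε‖ (dD v) ≤ ENNReal.ofReal β) (x y : ℝ) :
    ‖ev x ε v - ev y ε v‖ ≤ 2 * Real.pi * |x - y| * β := by
  have hc : Conv ε (dD v) := ne_top_of_le_ne_top ENNReal.ofReal_ne_top hd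
  have h0 : ∑' m, ‖MvPowerSeries.coeff m (dD v) * mono (0:ℝ) ε m‖ ≤ β := by
    rw [← ENNReal.ofReal_le_ofReal_iff hβ,
      ENNReal.ofReal_tsum_of_nonneg (fun _ => norm_nonneg _) (hc.summable_norm 0)]
    simp only [ofReal_norm]
    rw [tsum_enorm_mono]; exact hd
  rw [ev, ev, ← (hv.summable x).tsum_sub (hv.summable y)]
  refine (tsum_of_norm_bounded ((hc.summable_norm 0).hasSum.mul_left (2 * Real.pi * |x - y|))
    fun m => ?_).trans (by gcongr)
  rw [← mul_sub, mono, mono, ← sub_mul, norm_mul, norm_mul, norm_mul, norm_mono, dD, coeff_fmul,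
    norm_mul, norm_pow]
  refine (mul_le_mul_of_nonneg_left (mul_le_mul_of_nonneg_right (norm_ek_sub_le _ x y)
    (by positivity)) (norm_nonneg _)).trans (le_of_eq ?_)
  simp; ring

end Regularity
section Superposition

variable {ι α : Type*} {S : Set α} {μ : ι → α → ℂ} {C W : ι → ℝ}

lemma summable_super {X : Type*} {T : Set X} {F : X → ι → ℂ} {A : ι → ℝ}
    (hF : ∀ x ∈ T, ∀ i, ‖F x i‖ ≤ A i) (hμ : ∀ i, ∀ a ∈ S, ‖μ i a‖ ≤ W i)
    (hA : Summable fun i => A i * W i) {x : X} (hx : x ∈ T) {a : α} (ha : a ∈ S) :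
    Summable (fun i => F x i * μ i a) ∧ ‖∑' i, F x i * μ i a‖ ≤ ∑' i, A i * W i := by
  have h (i : ι) : ‖F x i * μ i a‖ ≤ A i * W i := by
    rw [norm_mul]
    exact mul_le_mul (hF x hx i) (hμ i a ha) (norm_nonneg _) ((norm_nonneg _).trans (hF x hx i))
  exact ⟨Summable.of_norm_bounded hA h, tsum_of_norm_bounded hA.hasSum h⟩

lemma contSup_super {X : Type*} [PseudoMetricSpace X] {T : Set X} {F : X → ι → ℂ} {A : ι → ℝ}
    (hc : ∀ i, ContinuousOn (fun x => F x i) T)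
    (hF : ∀ x ∈ T, ∀ i, ‖F x i‖ ≤ A i) (hμ : ∀ i, ∀ a ∈ S, ‖μ i a‖ ≤ W i) (hW : ∀ i, 0 ≤ W i)
    (hA : Summable fun i => A i * W i) :
    ∀ x ∈ T, ∀ ε > (0 : ℝ), ∃ δ > (0 : ℝ), ∀ x' ∈ T, dist x' x < δ → ∀ a ∈ S,
      ‖∑' i, F x' i * μ i a - ∑' i, F x i * μ i a‖ ≤ ε := by
  intro x hx ε hε
  have hb (i : ι) (y : X) (hy : y ∈ T) : ‖F y i - F x i‖ * W i ≤ 2 * (A i * W i) := by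
    have := (norm_sub_le (F y i) (F x i)).trans (add_le_add (hF y hy i) (hF x hx i))
    nlinarith [hW i]
  have hcont : ContinuousOn (fun y => ∑' i, ‖F y i - F x i‖ * W i) T :=
    continuousOn_tsum (fun i => (((hc i).sub continuousOn_const).norm).mul continuousOn_const)
      (hA.mul_left 2) fun i y hy => by
        rw [Real.norm_of_nonneg (mul_nonneg (norm_nonneg _) (hW i))]; exact hb i y hy
  obtain ⟨δ, hδ, h⟩ := Metric.continuousOn_iff.1 hcont x hx ε hε
  refine ⟨δ, hδ, fun y hy hyx a ha => ?_⟩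
  have h1 := h y hy hyx
  have hnn : 0 ≤ ∑' i, ‖F y i - F x i‖ * W i :=
    tsum_nonneg fun i => mul_nonneg (norm_nonneg _) (hW i)
  simp only [sub_self, norm_zero, zero_mul, tsum_zero, Real.dist_eq, sub_zero,
    abs_of_nonneg hnn] at h1
  have hs : Summable fun i => ‖F y i - F x i‖ * W i :=
    Summable.of_nonneg_of_le (fun i => mul_nonneg (norm_nonneg _) (hW i)) (fun i => hb i y hy)
      (hA.mul_left 2)
  rw [← (summable_super hF hμ hA hy ha).1.tsum_sub (summable_super hF hμ hA hx ha).1]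
  refine (tsum_of_norm_bounded hs.hasSum fun i => ?_).trans h1.le
  rw [← sub_mul, norm_mul]
  exact mul_le_mul_of_nonneg_left (hμ i a ha) (norm_nonneg _)

variable {K : Set ℂ} {f : ι → ℂ → ℂ} {D : ι → ℂ × ℂ → ℂ}

lemma fpair_super (hq : ∀ i, Quot K (f i) (D i) (C i)) (hf : ∀ i, ∀ q ∈ K, ‖f i q‖ ≤ C i)
    (hμ : ∀ i, ∀ a ∈ S, ‖μ i a‖ ≤ W i) (hW : ∀ i, 0 ≤ W i) (hC : Summable fun i => C i * W i) :
    FPair K S (fun q a => ∑' i, f i q * μ i a) (fun q a => ∑' i, D i (q, q) * μ i a) ∧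
      FBdd K S (fun q a => ∑' i, f i q * μ i a) (fun q a => ∑' i, D i (q, q) * μ i a) := by
  have hdiag (i : ι) : ∀ q ∈ K, ‖D i (q, q)‖ ≤ C i := fun q h => (hq i).bound _ ⟨h, h⟩
  have hC2 : Summable fun i => (2 * C i) * W i := by simpa only [mul_assoc] using hC.mul_left 2
  have hom_bd : ∀ p ∈ K ×ˢ K, ∀ i, ‖D i p - D i (p.1, p.1)‖ ≤ 2 * C i := fun p hp i => by
    have := (norm_sub_le (D i p) (D i (p.1, p.1))).trans
      (add_le_add ((hq i).bound p hp) (hdiag i _ hp.1))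
    linarith
  have hom {p : ℂ × ℂ} (hp : p ∈ K ×ˢ K) {a : α} (ha : a ∈ S) :
      omegaF (fun q a => ∑' i, f i q * μ i a) (fun q a => ∑' i, D i (q, q) * μ i a) p a =
        ∑' i, (D i p - D i (p.1, p.1)) * μ i a := by
    rw [omegaF]
    split_ifs with h
    · have : p = (p.1, p.1) := Prod.ext rfl h.symm
      have h0 (i : ι) : D i p - D i (p.1, p.1) = 0 := by rw [← this, sub_self]
      simp [h0]
    · have hne : p.2 - p.1 ≠ 0 := sub_ne_zero.2 (Ne.symm h)
      have s1 := (summable_super (T := K) (F := fun q i => f i q) (fun q h i => hf i q h)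
        hμ hC hp.1 ha).1
      have s2 := (summable_super (T := K) (F := fun q i => f i q) (fun q h i => hf i q h)
        hμ hC hp.2 ha).1
      have s3 := (summable_super (T := K) (F := fun q i => D i (q, q)) (fun q h i => hdiag i q h)
        hμ hC hp.1 ha).1
      rw [← s2.tsum_sub s1, smul_eq_mul, ← tsum_mul_left, ← ((s2.sub s1).mul_left _).tsum_sub s3]
      refine tsum_congr fun i => ?_
      rw [← sub_mul, (hq i).eq p hp]
      field_simp
  refine ⟨⟨contSup_super (F := fun q i => f i q) (fun i => (hq i).continuousOn)
      (fun q h i => hf i q h) hμ hW hC,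
    contSup_super (F := fun q i => D i (q, q)) (fun i => ?_) (fun q h i => hdiag i q h) hμ hW hC,
    fun p hp ε hε => ?_⟩, ⟨∑' i, C i * W i, ?_⟩, ⟨∑' i, C i * W i, ?_⟩,
    ⟨∑' i, (2 * C i) * W i, ?_⟩⟩
  · exact (hq i).cont.comp (f := fun q => (q, q)) (by fun_prop) fun q h => ⟨h, h⟩
  · obtain ⟨δ, hδ, h⟩ := contSup_super (T := K ×ˢ K) (F := fun p i => D i p - D i (p.1, p.1))
      (fun i => (hq i).cont.sub ((hq i).cont.comp (f := fun p : ℂ × ℂ => (p.1, p.1)) (by fun_prop)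
        fun p h => ⟨h.1, h.1⟩)) hom_bd hμ hW hC2 p hp ε hε
    exact ⟨δ, hδ, fun p' hp' hd a ha => by rw [hom hp ha, hom hp' ha]; exact h p' hp' hd a ha⟩
  · rintro _ ⟨q, hqK, a, ha, rfl⟩
    exact (summable_super (T := K) (F := fun q i => f i q) (fun q h i => hf i q h)
      hμ hC hqK ha).2
  · rintro _ ⟨q, hqK, a, ha, rfl⟩
    exact (summable_super (T := K) (F := fun q i => D i (q, q)) (fun q h i => hdiag i q h)
      hμ hC hqK ha).2
  · rintro _ ⟨p, hp, a, ha, rfl⟩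
    rw [hom hp ha]
    exact (summable_super (T := K ×ˢ K) (F := fun p i => D i p - D i (p.1, p.1)) hom_bd
      hμ hC2 hp ha).2

end Superposition
section Parametrized
open scoped ENNReal

variable {R s ρ : ℝ}

lemma abs_two_pi_chg_le (m : Fin 3 →₀ ℕ) {y : ℝ} (hy : |y| ≤ R) :
    -(2 * Real.pi * chg m * y) ≤ 2 * Real.pi * R * (m 0 + m 1) := by
  have h1 := abs_chg_le m
  have h2 : |(chg m : ℝ) * y| ≤ (m 0 + m 1) * R := by
    rw [abs_mul]; exact mul_le_mul h1 hy (abs_nonneg _) (by positivity)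
  have h3 := (abs_le.1 h2).1
  nlinarith [Real.pi_pos]

lemma norm_mono_le {a : ℂ × ℂ} (ha : a ∈ SD R ρ) (m : Fin 3 →₀ ℕ) :
    ‖mono a.1 a.2 m‖ ≤ Real.exp (2 * Real.pi * R * (m 0 + m 1)) * ρ ^ m 2 := by
  rw [mono, norm_mul, norm_ek, norm_pow]
  have h2 : ‖a.2‖ ≤ ρ := by simpa using (mem_ball.1 ha.2).le
  gcongr
  exact abs_two_pi_chg_le m (le_of_lt ha.1)

/-- The derivative of a monomial. -/
def monoD (a : ℂ × ℂ) (m : Fin 3 →₀ ℕ) : ℂ × ℂ →L[ℂ] ℂ :=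
  (a.2 ^ m 2 * (ek (chg m) a.1 * (2 * Real.pi * I * chg m))) • ContinuousLinearMap.fst ℂ ℂ ℂ +
    (ek (chg m) a.1 * (m 2 * a.2 ^ (m 2 - 1))) • ContinuousLinearMap.snd ℂ ℂ ℂ

lemma hasFDerivAt_mono (a : ℂ × ℂ) (m : Fin 3 →₀ ℕ) :
    HasFDerivAt (fun b : ℂ × ℂ => mono b.1 b.2 m) (monoD a m) a := by
  have h1 : HasDerivAt (ek (chg m)) (ek (chg m) a.1 * (2 * Real.pi * I * chg m)) a.1 := by
    have := ((hasDerivAt_id a.1).const_mul (2 * Real.pi * I * chg m)).cexp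
    unfold ek
    simpa using this
  have h2 := (hasDerivAt_pow (m 2) a.2).comp_hasFDerivAt a
    (ContinuousLinearMap.snd ℂ ℂ ℂ).hasFDerivAt
  have h := (h1.comp_hasFDerivAt a (ContinuousLinearMap.fst ℂ ℂ ℂ).hasFDerivAt).mul h2
  refine h.congr_fderiv ?_
  ext <;> simp [monoD]

lemma norm_monoD_le (hρ : 0 < ρ) (hs : 2 * Real.pi * R < s) {a : ℂ × ℂ}
    (ha : a ∈ SD R ρ) (m : Fin 3 →₀ ℕ) :
    ‖monoD a m‖ ≤ (2 * Real.pi / (s - 2 * Real.pi * R) + 1 / ρ) *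
      (Real.exp (s * (m 0 + m 1)) * (2 * ρ) ^ m 2) := by
  set δ := s - 2 * Real.pi * R with hδ
  have hδ0 : 0 < δ := sub_pos.2 hs
  set N : ℝ := m 0 + m 1 with hN
  have hN0 : 0 ≤ N := by positivity
  have hek : ‖ek (chg m) a.1‖ ≤ Real.exp (2 * Real.pi * R * N) := by
    rw [norm_ek]; exact Real.exp_le_exp.2 (abs_two_pi_chg_le m (le_of_lt ha.1))
  have hε : ‖a.2‖ ≤ ρ := by simpa using (mem_ball.1 ha.2).le
  have hexp : Real.exp (s * N) = Real.exp (2 * Real.pi * R * N) * Real.exp (δ * N) := by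
    rw [← Real.exp_add]; congr 1; rw [hδ]; ring
  have hNexp : N ≤ Real.exp (δ * N) / δ := by
    rw [le_div_iff₀ hδ0]; linarith [Real.add_one_le_exp (δ * N)]
  have hexp1 : Real.exp (2 * Real.pi * R * N) ≤ Real.exp (s * N) :=
    Real.exp_le_exp.2 (by gcongr)
  have hpow : ρ ^ m 2 ≤ (2 * ρ) ^ m 2 := by gcongr; linarith
  have hpow2 : (m 2 : ℝ) * ρ ^ (m 2 - 1) ≤ (2 * ρ) ^ m 2 / ρ := by
    rw [le_div_iff₀ hρ]
    rcases Nat.eq_zero_or_pos (m 2) with h | h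
    · simp [h]
    · have : ρ ^ (m 2 - 1) * ρ = ρ ^ m 2 := by rw [← pow_succ]; congr 1; omega
      rw [mul_assoc, this, mul_pow]
      gcongr
      exact_mod_cast (Nat.lt_two_pow_self).le
  have h1 : ‖(a.2 ^ m 2 * (ek (chg m) a.1 * (2 * Real.pi * I * chg m))) •
      ContinuousLinearMap.fst ℂ ℂ ℂ‖ ≤
      2 * Real.pi / δ * (Real.exp (s * N) * (2 * ρ) ^ m 2) := by
    rw [norm_smul, norm_mul, norm_mul, norm_pow]
    have e : ‖(2 * Real.pi * I * chg m : ℂ)‖ = 2 * Real.pi * |(chg m : ℝ)| := by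
      simp [abs_of_pos Real.pi_pos]
    rw [e]
    calc ‖a.2‖ ^ m 2 * (‖ek (chg m) a.1‖ * (2 * Real.pi * |(chg m : ℝ)|)) *
          ‖ContinuousLinearMap.fst ℂ ℂ ℂ‖
        ≤ (2 * ρ) ^ m 2 * (Real.exp (2 * Real.pi * R * N) *
          (2 * Real.pi * (Real.exp (δ * N) / δ))) * 1 := by
          gcongr
          · linarith
          · exact (abs_chg_le m).trans hNexp
          · exact ContinuousLinearMap.norm_fst_le ..
      _ = _ := by rw [hexp]; ring
  have h2 : ‖(ek (chg m) a.1 * (m 2 * a.2 ^ (m 2 - 1))) • ContinuousLinearMap.snd ℂ ℂ ℂ‖ ≤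
      1 / ρ * (Real.exp (s * N) * (2 * ρ) ^ m 2) := by
    rw [norm_smul, norm_mul, norm_mul, norm_pow, Complex.norm_natCast]
    calc ‖ek (chg m) a.1‖ * (m 2 * ‖a.2‖ ^ (m 2 - 1)) * ‖ContinuousLinearMap.snd ℂ ℂ ℂ‖
        ≤ Real.exp (s * N) * ((2 * ρ) ^ m 2 / ρ) * 1 := by
          gcongr
          · exact hek.trans hexp1
          · exact (mul_le_mul_of_nonneg_left (pow_le_pow_left₀ (norm_nonneg _) hε _)
              (Nat.cast_nonneg _)).trans hpow2
          · exact ContinuousLinearMap.norm_snd_le ..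
      _ = _ := by ring
  rw [add_mul]
  exact (norm_add_le _ _).trans (add_le_add h1 h2)

lemma isOpen_SD (R ρ : ℝ) : IsOpen (SD R ρ) := (isOpen_Strip R).prod isOpen_ball

lemma convex_SD (R ρ : ℝ) : Convex ℝ (SD R ρ) := by
  refine Convex.prod ?_ (convex_ball 0 ρ)
  have : Strip R = Complex.imLm ⁻¹' Set.Ioo (-R) R := by ext z; simp [Strip, abs_lt]
  rw [this]
  exact (convex_Ioo _ _).linear_preimage _

lemma differentiableOn_super (hρ : 0 < ρ) (hs : 2 * Real.pi * R < s)
    {c : (Fin 3 →₀ ℕ) → ℂ} {C : (Fin 3 →₀ ℕ) → ℝ} (hc : ∀ m, ‖c m‖ ≤ C m)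
    (hC : Summable fun m => C m * (Real.exp (s * (m 0 + m 1)) * (2 * ρ) ^ m 2)) :
    DifferentiableOn ℂ (fun a : ℂ × ℂ => ∑' m, c m * mono a.1 a.2 m) (SD R ρ) := by
  intro a ha
  have hb : ∀ m, ∀ b ∈ SD R ρ, ‖c m • monoD b m‖ ≤
      (2 * Real.pi / (s - 2 * Real.pi * R) + 1 / ρ) *
        (C m * (Real.exp (s * (m 0 + m 1)) * (2 * ρ) ^ m 2)) := fun m b hb => by
    rw [norm_smul]
    refine (mul_le_mul (hc m) (norm_monoD_le hρ hs hb m) (norm_nonneg _)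
      ((norm_nonneg _).trans (hc m))).trans (le_of_eq ?_)
    ring
  have h0 : Summable fun m => c m * mono a.1 a.2 m := by
    refine Summable.of_norm_bounded hC fun m => ?_
    rw [norm_mul]
    refine mul_le_mul (hc m) ((norm_mono_le ha m).trans ?_) (norm_nonneg _)
      ((norm_nonneg _).trans (hc m))
    gcongr
    linarith
  exact (hasFDerivAt_tsum_of_isPreconnected (hC.mul_left _) (isOpen_SD R ρ)
    (convex_SD R ρ).isPreconnected (fun m b _ => (hasFDerivAt_mono b m).const_mul (c m)) hb ha h0
    ha).differentiableAt.differentiableWithinAt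

end Parametrized
section Parametrized
open scoped ENNReal

variable {K : Set (OnePoint ℂ)} {R s ρ : ℝ}

/-- Evaluation of the coefficients at a point of `K`. -/
def atPt (x : Pts K) : PS (Pts K → ℂ) →+* PS ℂ :=
  MvPowerSeries.map (Pi.evalRingHom (fun _ => ℂ) x)

lemma coeff_atPt (x : Pts K) (v : PS (Pts K → ℂ)) (m : Fin 3 →₀ ℕ) :
    MvPowerSeries.coeff m (atPt x v) = MvPowerSeries.coeff m v x := by
  rw [atPt, MvPowerSeries.coeff_map]; rfl

lemma exists_lift_family {v : PS (Pts K → ℂ)} (hρ : 0 < ρ) (hv : Tot (nu K) s ρ v ≠ ⊤) :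
    ∃ C : (Fin 3 →₀ ℕ) → ℝ, (∀ m, HasLift (MvPowerSeries.coeff m v) (C m)) ∧
      Summable fun m => C m * (Real.exp (s * (m 0 + m 1)) * ρ ^ m 2) := by
  have hwt (m : Fin 3 →₀ ℕ) : wt s ρ m ≠ 0 := by
    rw [wt, Ne, ENNReal.ofReal_eq_zero, not_le]; positivity
  have hex (m : Fin 3 →₀ ℕ) : ∃ C, HasLift (MvPowerSeries.coeff m v) C ∧
      ENNReal.ofReal C ≤ 2 * nu K (MvPowerSeries.coeff m v) := by
    by_cases h0 : nu K (MvPowerSeries.coeff m v) = 0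
    · refine ⟨0, ?_, by simp⟩
      rw [eq_zero_of_nu h0]
      have h := HasLift.const (K := K) 0
      rw [norm_zero] at h
      exact h
    · have htop : nu K (MvPowerSeries.coeff m v) ≠ ⊤ := fun h =>
        ENNReal.ne_top_of_tsum_ne_top hv m (by rw [h, ENNReal.top_mul (hwt m)])
      obtain ⟨C, hC, hlt⟩ := exists_hasLift_of_lt
        (show nu K (MvPowerSeries.coeff m v) < 2 * nu K (MvPowerSeries.coeff m v) by
          rw [two_mul]; exact ENNReal.lt_add_right htop h0)
      exact ⟨C, hC, hlt.le⟩
  choose C hC hle using hex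
  refine ⟨C, hC, ?_⟩
  have hne : ∑' m, ENNReal.ofReal (C m * (Real.exp (s * (m 0 + m 1)) * ρ ^ m 2)) ≠ ⊤ := by
    refine ne_top_of_le_ne_top (ENNReal.mul_ne_top ENNReal.ofNat_ne_top hv) (b := 2 * Tot (nu K) s ρ v) ?_
    rw [Tot, ← ENNReal.tsum_mul_left]
    refine ENNReal.tsum_le_tsum fun m => ?_
    rw [ENNReal.ofReal_mul (hC m).nonneg, ← mul_assoc]
    exact mul_le_mul' (hle m) le_rfl
  refine (ENNReal.summable_toReal hne).congr fun m => ?_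
  rw [ENNReal.toReal_ofReal (mul_nonneg (hC m).nonneg (by positivity))]

/-- A convergent formal power series over `K_M` represents a `C¹`-holomorphic function. -/
theorem exists_memC {τ M : ℝ} {v : PS (Pts (KM τ M) → ℂ)} (hρ : 0 < ρ)
    (hs : 2 * Real.pi * R < s) (hv : Tot (nu (KM τ M)) s (2 * ρ) v ≠ ⊤) :
    ∃ u g h, MemC τ M R ρ u g h ∧ ∀ (x : Pts (KM τ M)) (θ ε : ℂ),
      u (x : ℂ) (θ, ε) = (2 * Real.pi * I)⁻¹ * ev θ ε (atPt x v) := by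
  obtain ⟨C, hC, hsum⟩ := exists_lift_family (by positivity) hv
  choose Φ D₁ D₂ C₀ C₁ hΦ hCle using hC
  set W : (Fin 3 →₀ ℕ) → ℝ := fun m => Real.exp (s * (m 0 + m 1)) * (2 * ρ) ^ m 2 with hW
  set μ : (Fin 3 →₀ ℕ) → ℂ × ℂ → ℂ := fun m a => (2 * Real.pi * I)⁻¹ * mono a.1 a.2 m with hμ
  have hW0 (m : Fin 3 →₀ ℕ) : 0 ≤ W m := by positivity
  have hpi : ‖(2 * Real.pi * I : ℂ)⁻¹‖ ≤ 1 := by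
    rw [norm_inv]
    refine inv_le_one_of_one_le₀ ?_
    simp only [norm_mul, Complex.norm_ofNat, norm_real, norm_I, mul_one, Real.norm_eq_abs,
      abs_of_pos Real.pi_pos]
    linarith [Real.pi_gt_three]
  have hμW (m : Fin 3 →₀ ℕ) : ∀ a ∈ SD R ρ, ‖μ m a‖ ≤ W m := fun a ha => by
    rw [hμ, hW]
    simp only [norm_mul]
    refine (mul_le_of_le_one_left (norm_nonneg _) hpi).trans ((norm_mono_le ha m).trans ?_)
    gcongr
    linarith
  have hCm (m : Fin 3 →₀ ℕ) : C₀ m ≤ C m := by linarith [hCle m, (hΦ m).nonneg']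
  have hCm' (m : Fin 3 →₀ ℕ) : C₁ m ≤ C m := by linarith [hCle m, (hΦ m).nonneg]
  have h1 := fpair_super (fun m => (hΦ m).fin.mono (hCm' m))
    (fun m q hq => ((hΦ m).bound _ hq).trans (hCm m)) hμW hW0 hsum
  have h2 := fpair_super (fun m => (hΦ m).inf.mono (hCm' m))
    (fun m ξ hξ => ((hΦ m).bound _ hξ).trans (hCm m)) hμW hW0 hsum
  have hu (p : OnePoint ℂ) (a : ℂ × ℂ) : ∑' m, Φ m p * μ m a =
      (2 * Real.pi * I)⁻¹ * ∑' m, Φ m p * mono a.1 a.2 m := by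
    rw [← tsum_mul_left]; exact tsum_congr fun m => by rw [hμ]; ring
  refine ⟨fun p a => ∑' m, Φ m p * μ m a, fun q a => ∑' m, D₁ m (q, q) * μ m a,
    fun q a => ∑' m, D₂ m (q, q) * μ m a, ⟨⟨h1.1, h2.1⟩, ⟨h1.2, h2.2⟩, fun q hq => ⟨?_, ?_⟩⟩, ?_⟩
  · intro θ ε
    simp only [hμ, mono, ek_add_one]
  · simp only [hu]
    exact (differentiableOn_super hρ hs
      (fun m => ((hΦ m).bound _ hq).trans (hCm m)) hsum).const_mul _
  · intro x θ ε
    simp only [hu, ev, coeff_atPt]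
    congr 1
    exact tsum_congr fun m => by rw [(hΦ m).ext]

end Parametrized
section Restriction
open scoped ENNReal ComplexConjugate

variable {K : Set (OnePoint ℂ)} {x : Pts K}

lemma atPt_fmul (b : ℤ → Pts K → ℂ) (w : PS (Pts K → ℂ)) :
    atPt x (fmul b w) = fmul (fun k => b k x) (atPt x w) := by
  ext m; simp only [coeff_atPt, coeff_fmul, Pi.mul_apply]

lemma atPt_dD (w : PS (Pts K → ℂ)) : atPt x (dD w) = dD (atPt x w) := by
  rw [dD, atPt_fmul]; rfl

lemma atPt_eps : atPt x eps = eps := MvPowerSeries.map_X _ _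

lemma atPt_fser (g : ℤ → ℂ) : atPt x (fser _ g) = fser ℂ g := by
  ext m; rw [coeff_atPt, coeff_fser, coeff_fser]; rfl

lemma atPt_comp (G₀ : PS (Pts K → ℂ)) (J : ℕ) (v : PS (Pts K → ℂ)) :
    atPt x (comp G₀ J v) = comp (atPt x G₀) J (atPt x v) := by
  rw [comp, comp, map_sum]
  refine Finset.sum_congr rfl fun j _ => ?_
  rw [map_mul, map_pow, tay, tay, atPt_fmul]; rfl

lemma IsSol.atPt {b : ℤ → Pts K → ℂ} {G₀ v : PS (Pts K → ℂ)} (h : IsSol b G₀ v) :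
    IsSol (fun k => b k x) (atPt x G₀) (atPt x v) := fun J => by
  have := map_dvd (KAM.atPt x) (h J)
  rwa [map_pow, atPt_eps, map_sub, atPt_fmul, map_mul, atPt_eps, atPt_comp] at this

lemma tot_atPt_le {s ρ ρ' : ℝ} (hs : 0 ≤ s) (hρ' : 0 ≤ ρ') (hρ : ρ' ≤ ρ) (v : PS (Pts K → ℂ)) :
    Tot (fun z : ℂ => ‖z‖ₑ) 0 ρ' (atPt x v) ≤ Tot (nu K) s ρ v := by
  refine ENNReal.tsum_le_tsum fun m => mul_le_mul' ?_ (ENNReal.ofReal_le_ofReal ?_)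
  · rw [coeff_atPt]; exact (ofReal_norm _).symm.trans_le (norm_le_nu _ x)
  · gcongr

lemma isDivisor_symb_apply {τ M : ℝ} (hτ : 0 ≤ τ) (hM : 1 ≤ M) (x : Pts (KM τ M)) :
    IsDivisor (Units.mk0 (x : ℂ) x.2.1) (fun k => symb (KM τ M) k x) where
  zero := by simp [symb]
  mul k hk := by
    rw [Units.val_zpow_eq_zpow_val, Units.val_mk0, symb, if_neg hk]
    exact inv_mul_cancel₀ (zpow_sub_one_ne_zero hτ hM x hk)

lemma conj_dbl_symb {τ M : ℝ} {x : Pts (KM τ M)} (hx : ‖(x : ℂ)‖ = 1)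
    (k : ℤ) : conj (dbl (symb (KM τ M)) k x) = dbl (symb (KM τ M)) (-k) x := by
  have h : conj (symb (KM τ M) k x) = symb (KM τ M) (-k) x := by
    rw [symb, symb]
    by_cases hk : k = 0
    · simp [hk]
    rw [if_neg hk, if_neg (neg_ne_zero.2 hk), map_inv₀, map_sub, map_one, map_zpow₀,
      ← Complex.inv_eq_conj hx, inv_zpow, zpow_neg]
  simp only [dbl, Pi.mul_apply, Pi.add_apply, Pi.one_apply, map_mul, map_add, map_one, h]

end Restriction
section Real
open scoped ENNReal ComplexConjugate

/-- The function represented by a convergent formal solution over a point of the unit circle is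
real-valued with zero mean, almost constant, and solves the difference equation. -/
theorem exists_real_solution {R₁ : ℝ} {F : ℂ → ℂ} (hR₁ : 0 < R₁)
    (hFper : ∀ z : ℂ, F (z + 1) = F z) (hF : DifferentiableOn ℂ F (Strip R₁))
    (hFb : ∃ C : ℝ, ∀ z ∈ Strip R₁, ‖F z‖ ≤ C) (hFreal : ∀ x : ℝ, (F (x : ℂ)).im = 0)
    (hFmean : (∫ t in (0:ℝ)..1, F t) = 0) {g : ℤ → ℂ} (hg : ∀ k, g k = 2 * Real.pi * I * four F k)
    {B : ℝ} (hB : 0 < B) (hgs : Summable fun k : ℤ => ‖g k‖ * Real.exp (B * |(k : ℝ)|))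
    {ω : ℝ} {q : ℂˣ} (hq : ∀ k : ℤ, ((q ^ k : ℂˣ) : ℂ) = ek k ω) {a : ℤ → ℂ}
    (ha : IsDivisor q a) (hb : ∀ k, conj (dbl a k) = dbl a (-k)) {w : PS ℂ}
    (hw : IsSol (dbl a) (fser ℂ g) w) {ρ β : ℝ} (hβ : 0 ≤ β) (hβB : β ≤ B)
    (h0 : ∀ ρ', 0 ≤ ρ' → ρ' ≤ ρ → Tot (fun z : ℂ => ‖z‖ₑ) 0 ρ' w ≤ ENNReal.ofReal β ∧
      Tot (fun z : ℂ => ‖z‖ₑ) 0 ρ' (dD w) ≤ ENNReal.ofReal β)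
    {ε : ℝ} (hε : |ε| < ρ) :
    ∃ r : ℝ → ℝ, (∀ θ : ℝ, (2 * Real.pi * I)⁻¹ * ev θ ε w = r θ) ∧
      (∫ t in (0:ℝ)..1, (r t : ℂ)) = 0 ∧ (∀ x y, |r x - r y| ≤ |x - y| * β) ∧
      ∀ θ : ℝ, (r (θ + ω) - 2 * r θ + r (θ - ω) : ℂ) = ε * F ((θ + r θ : ℝ) : ℂ) := by
  have hpi : (2 * Real.pi * I : ℂ) ≠ 0 := by simp [Real.pi_ne_zero, I_ne_zero]
  have hpi' : ‖(2 * Real.pi * I : ℂ)‖ = 2 * Real.pi := by simp [abs_of_pos Real.pi_pos]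
  have hε' : ‖(ε : ℂ)‖ < ρ := by rwa [Complex.norm_real]
  obtain ⟨hc, hd⟩ := h0 ‖(ε : ℂ)‖ (norm_nonneg _) hε'.le
  have hconv : Conv ε w := ne_top_of_le_ne_top ENNReal.ofReal_ne_top hc
  have hgc (k : ℤ) : conj (g k) = -g (-k) := by
    rw [hg, hg, map_mul, four_conj hFreal]
    simp [Complex.conj_ofNat]
  have hg0 : g 0 = 0 := by rw [hg, four_zero hFmean, mul_zero]
  have hcj : cj w = -w := neg_eq_iff_eq_neg.1 (IsSol.unique (hw.neg_cj hb hgc) hw)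
  have hr (θ : ℝ) : (2 * Real.pi * I)⁻¹ * ev θ ε w = ((2 * Real.pi * I)⁻¹ * ev θ ε w).re := by
    refine (Complex.conj_eq_iff_re.1 ?_).symm
    rw [map_mul, conj_ev hcj, map_inv₀, map_mul, map_mul, conj_I, conj_ofReal, conj_ofNat,
      mul_neg, mul_neg, inv_neg, neg_mul, neg_neg]
  set r : ℝ → ℝ := fun θ => ((2 * Real.pi * I)⁻¹ * ev θ ε w).re with hrdef
  have hev (θ : ℝ) : ev θ ε w = 2 * Real.pi * I * r θ := by
    rw [← hr, mul_inv_cancel_left₀ hpi]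
  refine ⟨r, hr, ?_, fun x y => ?_, fun θ => ?_⟩
  · refine (intervalIntegral.integral_congr fun t _ => (hr t).symm).trans ?_
    rw [intervalIntegral.integral_const_mul, integral_ev (mean_sol ha hw) hconv, mul_zero]
  · have h := norm_ev_sub_le hβ hconv hd x y
    rw [hev, hev, ← mul_sub, norm_mul, hpi', ← ofReal_sub, Complex.norm_real,
      mul_assoc (2 * Real.pi) |x - y|] at h
    exact le_of_mul_le_mul_left h (by positivity)
  · have h := ev_equation hB hgs hq ((h0 ρ ((norm_nonneg _).trans hε'.le) le_rfl).1.trans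
      (ENNReal.ofReal_le_ofReal hβB)) hε' (lap_sol ha (mean_fser hg0) hw) θ
    have hsum : ∑' k : ℤ, g k * ek k θ * Complex.exp (k * ev θ ε w) =
        2 * Real.pi * I * F ((θ + r θ : ℝ) : ℂ) := by
      rw [← (hasSum_four hFper hF hFb hR₁ (θ + r θ)).tsum_eq, ← tsum_mul_left]
      refine tsum_congr fun k => ?_
      rw [ofReal_add, ek_add, hg, hev, ek.eq_def k (r θ)]
      rw [show (k : ℂ) * (2 * Real.pi * I * r θ) = 2 * Real.pi * I * k * r θ by ring]
      ring
    rw [hsum, ← ofReal_add, ← ofReal_sub, hev, hev, hev] at h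
    refine mul_left_cancel₀ hpi ?_
    linear_combination h

end Real
end KAM

/-- The complexified KAM theorem for the standard family
`T_ε(x,y) = (x+y+εf(x), y+εf(x))`: there is `c > 0` (depending only on `τ, R₀, f, R`)
such that for every `M > 2ζ(1+τ)` there is `ũ_M ∈ C¹_hol(K_M, B_{R,ρ})`,
`ρ = cM⁻⁸`, such that for every `ω ∈ A_M^ℝ` and `ε ∈ (−ρ,ρ)` the function
`θ ↦ ũ_M(e^{2πiω})(θ,ε)` is real-valued with zero mean value on `𝕋`,
`θ ↦ θ + ũ_M(e^{2πiω})(θ,ε)` is injective on `ℝ`, and `u = ũ_M(e^{2πiω})(·,ε)`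
solves `u(θ+ω) − 2u(θ) + u(θ−ω) = εf(θ+u(θ))`; consequently
`γ(θ) = (θ+u(θ), ω+u(θ)−u(θ−ω))` parametrizes an invariant graph of frequency
`ω` for `T_ε`, i.e. `γ(θ+ω) = T_ε(γ(θ))`. -/
theorem complexified_KAM (τ R R₀ R₁ : ℝ) (hτ : 0 < τ) (hR : 0 < R) (hRR : R < R₀)
    (hR₁ : R₀ < R₁) (F : ℂ → ℂ)
    -- `f` is real analytic, `1`-periodic, with zero mean value, and extends
    -- holomorphically and boundedly to a neighbourhood of the closed strip `S̄_{R₀}` :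
    (hFper : ∀ z : ℂ, F (z + 1) = F z)
    (hFdiff : DifferentiableOn ℂ F (Strip R₁))
    (hFbdd : ∃ C : ℝ, ∀ z ∈ Strip R₁, ‖F z‖ ≤ C)
    (hFreal : ∀ x : ℝ, (F (x : ℂ)).im = 0)
    (hFmean : (∫ t in (0:ℝ)..1, F t) = 0) :
    ∃ c : ℝ, 0 < c ∧
      ∀ M : ℝ, 2 * zetaR (1 + τ) < M →
        ∃ u : OnePoint ℂ → ℂ × ℂ → ℂ, ∃ g h : ℂ → ℂ × ℂ → ℂ,
          MemC τ M R (c / M ^ 8) u g h ∧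
          ∀ ω ∈ AMR τ M, ∀ ε : ℝ, |ε| < c / M ^ 8 →
            -- real-valued on `𝕋` :
            (∀ θ : ℝ, (u ((Efn (ω : ℂ)) : OnePoint ℂ) ((θ : ℂ), (ε : ℂ))).im = 0) ∧
            -- zero mean value:
            (∫ t in (0:ℝ)..1, u ((Efn (ω : ℂ)) : OnePoint ℂ) ((t : ℂ), (ε : ℂ))) = 0 ∧
            -- `θ ↦ θ + u(θ)` is injective on `ℝ` :
            Function.Injective (fun θ : ℝ =>
              θ + (u ((Efn (ω : ℂ)) : OnePoint ℂ) ((θ : ℂ), (ε : ℂ))).re) ∧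
            -- the second-order difference equation `Δu = εf(id+u)` :
            (∀ θ : ℝ,
              u ((Efn (ω : ℂ)) : OnePoint ℂ) (((θ : ℂ) + (ω : ℂ)), (ε : ℂ)) -
                  2 * u ((Efn (ω : ℂ)) : OnePoint ℂ) ((θ : ℂ), (ε : ℂ)) +
                  u ((Efn (ω : ℂ)) : OnePoint ℂ) (((θ : ℂ) - (ω : ℂ)), (ε : ℂ)) =
                (ε : ℂ) * F ((θ : ℂ) + u ((Efn (ω : ℂ)) : OnePoint ℂ) ((θ : ℂ), (ε : ℂ)))) ∧
            -- consequently `γ(θ) = (θ+u(θ), ω+u(θ)−u(θ−ω))` parametrizes an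
            -- invariant graph of frequency `ω` for `T_ε` :
            (∀ Uf Vf : ℝ → ℝ,
              (∀ θ : ℝ, Uf θ =
                θ + (u ((Efn (ω : ℂ)) : OnePoint ℂ) ((θ : ℂ), (ε : ℂ))).re) →
              (∀ θ : ℝ, Vf θ =
                ω + (u ((Efn (ω : ℂ)) : OnePoint ℂ) ((θ : ℂ), (ε : ℂ))).re -
                  (u ((Efn (ω : ℂ)) : OnePoint ℂ) (((θ : ℂ) - (ω : ℂ)), (ε : ℂ))).re) →
              ∀ θ : ℝ,
                Uf (θ + ω) = Uf θ + Vf θ + ε * (F ((Uf θ : ℝ) : ℂ)).re ∧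
                Vf (θ + ω) = Vf θ + ε * (F ((Uf θ : ℝ) : ℂ)).re) := by
  set s₀ := 2 * Real.pi * (R + R₀) / 2 with hs₀
  set B := 2 * Real.pi * (R₀ - R) / 4 with hBdef
  have hB : 0 < B := by
    have : 0 < R₀ - R := by linarith
    positivity
  set δ₀ := min 1 (B / 12) with hδ₀
  have hδ : 0 < δ₀ := by positivity
  have hδB : δ₀ ≤ B / 12 := min_le_right _ _
  have hπR : 0 < 2 * Real.pi * R := by positivity
  have hs : 2 * Real.pi * R < s₀ - 6 * δ₀ := by linarith
  set β := min (1 / 10) B with hβdef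
  have hβ : 0 < β := by positivity
  set G : ℤ → ℂ := fun k => 2 * Real.pi * I * KAM.four F k with hG
  have hGs : Summable fun k : ℤ => ‖G k‖ * Real.exp ((s₀ + B) * |(k : ℝ)|) := by
    refine Summable.of_nonneg_of_le (fun k => by positivity) (fun k => ?_)
      ((KAM.summable_four hFper hFdiff hFbdd (hR.trans hRR).le hR₁).mul_left
        ‖(2 * Real.pi * I : ℂ)‖)
    rw [hG, norm_mul, mul_assoc]
    gcongr
    linarith
  have hGsB : Summable fun k : ℤ => ‖G k‖ * Real.exp (B * |(k : ℝ)|) := by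
    refine Summable.of_nonneg_of_le (fun k => by positivity) (fun k => ?_) hGs
    gcongr
    linarith
  have hG0 : G 0 = 0 := by rw [hG]; simp [KAM.four_zero hFmean]
  obtain ⟨c, hc, hbound⟩ := KAM.exists_bound hτ.le hG0 hδ (min_le_left _ _) hB hβ
    (min_le_left _ _) (min_le_right _ _) hGs
  refine ⟨c, hc, fun M hM => ?_⟩
  have hM1 : 1 ≤ M := KAM.one_le_of_zetaR hτ hM
  set v := KAM.sol (KAM.dbl (KAM.symb (KM τ M))) (KAM.fser _ G) with hv
  have hsol : KAM.IsSol (KAM.dbl (KAM.symb (KM τ M))) (KAM.fser _ G) v := KAM.isSol_sol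
  obtain ⟨hb0, hb1⟩ := hbound M hM1 v hsol
  have hρ : 0 < c / M ^ 8 := by positivity
  obtain ⟨u, g, h, hmem, hu⟩ := KAM.exists_memC hρ hs (ne_top_of_le_ne_top ENNReal.ofReal_ne_top hb0)
  refine ⟨u, g, h, hmem, fun ω hω ε hε => ?_⟩
  have hq : Efn ω ∈ finPart (KM τ M) := KAM.mem_finPart.2 (.inr ⟨ω, ⟨ω, hω, by simp⟩, rfl⟩)
  let x : KAM.Pts (KM τ M) := ⟨Efn ω, KAM.Efn_ne_zero _, hq⟩
  have hx : ‖(x : ℂ)‖ = 1 := by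
    change ‖Complex.exp _‖ = 1
    rw [Complex.norm_exp]; simp
  have hxk (k : ℤ) : ((Units.mk0 (x : ℂ) x.2.1 ^ k : ℂˣ) : ℂ) = ek k ω := by
    rw [Units.val_zpow_eq_zpow_val, Units.val_mk0, ek]
    change Complex.exp _ ^ k = _
    rw [← Complex.exp_int_mul]; congr 1; ring
  have hw := hsol.atPt (x := x)
  rw [KAM.atPt_fser] at hw
  obtain ⟨r, hr, hmean, hlip, heq⟩ := KAM.exists_real_solution (hR.trans (hRR.trans hR₁)) hFper
    hFdiff hFbdd hFreal hFmean (fun _ => rfl) hB hGsB hxk (KAM.isDivisor_symb_apply hτ.le hM1 x)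
    (KAM.conj_dbl_symb hx) hw (ρ := 2 * (c / M ^ 8)) hβ.le (min_le_right _ _)
    (fun ρ' h0 h1 => ⟨(KAM.tot_atPt_le (by linarith) h0 h1 v).trans hb0, by
      rw [← KAM.atPt_dD]; exact (KAM.tot_atPt_le (by linarith) h0 h1 _).trans hb1⟩)
    (hε.trans (by linarith))
  have hur (θ : ℝ) : u (Efn (ω : ℂ) : OnePoint ℂ) ((θ : ℂ), (ε : ℂ)) = r θ := (hu x θ ε).trans (hr θ)
  have hFr (θ : ℝ) : F (θ : ℂ) = ((F (θ : ℂ)).re : ℂ) := (Complex.conj_eq_iff_re.1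
    (Complex.conj_eq_iff_im.2 (hFreal θ))).symm
  have heqr (θ : ℝ) : r (θ + ω) - 2 * r θ + r (θ - ω) = ε * (F ((θ + r θ : ℝ) : ℂ)).re := by
    have := heq θ
    rw [hFr] at this
    exact_mod_cast this
  simp only [← ofReal_add, ← ofReal_sub, hur, ofReal_re, ofReal_im]
  refine ⟨fun _ => trivial, hmean, fun a b hab => ?_, fun θ => ?_, fun Uf Vf hU hV θ => ?_⟩
  · have h1 : |r a - r b| ≤ |a - b| * (1 / 10) :=
      (hlip a b).trans (by gcongr; exact min_le_left _ _)
    have h2 : r a - r b = -(a - b) := by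
      have : a + r a = b + r b := hab
      linarith
    rw [h2, abs_neg] at h1
    have h3 : |a - b| = 0 := le_antisymm (by linarith) (abs_nonneg _)
    exact sub_eq_zero.1 (abs_eq_zero.1 h3)
  · have := heq θ
    push_cast at this ⊢
    exact this
  · have h1 := heqr θ
    rw [hU, hU, hV, hV, add_sub_cancel_right]
    constructor <;> linarith
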